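/- arXiv:2401.08071 — 2 statements merged into one kernel-verified Lean document; each statement's English description precedes it below -/
import Mathlib

section
/- Let u be a local minimizer of J in B₁ with 0 ≤ u ≤ 1, under assumption (H1), and assume δ(x) ≥ δ₀ > 0 on B₁. Suppose there exist C̃ > 0 and a nondecreasing ω : (0,1] → [0,∞) such that |γ(x) − γ(y)| ≤ ω(|x − y|) for all x, y ∈ B₁ with x ≠ y, ω(1) ≤ C̃, and there is t₀ ∈ (0,1) with ω(t)·ln(1/t) ≤ C̃ for all t ∈ (0,t₀). Then the free boundary F(u) ∩ B_{1/2} is porous: there exist κ ∈ (0,1) and r₀ > 0 such that for every r ∈ (0,r₀] and every z ∈ F(u) ∩ B_{1/2} there exists y ∈ ℝⁿ with B_{κ r}(y) ⊆ B_r(z) ∖ F(u). -/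
open Metric MeasureTheory Set Real

noncomputable section

/-- The energy functional `J(v, O) = ∫_O ( ½|Dv|² + δ(x) (v⁺)^{γ(x)} ) dx`,
where the gradient is the a.e.-defined gradient of a Lipschitz function
(realized via `gradient`, which vanishes at points of non-differentiability). -/
def energyJ {n : ℕ} (δ γ u : EuclideanSpace ℝ (Fin n) → ℝ)
    (O : Set (EuclideanSpace ℝ (Fin n))) : ℝ :=
  ∫ x in O, ((1:ℝ)/2 * ‖gradient u x‖ ^ 2 + δ x * (max (u x) 0) ^ (γ x))

/-- A Lipschitz function `u` is a local minimizer of `J` in the unit ball `B₁` if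
`J(u,B₁) ≤ J(v,B₁)` for every Lipschitz `v` such that `{v ≠ u}` is contained in a
compact subset of `B₁`. -/
def IsLocalMinimizer {n : ℕ} (δ γ u : EuclideanSpace ℝ (Fin n) → ℝ) : Prop :=
  (∃ K, LipschitzWith K u) ∧
  ∀ v : EuclideanSpace ℝ (Fin n) → ℝ, (∃ K, LipschitzWith K v) →
    (∃ K : Set (EuclideanSpace ℝ (Fin n)), IsCompact K ∧
        K ⊆ ball (0 : EuclideanSpace ℝ (Fin n)) 1 ∧ {x | v x ≠ u x} ⊆ K) →
    energyJ δ γ u (ball (0 : EuclideanSpace ℝ (Fin n)) 1) ≤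
      energyJ δ γ v (ball (0 : EuclideanSpace ℝ (Fin n)) 1)

/-- The free boundary `F(u) = ∂{x ∈ B₁ : u(x) > 0} ∩ B₁`. -/
def freeBoundary {n : ℕ} (u : EuclideanSpace ℝ (Fin n) → ℝ) :
    Set (EuclideanSpace ℝ (Fin n)) :=
  frontier {x ∈ ball (0 : EuclideanSpace ℝ (Fin n)) 1 | 0 < u x} ∩
    ball (0 : EuclideanSpace ℝ (Fin n)) 1

section Aux

abbrev Eu (n : ℕ) := EuclideanSpace ℝ (Fin n)

variable {n : ℕ}


lemma grad_norm_le {K : NNReal} {u : Eu n → ℝ} (hu : LipschitzWith K u) (x : Eu n) :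
    ‖gradient u x‖ ≤ K := by
  unfold gradient
  rw [LinearIsometryEquiv.norm_map]
  exact norm_fderiv_le_of_lipschitz ℝ hu

lemma grad_meas (u : Eu n → ℝ) : Measurable (gradient u) := by
  unfold gradient
  exact (InnerProductSpace.toDual ℝ (Eu n)).symm.continuous.measurable.comp (measurable_fderiv ℝ u)

lemma grad_add {u v : Eu n → ℝ} {x : Eu n} (hu : DifferentiableAt ℝ u x)
    (hv : DifferentiableAt ℝ v x) :
    gradient (fun y => u y + v y) x = gradient u x + gradient v x := by
  unfold gradient
  rw [fderiv_fun_add hu hv, map_add]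

lemma grad_const_mul (t : ℝ) (u : Eu n → ℝ) (x : Eu n) (hu : DifferentiableAt ℝ u x) :
    gradient (fun y => t * u y) x = t • gradient u x := by
  unfold gradient
  rw [fderiv_const_mul hu, map_smul]

lemma grad_zero_of_nonneg {w : Eu n → ℝ} (h0 : ∀ x, 0 ≤ w x) {x : Eu n} (hx : w x = 0) :
    gradient w x = 0 := by
  unfold gradient
  have : IsLocalMin w x := Filter.Eventually.of_forall (fun y => by rw [hx]; exact h0 y)
  rw [this.fderiv_eq_zero, map_zero]

lemma pow_bd {a g : ℝ} (ha : 0 ≤ a) (hg : 0 ≤ g) (hg1 : g ≤ 1) : a ^ g ≤ 1 + a := by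
  rcases le_total a 1 with h | h
  · have := Real.rpow_le_one ha h hg
    linarith
  · have := Real.rpow_le_rpow_of_exponent_le h hg1
    rw [Real.rpow_one] at this
    linarith

lemma integrableOn_of_bdd {f : Eu n → ℝ} (hf : AEStronglyMeasurable f volume)
    {C : ℝ} (hC : ∀ x ∈ ball (0 : Eu n) 1, |f x| ≤ C) :
    IntegrableOn f (ball (0 : Eu n) 1) := by
  refine Measure.integrableOn_of_bounded (M := C) measure_ball_lt_top.ne hf ?_
  filter_upwards [ae_restrict_mem measurableSet_ball] with x hx
  exact hC x hx

lemma pot_integrable {δ γ v : Eu n → ℝ} (hδm : Measurable δ) (hγm : Measurable γ)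
    {M : ℝ} (hδbd : ∀ x, |δ x| ≤ M) (hγ0 : ∀ x ∈ ball (0 : Eu n) 1, 0 < γ x)
    (hγ1 : ∀ x ∈ ball (0 : Eu n) 1, γ x ≤ 1) {K : NNReal} (hv : LipschitzWith K v) :
    IntegrableOn (fun x => δ x * (max (v x) 0) ^ (γ x)) (ball (0 : Eu n) 1) := by
  have hm : Measurable (fun x => δ x * (max (v x) 0) ^ (γ x)) :=
    hδm.mul ((hv.continuous.measurable.max measurable_const).pow hγm)
  refine integrableOn_of_bdd hm.aestronglyMeasurable (C := M * (1 + (|v 0| + K))) ?_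
  intro x hx
  have hp : 0 ≤ max (v x) 0 := le_max_right _ _
  have h1 : max (v x) 0 ≤ |v 0| + K := by
    apply max_le _ (by positivity)
    have := hv.dist_le_mul x 0
    rw [Real.dist_eq] at this
    have h2 : dist x 0 < 1 := hx
    have h3 : (K : ℝ) * dist x 0 ≤ K := by nlinarith [K.coe_nonneg]
    have := le_abs_self (v x - v 0)
    have := le_abs_self (v 0)
    linarith
  have h2 := pow_bd hp (hγ0 x hx).le (hγ1 x hx)
  rw [abs_mul, abs_of_nonneg (Real.rpow_nonneg hp _)]
  have hM : 0 ≤ M := (abs_nonneg _).trans (hδbd x)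
  exact mul_le_mul (hδbd x) (by linarith) (Real.rpow_nonneg hp _) hM

lemma gradsq_integrable {v : Eu n → ℝ} {K : NNReal} (hv : LipschitzWith K v) :
    IntegrableOn (fun x => (1:ℝ)/2 * ‖gradient v x‖ ^ 2) (ball (0 : Eu n) 1) := by
  refine integrableOn_of_bdd (((grad_meas v).norm.pow_const 2).const_mul _).aestronglyMeasurable
    (C := K ^ 2) ?_
  intro x hx
  have := grad_norm_le hv x
  have h0 := norm_nonneg (gradient v x)
  rw [abs_of_nonneg (by positivity)]
  nlinarith

lemma inner_integrable {u v : Eu n → ℝ} {K L : NNReal} (hu : LipschitzWith K u)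
    (hv : LipschitzWith L v) :
    IntegrableOn (fun x => inner ℝ (gradient u x) (gradient v x)) (ball (0 : Eu n) 1) := by
  refine integrableOn_of_bdd ((grad_meas u).inner (grad_meas v)).aestronglyMeasurable
    (C := K * L) ?_
  intro x hx
  refine (abs_real_inner_le_norm _ _).trans ?_
  exact mul_le_mul (grad_norm_le hu x) (grad_norm_le hv x) (norm_nonneg _) K.coe_nonneg

/-- first variation inequality, in integrated form -/
lemma basic_var {δ γ u φ : Eu n → ℝ} (hδm : Measurable δ) (hγm : Measurable γ)
    {M : ℝ} (hδbd : ∀ x, |δ x| ≤ M) (hγ0 : ∀ x ∈ ball (0 : Eu n) 1, 0 < γ x)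
    (hγ1 : ∀ x ∈ ball (0 : Eu n) 1, γ x ≤ 1) (humin : IsLocalMinimizer δ γ u)
    {K L : NNReal} (hu : LipschitzWith K u) (hφ : LipschitzWith L φ) {p : Eu n} {s : ℝ}
    (hps : closedBall p s ⊆ ball 0 1) (hsupp : ∀ x, x ∉ closedBall p s → φ x = 0)
    {H : Eu n → ℝ} (hH : IntegrableOn H (ball 0 1))
    (hle : ∀ᵐ x, x ∈ ball (0 : Eu n) 1 → inner ℝ (gradient u x) (gradient φ x)
      + (1:ℝ)/2 * ‖gradient φ x‖ ^ 2
      + δ x * ((max (u x + φ x) 0) ^ (γ x) - (max (u x) 0) ^ (γ x)) ≤ H x) :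
    0 ≤ ∫ x in ball (0 : Eu n) 1, H x := by
  have hv : LipschitzWith (K + L) (fun x => u x + φ x) := hu.add hφ
  have h1 := humin.2 (fun x => u x + φ x) ⟨_, hv⟩ ⟨closedBall p s, isCompact_closedBall p s, hps, by
    intro x hx
    by_contra h
    exact hx (by simp [hsupp x h])⟩
  unfold energyJ at h1
  have i1 : IntegrableOn _ (ball (0 : Eu n) 1) :=
    (gradsq_integrable hu).add (pot_integrable hδm hγm hδbd hγ0 hγ1 hu)
  have i2 : IntegrableOn _ (ball (0 : Eu n) 1) :=
    (gradsq_integrable hv).add (pot_integrable hδm hγm hδbd hγ0 hγ1 hv)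
  have h2 := integral_sub i2 i1
  have h3 : 0 ≤ ∫ x in ball (0 : Eu n) 1, (((1:ℝ)/2 * ‖gradient (fun x => u x + φ x) x‖ ^ 2 + δ x * (max (u x + φ x) 0) ^ (γ x)) - ((1:ℝ)/2 * ‖gradient u x‖ ^ 2 + δ x * (max (u x) 0) ^ (γ x))) := by
    have h2' := h2
    simp only [Pi.add_apply] at h2'
    rw [h2']
    linarith
  refine h3.trans (integral_mono_ae (i2.sub i1) hH ?_)
  rw [Filter.EventuallyLE, ae_restrict_iff' measurableSet_ball]
  filter_upwards [hle, hu.ae_differentiableAt, hφ.ae_differentiableAt] with x hx hx1 hx2 hxB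
  refine le_trans (le_of_eq ?_) (hx hxB)
  rw [grad_add hx1 hx2, norm_add_sq_real]
  ring

def qf (p : Eu n) (s : ℝ) (x : Eu n) : ℝ := (min ‖x - p‖ s) ^ 2

lemma qf_lip (p : Eu n) {s : ℝ} (hs : 0 ≤ s) : LipschitzWith (Real.toNNReal (2 * s)) (qf p s) := by
  apply LipschitzWith.of_dist_le_mul
  intro x y
  rw [Real.coe_toNNReal _ (by positivity), Real.dist_eq]
  unfold qf
  set a := min ‖x - p‖ s with ha
  set b := min ‖y - p‖ s with hb
  have ha0 : 0 ≤ a := le_min (norm_nonneg _) hs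
  have hb0 : 0 ≤ b := le_min (norm_nonneg _) hs
  have ha1 : a ≤ s := min_le_right _ _
  have hb1 : b ≤ s := min_le_right _ _
  have h1 : |a - b| ≤ dist x y := by
    have h2 : |a - b| ≤ max |‖x - p‖ - ‖y - p‖| |s - s| := abs_min_sub_min_le_max _ _ _ _
    rw [sub_self, abs_zero, max_eq_left (abs_nonneg _)] at h2
    refine h2.trans ((abs_norm_sub_norm_le _ _).trans ?_)
    rw [dist_eq_norm]
    simp
  have h3 : a ^ 2 - b ^ 2 = (a + b) * (a - b) := by ring
  rw [h3, abs_mul, abs_of_nonneg (add_nonneg ha0 hb0)]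
  exact mul_le_mul (by linarith) h1 (abs_nonneg _) (by positivity)

lemma qf_grad (p : Eu n) {s : ℝ} {x : Eu n} (hx : ‖x - p‖ < s) :
    HasGradientAt (qf p s) ((2:ℝ) • (x - p)) x := by
  have h1 : HasGradientAt (fun y : Eu n => ‖y - p‖ ^ 2) ((2:ℝ) • (x - p)) x := by
    rw [hasGradientAt_iff_hasFDerivAt]
    have := ((hasFDerivAt_id x).sub_const p).norm_sq
    have e : (InnerProductSpace.toDual ℝ (Eu n)) ((2:ℝ) • (x - p))
        = 2 • (innerSL ℝ) (x - p) ∘SL ContinuousLinearMap.id ℝ (Eu n) := by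
      ext v
      simp
    rw [e]
    exact this
  refine h1.congr_of_eventuallyEq ?_
  have : ∀ᶠ y in nhds x, ‖y - p‖ < s :=
    (isOpen_lt (by fun_prop) continuous_const).mem_nhds hx
  filter_upwards [this] with y hy
  simp [qf, min_eq_left hy.le]

lemma qf_le (p : Eu n) {s : ℝ} (hs : 0 ≤ s) (x : Eu n) : qf p s x ≤ s ^ 2 := by
  unfold qf
  have : 0 ≤ min ‖x - p‖ s := le_min (norm_nonneg _) hs
  have : min ‖x - p‖ s ≤ s := min_le_right _ _
  gcongr

lemma qf_out (p : Eu n) {s : ℝ} {x : Eu n} (hx : s ≤ ‖x - p‖) : qf p s x = s ^ 2 := by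
  simp [qf, min_eq_right hx]

lemma qf_nonneg (p : Eu n) (s : ℝ) (x : Eu n) : 0 ≤ qf p s x := sq_nonneg _

def cut (p : Eu n) (s : ℝ) (x : Eu n) : ℝ := 1 / 2 + (-(1 / (2 * s ^ 2))) * qf p s x

lemma cut_nonneg (p : Eu n) {s : ℝ} (hs : 0 < s) (x : Eu n) : 0 ≤ cut p s x := by
  have h := qf_le p hs.le x
  have : (1 / (2 * s ^ 2)) * qf p s x ≤ (1 / (2 * s ^ 2)) * s ^ 2 := by gcongr
  have h2 : (1 / (2 * s ^ 2)) * s ^ 2 = 1 / 2 := by field_simp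
  unfold cut
  linarith

lemma cut_le (p : Eu n) {s : ℝ} (hs : 0 < s) (x : Eu n) : cut p s x ≤ 1 := by
  have h := qf_nonneg p s x
  have : 0 ≤ (1 / (2 * s ^ 2)) * qf p s x := by positivity
  unfold cut
  linarith

lemma cut_out (p : Eu n) {s : ℝ} (hs : 0 < s) {x : Eu n} (hx : s ≤ ‖x - p‖) : cut p s x = 0 := by
  unfold cut
  rw [qf_out p hx]
  field_simp
  ring

lemma cut_lip (p : Eu n) {s : ℝ} (hs : 0 < s) : ∃ L : NNReal, LipschitzWith L (cut p s) := by
  have h := (LipschitzWith.const (1 / 2 : ℝ) (α := Eu n)).add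
    ((lipschitzWith_smul (-(1 / (2 * s ^ 2)) : ℝ)).comp (qf_lip p hs.le))
  exact ⟨_, h⟩

lemma cut_grad_in (p : Eu n) {s : ℝ} (hs : 0 < s) {x : Eu n} (hx : ‖x - p‖ < s) :
    gradient (cut p s) x = (-(1 / s ^ 2)) • (x - p) := by
  have h1 := (qf_grad p hx).differentiableAt
  have h2 := grad_add (u := fun _ => (1/2:ℝ)) (v := fun y => (-(1 / (2 * s ^ 2))) * qf p s y) (x := x)
    (by fun_prop) (h1.const_mul _)
  have h3 : cut p s = fun y => (1/2:ℝ) + (-(1 / (2 * s ^ 2))) * qf p s y := rfl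
  rw [h3, h2, gradient_fun_const, grad_const_mul _ _ _ h1, (qf_grad p hx).gradient, zero_add, smul_smul]
  congr 1
  field_simp

lemma cut_grad_out (p : Eu n) {s : ℝ} (hs : 0 < s) {x : Eu n} (hx : s ≤ ‖x - p‖) :
    gradient (cut p s) x = 0 :=
  grad_zero_of_nonneg (cut_nonneg p hs) (cut_out p hs hx)

lemma cut_grad_norm (p : Eu n) {s : ℝ} (hs : 0 < s) (x : Eu n) :
    ‖gradient (cut p s) x‖ ^ 2 ≤ (ball p s).indicator (fun _ => 1 / s ^ 2) x := by
  by_cases hx : ‖x - p‖ < s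
  · rw [indicator_of_mem (by simpa [dist_eq_norm] using hx), cut_grad_in p hs hx, norm_smul, mul_pow]
    have h0 := norm_nonneg (x - p)
    have : ‖x - p‖ ^ 2 ≤ s ^ 2 := by gcongr
    calc ‖-(1 / s ^ 2)‖ ^ 2 * ‖x - p‖ ^ 2 ≤ ‖-(1 / s ^ 2)‖ ^ 2 * s ^ 2 := by gcongr
      _ = 1 / s ^ 2 := by
        rw [norm_neg, Real.norm_of_nonneg (by positivity)]
        field_simp
  · rw [cut_grad_out p hs (not_lt.mp hx)]
    simp only [norm_zero]
    rw [zero_pow two_ne_zero]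
    exact indicator_nonneg (fun _ _ => by positivity) _

lemma cov (f : Eu n → ℝ) (x : Eu n) {s : ℝ} (hs : 0 < s) :
    ∫ y in ball (0 : Eu n) 1, f (x + s • y) = (s ^ n)⁻¹ * ∫ ξ in ball x s, f ξ := by
  rw [← integral_indicator measurableSet_ball, ← integral_indicator measurableSet_ball]
  have h1 : ∀ y, (ball (0 : Eu n) 1).indicator (fun y => f (x + s • y)) y
      = (fun z => (ball x s).indicator f (x + z)) (s • y) := by
    intro y
    have : y ∈ ball (0 : Eu n) 1 ↔ x + s • y ∈ ball x s := by
      simp only [mem_ball, dist_eq_norm, sub_zero, add_sub_cancel_left, norm_smul,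
        Real.norm_of_nonneg hs.le]
      constructor
      · intro h; nlinarith
      · intro h; by_contra hh; nlinarith
    by_cases hy : y ∈ ball (0 : Eu n) 1
    · simp only [indicator_of_mem hy, indicator_of_mem (this.mp hy)]
    · simp only [indicator_of_notMem hy, indicator_of_notMem (fun h => hy (this.mpr h))]
  simp_rw [h1]
  rw [Measure.integral_comp_smul_of_nonneg _ (fun z => (ball x s).indicator f (x + z)) s (hR := hs.le)]
  rw [integral_add_left_eq_self (μ := volume) ((ball x s).indicator f) x]
  simp

def Gm (u : Eu n → ℝ) (x : Eu n) (s : ℝ) : ℝ := ∫ y in ball (0 : Eu n) 1, u (x + s • y)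

lemma Gm_intg {u : Eu n → ℝ} (hu : Continuous u) (x : Eu n) (s : ℝ) :
    IntegrableOn (fun y => u (x + s • y)) (ball (0 : Eu n) 1) :=
  ((by fun_prop : Continuous (fun y => u (x + s • y))).continuousOn.integrableOn_compact
    (isCompact_closedBall 0 1)).mono_set ball_subset_closedBall

lemma Gm_lip {u : Eu n → ℝ} {K : NNReal} (hu : LipschitzWith K u) (x : Eu n) {y : Eu n}
    (hy : y ∈ ball (0 : Eu n) 1) : LipschitzWith K (fun s : ℝ => u (x + s • y)) := by
  apply LipschitzWith.of_dist_le_mul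
  intro a b
  refine (hu.dist_le_mul _ _).trans ?_
  gcongr
  rw [dist_eq_norm, dist_eq_norm, add_sub_add_left_eq_sub, ← sub_smul, norm_smul]
  have : ‖y‖ < 1 := by simpa using hy
  nlinarith [norm_nonneg (a - b)]

lemma Gm_deriv {u : Eu n → ℝ} {K : NNReal} (hu : LipschitzWith K u) (x : Eu n) {s : ℝ}
    (hs : 0 < s) :
    HasDerivAt (Gm u x) (∫ y in ball (0 : Eu n) 1, inner ℝ (gradient u (x + s • y)) y) s := by
  have hae : ∀ᵐ y : Eu n, DifferentiableAt ℝ u (x + s • y) := by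
    have h0 := hu.ae_differentiableAt (μ := (volume : Measure (Eu n)))
    have h1 : ∀ᵐ y : Eu n, DifferentiableAt ℝ u (x + y) :=
      (measurePreserving_add_left (volume : Measure (Eu n)) x).quasiMeasurePreserving.ae h0
    exact (Measure.quasiMeasurePreserving_smul volume hs.ne').ae h1
  have := hasDerivAt_integral_of_dominated_loc_of_lip (𝕜 := ℝ)
    (μ := volume.restrict (ball (0 : Eu n) 1))
    (F := fun s y => u (x + s • y)) (x₀ := s) (s := univ)
    (F' := fun y => inner ℝ (gradient u (x + s • y)) y) (bound := fun _ => (K : ℝ))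
    Filter.univ_mem
    (Filter.Eventually.of_forall fun t => (Gm_intg hu.continuous x t).aestronglyMeasurable)
    (Gm_intg hu.continuous x s)
    ((((grad_meas u).comp (by fun_prop : Measurable (fun y : Eu n => x + s • y))).inner
      measurable_id).aestronglyMeasurable)
    (by
      filter_upwards [ae_restrict_mem measurableSet_ball] with y hy
      simpa using Gm_lip hu x hy)
    (integrableOn_const measure_ball_lt_top.ne)
    (by
      filter_upwards [ae_restrict_of_ae hae] with y hy
      have h1 : HasDerivAt (fun t : ℝ => x + t • y) y s := by
        simpa using ((hasDerivAt_id s).smul_const y).const_add x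
      have h2 := hy.hasFDerivAt.comp_hasDerivAt s h1
      rw [← inner_gradient_left (𝕜 := ℝ)] at h2
      exact h2)
  exact this.2

lemma Gm_deriv' {u : Eu n → ℝ} {K : NNReal} (hu : LipschitzWith K u) (x : Eu n) {s : ℝ}
    (hs : 0 < s) (hsub : ball x s ⊆ ball 0 1) :
    HasDerivAt (Gm u x) (-((s ^ n)⁻¹ * s *
      ∫ y in ball (0 : Eu n) 1, inner ℝ (gradient u y) (gradient (cut x s) y))) s := by
  convert Gm_deriv hu x hs using 1
  have h1 : ∀ y : Eu n, inner ℝ (gradient u (x + s • y)) y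
     = (fun ξ => inner ℝ (gradient u ξ) ((1 / s) • (ξ - x))) (x + s • y) := by
    intro y
    simp only [add_sub_cancel_left, smul_smul]
    rw [one_div_mul_cancel hs.ne', one_smul]
  simp_rw [h1]
  rw [cov (fun ξ => inner ℝ (gradient u ξ) ((1 / s) • (ξ - x))) x hs]
  have h2 : ∫ y in ball (0 : Eu n) 1, inner ℝ (gradient u y) (gradient (cut x s) y)
      = ∫ y in ball x s, inner ℝ (gradient u y) (gradient (cut x s) y) := by
    refine setIntegral_eq_of_subset_of_forall_sdiff_eq_zero measurableSet_ball hsub ?_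
    intro y hy
    have : s ≤ ‖y - x‖ := by simpa [dist_eq_norm] using hy.2
    rw [cut_grad_out x hs this, inner_zero_right]
  have h3 : ∫ y in ball x s, inner ℝ (gradient u y) (gradient (cut x s) y)
      = ∫ y in ball x s, (-(1/s)) * inner ℝ (gradient u y) ((1 / s) • (y - x)) := by
    refine setIntegral_congr_fun measurableSet_ball ?_
    intro y hy
    have : ‖y - x‖ < s := by simpa [dist_eq_norm] using hy
    simp only
    rw [cut_grad_in x hs this, inner_smul_right, inner_smul_right]
    field_simp
  rw [h2, h3, integral_const_mul]
  field_simp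

lemma Gm_cont {u : Eu n → ℝ} {K : NNReal} (hu : LipschitzWith K u) (x : Eu n) :
    Continuous (Gm u x) := by
  have : LipschitzWith (K * (volume (ball (0 : Eu n) 1)).toNNReal) (Gm u x) := by
    apply LipschitzWith.of_dist_le_mul
    intro a b
    unfold Gm
    rw [dist_eq_norm, ← integral_sub (Gm_intg hu.continuous x a) (Gm_intg hu.continuous x b)]
    have := norm_setIntegral_le_of_norm_le_const (μ := volume) (s := ball (0 : Eu n) 1)
      (f := fun y => u (x + a • y) - u (x + b • y)) (C := K * dist a b) measure_ball_lt_top (by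
        intro y hy
        have := (Gm_lip hu x hy).dist_le_mul a b
        rwa [dist_eq_norm] at this)
    refine this.trans (le_of_eq ?_)
    simp only [NNReal.coe_mul, Measure.real, ENNReal.coe_toNNReal_eq_toReal]
    ring
  exact this.continuous

lemma Gm_zero (u : Eu n → ℝ) (x : Eu n) : Gm u x 0 = volume.real (ball (0 : Eu n) 1) * u x := by
  simp [Gm]

structure Hyp (δ γ u : Eu n → ℝ) (M g d0 : ℝ) (K : NNReal) : Prop where
  δm : Measurable δ
  γm : Measurable γ
  δbd : ∀ x, |δ x| ≤ M
  g0 : 0 < g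
  γlow : ∀ x ∈ ball (0 : Eu n) 1, g ≤ γ x
  γ1 : ∀ x ∈ ball (0 : Eu n) 1, γ x ≤ 1
  d0pos : 0 < d0
  δlow : ∀ x ∈ ball (0 : Eu n) 1, d0 ≤ δ x
  umin : IsLocalMinimizer δ γ u
  lip : LipschitzWith K u
  unn : ∀ x ∈ ball (0 : Eu n) 1, 0 ≤ u x


variable {δ γ u : Eu n → ℝ} {M g d0 : ℝ} {K : NNReal}

lemma Hyp.γpos (h : Hyp δ γ u M g d0 K) : ∀ x ∈ ball (0 : Eu n) 1, 0 < γ x :=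
  fun x hx => h.g0.trans_le (h.γlow x hx)

lemma sub_harm (h : Hyp δ γ u M g d0 K) {p : Eu n} {s : ℝ} (hs : 0 < s)
    (hps : closedBall p s ⊆ ball 0 1) :
    ∫ y in ball (0 : Eu n) 1, inner ℝ (gradient u y) (gradient (cut p s) y) ≤ 0 := by
  obtain ⟨L, hL⟩ := cut_lip p hs
  set A := ∫ y in ball (0 : Eu n) 1, inner ℝ (gradient u y) (gradient (cut p s) y) with hA
  set B := ∫ y in ball (0 : Eu n) 1, (1:ℝ)/2 * ‖gradient (cut p s) y‖ ^ 2 with hB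
  have hB0 : 0 ≤ B := integral_nonneg (fun y => by positivity)
  have iA := inner_integrable h.lip hL
  have iB := gradsq_integrable hL
  have key : ∀ t : ℝ, 0 < t → 0 ≤ -t * A + t ^ 2 * B := by
    intro t ht
    have hφ : LipschitzWith _ (fun x => (-t) * cut p s x) := (lipschitzWith_smul (-t)).comp hL
    have h1 := basic_var (H := fun x => (-t) * inner ℝ (gradient u x) (gradient (cut p s) x)
        + t ^ 2 * ((1:ℝ)/2 * ‖gradient (cut p s) x‖ ^ 2)) h.δm h.γm h.δbd h.γpos h.γ1 h.umin h.lip hφ hps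
      (by
        intro x hx
        have : s ≤ ‖x - p‖ := by
          simp only [mem_closedBall, dist_eq_norm, not_le] at hx
          exact hx.le
        simp [cut_out p hs this])
      (by
        have := (iA.const_mul (-t)).add (iB.const_mul (t ^ 2))
        exact this)
      (by
        filter_upwards [hL.ae_differentiableAt] with x hx hxB
        rw [grad_const_mul _ _ _ hx, inner_smul_right, norm_smul, mul_pow, norm_neg,
          Real.norm_of_nonneg ht.le]
        have hc := cut_nonneg p hs x
        have h2 : (max (u x + -t * cut p s x) 0) ^ (γ x) ≤ (max (u x) 0) ^ (γ x) := by
          apply Real.rpow_le_rpow (le_max_right _ _) _ (h.γpos x hxB).le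
          exact max_le_max (by nlinarith) le_rfl
        have h3 : δ x * ((max (u x + -t * cut p s x) 0) ^ (γ x) - (max (u x) 0) ^ (γ x)) ≤ 0 :=
          mul_nonpos_of_nonneg_of_nonpos (h.d0pos.le.trans (h.δlow x hxB)) (by linarith)
        linarith)
    rw [integral_add (iA.const_mul _) (iB.const_mul _), integral_const_mul, integral_const_mul] at h1
    exact h1
  by_contra hcon
  push Not at hcon
  have h2 := key (A / (2 * (B + 1))) (by positivity)
  have h3 : -(A / (2 * (B + 1))) * A + (A / (2 * (B + 1))) ^ 2 * B
      = -(A ^ 2 * (B + 2)) / (4 * (B + 1) ^ 2) := by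
    field_simp
    ring
  rw [h3] at h2
  have h4 : 0 < (A ^ 2 * (B + 2)) / (4 * (B + 1) ^ 2) := by positivity
  rw [neg_div] at h2
  linarith

lemma upper_var (h : Hyp δ γ u M g d0 K) {p : Eu n} {s : ℝ} (hs : 0 < s)
    (hps : closedBall p s ⊆ ball 0 1) {t N : ℝ} (ht : 0 < t)
    (hN : ∀ x ∈ ball p s, M * t ^ (γ x) ≤ N) :
    0 ≤ t * (∫ y in ball (0 : Eu n) 1, inner ℝ (gradient u y) (gradient (cut p s) y))
      + (t ^ 2 * (1 / (2 * s ^ 2)) + N) * volume.real (ball p s) := by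
  obtain ⟨L, hL⟩ := cut_lip p hs
  have iA := inner_integrable h.lip hL
  have hφ : LipschitzWith _ (fun x => t * cut p s x) := (lipschitzWith_smul t).comp hL
  have iI : IntegrableOn ((ball p s).indicator (fun _ => t ^ 2 * (1 / (2 * s ^ 2)) + N))
      (ball (0 : Eu n) 1) :=
    (integrableOn_const measure_ball_lt_top.ne).indicator measurableSet_ball
  have h1 := basic_var (H := fun x => t * inner ℝ (gradient u x) (gradient (cut p s) x)
      + (ball p s).indicator (fun _ => t ^ 2 * (1 / (2 * s ^ 2)) + N) x)
      h.δm h.γm h.δbd h.γpos h.γ1 h.umin h.lip hφ hps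
    (by
      intro x hx
      have : s ≤ ‖x - p‖ := by
        simp only [mem_closedBall, dist_eq_norm, not_le] at hx
        exact hx.le
      simp [cut_out p hs this])
    ((iA.const_mul _).add iI)
    (by
      filter_upwards [hL.ae_differentiableAt] with x hx hxB
      rw [grad_const_mul _ _ _ hx, inner_smul_right, norm_smul, mul_pow,
        Real.norm_of_nonneg ht.le]
      have hg2 := cut_grad_norm p hs x
      by_cases hxp : x ∈ ball p s
      · rw [indicator_of_mem hxp] at hg2 ⊢
        have hc := cut_nonneg p hs x
        have hc1 := cut_le p hs x
        have hu0 := h.unn x hxB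
        have hγ := h.γpos x hxB
        have h2 : (max (u x + t * cut p s x) 0) ^ (γ x) - (max (u x) 0) ^ (γ x) ≤ t ^ (γ x) := by
          rw [max_eq_left hu0, max_eq_left (by positivity)]
          have := Real.rpow_add_le_add_rpow hu0 (by positivity : 0 ≤ t * cut p s x) hγ.le (h.γ1 x hxB)
          have h3 : (t * cut p s x) ^ (γ x) ≤ t ^ (γ x) :=
            Real.rpow_le_rpow (by positivity) (by nlinarith) hγ.le
          linarith
        have hδ0 := h.d0pos.le.trans (h.δlow x hxB)
        have h3 : δ x * ((max (u x + t * cut p s x) 0) ^ (γ x) - (max (u x) 0) ^ (γ x))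
            ≤ M * t ^ (γ x) :=
          (mul_le_mul_of_nonneg_left h2 hδ0).trans
            (mul_le_mul_of_nonneg_right ((le_abs_self _).trans (h.δbd x)) (by positivity))
        have h4 := hN x hxp
        have h5 : (1:ℝ) / 2 * (t ^ 2 * ‖gradient (cut p s) x‖ ^ 2) ≤ t ^ 2 * (1 / (2 * s ^ 2)) := by
          calc (1:ℝ) / 2 * (t ^ 2 * ‖gradient (cut p s) x‖ ^ 2)
              ≤ (1:ℝ) / 2 * (t ^ 2 * (1 / s ^ 2)) := by gcongr
            _ = _ := by field_simp
        linarith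
      · have : s ≤ ‖x - p‖ := by simpa [dist_eq_norm] using hxp
        rw [indicator_of_notMem hxp, cut_out p hs this, cut_grad_out p hs this]
        simp)
  rw [integral_add (iA.const_mul _) iI, integral_const_mul, integral_indicator measurableSet_ball,
    Measure.restrict_restrict measurableSet_ball,
    inter_eq_left.mpr (ball_subset_closedBall.trans hps), setIntegral_const, smul_eq_mul] at h1
  linarith

lemma ball_real (p : Eu n) {s : ℝ} (hs : 0 < s) :
    volume.real (ball p s) = s ^ n * volume.real (ball (0 : Eu n) 1) := by
  unfold Measure.real
  rw [Measure.addHaar_ball_of_pos _ _ hs, ENNReal.toReal_mul, ENNReal.toReal_ofReal (by positivity)]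
  simp

lemma V_pos : 0 < volume.real (ball (0 : Eu n) 1) :=
  ENNReal.toReal_pos (measure_ball_pos _ _ one_pos).ne' measure_ball_lt_top.ne

/-- exponential control of small powers -/
lemma rpow_small {r e C : ℝ} (hr : 0 < r) (hr1 : r < 1) (h : |e| * Real.log (1 / r) ≤ C) :
    r ^ e ≤ Real.exp C := by
  rw [Real.rpow_def_of_pos hr]
  apply Real.exp_le_exp.mpr
  rw [one_div, Real.log_inv] at h
  have hl := Real.log_neg hr hr1
  have := neg_abs_le e
  nlinarith

def bet (γp : ℝ) : ℝ := 2 / (2 - γp)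

lemma bet_ge {a : ℝ} (h0 : 0 < a) (h1 : a ≤ 1) : 1 ≤ bet a := by
  unfold bet
  rw [le_div_iff₀ (by linarith)]
  linarith

lemma bet_le {a : ℝ} (h1 : a ≤ 1) : bet a ≤ 2 := by
  unfold bet
  rw [div_le_iff₀ (by linarith)]
  linarith

lemma bet_id {a : ℝ} (h1 : a ≤ 1) : bet a * a = 2 * bet a - 2 := by
  unfold bet
  have : (2 - a) ≠ 0 := by linarith
  field_simp
  ring

/-- log-type oscillation control of the exponent -/
def Osc (γ : Eu n → ℝ) (r₁ C1 : ℝ) : Prop :=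
  ∀ r, 0 < r → r ≤ r₁ → ∀ x ∈ ball (0 : Eu n) 1, ∀ y ∈ ball (0 : Eu n) 1,
    ‖x - y‖ ≤ 4 * r → |γ x - γ y| * Real.log (1 / r) ≤ C1

lemma Gm_upper (h : Hyp δ γ u M g d0 K) {r₁ C1 : ℝ} (hr₁ : r₁ < 1) (ho : Osc γ r₁ C1)
    {p : Eu n} {r : ℝ} (hr : 0 < r) (hrr : r ≤ r₁) (hps : closedBall p r ⊆ ball 0 1)
    (hup : u p = 0) :
    Gm u p r ≤ (1 / 2 + M * Real.exp (2 * C1)) * volume.real (ball (0 : Eu n) 1) * r ^ (bet (γ p)) := by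
  set Q := 1 / 2 + M * Real.exp (2 * C1) with hQ
  set V := volume.real (ball (0 : Eu n) 1) with hV
  have hVp : 0 < V := V_pos
  have hM : 0 ≤ M := (abs_nonneg _).trans (h.δbd 0)
  have hQ0 : 0 < Q := by positivity
  have hpB : p ∈ ball (0 : Eu n) 1 := hps (mem_closedBall_self hr.le)
  set b := bet (γ p) with hb
  have hb1 : 1 ≤ b := bet_ge (h.γpos p hpB) (h.γ1 p hpB)
  have hb2 : b ≤ 2 := bet_le (h.γ1 p hpB)
  have hbi : b * γ p = 2 * b - 2 := bet_id (h.γ1 p hpB)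
  have hsub : ∀ s, s ≤ r → closedBall p s ⊆ ball (0 : Eu n) 1 := fun s hs =>
    (closedBall_subset_closedBall hs).trans hps
  have hd : ∀ s, 0 < s → HasDerivAt (fun s => Q * V * s ^ b) (Q * V * (b * s ^ (b - 1))) s := by
    intro s hs
    exact (Real.hasDerivAt_rpow_const (Or.inl hs.ne')).const_mul _
  have key : AntitoneOn (fun s => Gm u p s - Q * V * s ^ b) (Icc 0 r) := by
    apply antitoneOn_of_deriv_nonpos (convex_Icc 0 r)
    · apply ContinuousOn.sub (Gm_cont h.lip p).continuousOn
      apply ContinuousOn.mul continuousOn_const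
      exact (Real.continuous_rpow_const (by linarith)).continuousOn
    · intro s hs
      rw [interior_Icc] at hs
      exact ((Gm_deriv' h.lip p hs.1 (ball_subset_closedBall.trans (hsub s hs.2.le))).fun_sub
        (hd s hs.1)).differentiableAt.differentiableWithinAt
    · intro s hs
      rw [interior_Icc] at hs
      have hs0 := hs.1
      rw [((Gm_deriv' h.lip p hs.1 (ball_subset_closedBall.trans (hsub s hs.2.le))).fun_sub
        (hd s hs.1)).deriv]
      have hN : ∀ x ∈ ball p s, M * (s ^ b) ^ (γ x) ≤ M * Real.exp (2 * C1) * s ^ (2 * b - 2) := by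
        intro x hx
        have hxB : x ∈ ball (0 : Eu n) 1 := hsub s hs.2.le (ball_subset_closedBall hx)
        have hxp : ‖x - p‖ ≤ 4 * s := by
          have : ‖x - p‖ < s := by simpa [dist_eq_norm] using hx
          linarith
        have ho1 := ho s hs0 (hs.2.le.trans hrr) x hxB p hpB hxp
        have hl : 0 ≤ Real.log (1 / s) := Real.log_nonneg (by
          rw [le_div_iff₀ hs0]; linarith [hs.2])
        have e1 : s ^ (b * (γ x - γ p)) ≤ Real.exp (2 * C1) := by
          apply rpow_small hs0 (by linarith [hs.2])
          rw [abs_mul, abs_of_nonneg (by linarith : 0 ≤ b)]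
          have : 0 ≤ |γ x - γ p| * Real.log (1 / s) := by positivity
          nlinarith
        rw [← Real.rpow_mul hs0.le, mul_assoc]
        apply mul_le_mul_of_nonneg_left _ hM
        have e2 : b * γ x = b * (γ x - γ p) + (2 * b - 2) := by rw [← hbi]; ring
        rw [e2, Real.rpow_add hs0]
        gcongr
      have hv := upper_var h hs0 (hsub s hs.2.le) (Real.rpow_pos_of_pos hs0 b) hN
      set A := ∫ y in ball (0 : Eu n) 1, inner ℝ (gradient u y) (gradient (cut p s) y) with hA
      rw [ball_real p hs0, ← hV] at hv
      have e3 : (s ^ b) ^ 2 * (1 / (2 * s ^ 2)) = 1 / 2 * s ^ (2 * b - 2) := by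
        rw [Real.rpow_sub hs0, mul_comm 2 b, Real.rpow_mul hs0.le, Real.rpow_two, Real.rpow_two]
        field_simp
      have e4 : s ^ (2 * b - 2) = s ^ b * (s ^ (b - 1) / s) := by
        rw [← Real.rpow_sub_one hs0.ne', ← Real.rpow_add hs0]
        congr 1; ring
      have hsb : 0 < s ^ b := Real.rpow_pos_of_pos hs0 b
      have hv2 : 0 ≤ A + Q * (s ^ (b - 1) / s) * (s ^ n * V) := by
        have : 0 ≤ s ^ b * (A + Q * (s ^ (b - 1) / s) * (s ^ n * V)) := by
          refine hv.trans (le_of_eq ?_)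
          rw [e3, e4, hQ]
          ring
        exact nonneg_of_mul_nonneg_right this hsb
      have hk : 0 < (s ^ n)⁻¹ * s := by positivity
      have hv3 := mul_nonneg hk.le hv2
      have e5 : (s ^ n)⁻¹ * s * (A + Q * (s ^ (b - 1) / s) * (s ^ n * V))
          = (s ^ n)⁻¹ * s * A + Q * V * s ^ (b - 1) := by
        field_simp
      rw [e5] at hv3
      have e6 : Q * V * s ^ (b - 1) ≤ Q * V * (b * s ^ (b - 1)) := by
        have : 0 < s ^ (b - 1) := Real.rpow_pos_of_pos hs0 _
        gcongr
        nlinarith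
      linarith
  have h0 := key (left_mem_Icc.mpr hr.le) (right_mem_Icc.mpr hr.le) hr.le
  simp only [Gm_zero, hup, Real.zero_rpow (by linarith : b ≠ 0)] at h0
  linarith

lemma Gm_lower (h : Hyp δ γ u M g d0 K) 
    {p : Eu n} {r : ℝ} (hr : 0 < r) (hps : closedBall p r ⊆ ball 0 1) :
    volume.real (ball (0 : Eu n) 1) * u p ≤ Gm u p r := by
  have hsub : ∀ s, s ≤ r → closedBall p s ⊆ ball (0 : Eu n) 1 := fun s hs =>
    (closedBall_subset_closedBall hs).trans hps
  have key : MonotoneOn (Gm u p) (Icc 0 r) := by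
    apply monotoneOn_of_deriv_nonneg (convex_Icc 0 r) (Gm_cont h.lip p).continuousOn
    · intro s hs
      rw [interior_Icc] at hs
      exact (Gm_deriv' h.lip p hs.1
        (ball_subset_closedBall.trans (hsub s hs.2.le))).differentiableAt.differentiableWithinAt
    · intro s hs
      rw [interior_Icc] at hs
      have hs0 := hs.1
      rw [(Gm_deriv' h.lip p hs.1 (ball_subset_closedBall.trans (hsub s hs.2.le))).deriv]
      have := sub_harm h hs0 (hsub s hs.2.le)
      have hk : 0 < (s ^ n)⁻¹ * s := by positivity
      nlinarith
  have h0 := key (left_mem_Icc.mpr hr.le) (right_mem_Icc.mpr hr.le) hr.le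
  rwa [Gm_zero] at h0

lemma growth (h : Hyp δ γ u M g d0 K) {r₁ C1 : ℝ} (hr₁ : r₁ < 1) (ho : Osc γ r₁ C1)
    {p x : Eu n} {ρ : ℝ} (hr : 0 < ρ) (hrr : 2 * ρ ≤ r₁) (hps : closedBall p (2 * ρ) ⊆ ball 0 1)
    (hup : u p = 0) (hx : ‖x - p‖ ≤ ρ) :
    u x ≤ 2 ^ n * (1 / 2 + M * Real.exp (2 * C1)) * (2 * ρ) ^ (bet (γ p)) := by
  have h1 := Gm_upper h hr₁ ho (by linarith) hrr hps hup
  have hsub : ∀ s, s ≤ ρ → closedBall x s ⊆ closedBall p (2 * ρ) := by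
    intro s hs
    apply closedBall_subset_closedBall'
    rw [dist_eq_norm]; linarith
  have h2 := Gm_lower h hr ((hsub ρ le_rfl).trans hps)
  have hb : ball x ρ ⊆ ball p (2 * ρ) := by
    apply ball_subset_ball'
    rw [dist_eq_norm]; linarith
  have h3 : Gm u x ρ ≤ 2 ^ n * Gm u p (2 * ρ) := by
    unfold Gm
    rw [cov u x hr, cov u p (by linarith : 0 < 2 * ρ)]
    have h4 : ∫ ξ in ball x ρ, u ξ ≤ ∫ ξ in ball p (2 * ρ), u ξ := by
      apply setIntegral_mono_set
      · exact (h.lip.continuous.continuousOn.integrableOn_compact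
          (isCompact_closedBall p (2 * ρ))).mono_set ball_subset_closedBall
      · filter_upwards [ae_restrict_mem measurableSet_ball] with y hy
        exact h.unn y (hps (ball_subset_closedBall hy))
      · exact hb.eventuallyLE
    calc (ρ ^ n)⁻¹ * ∫ ξ in ball x ρ, u ξ ≤ (ρ ^ n)⁻¹ * ∫ ξ in ball p (2 * ρ), u ξ := by gcongr
      _ = _ := by
        rw [mul_pow]
        field_simp
  have hV : 0 < volume.real (ball (0 : Eu n) 1) := V_pos
  have h5 : volume.real (ball (0 : Eu n) 1) * u x ≤ volume.real (ball (0 : Eu n) 1) *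
      (2 ^ n * (1 / 2 + M * Real.exp (2 * C1)) * (2 * ρ) ^ (bet (γ p))) := by
    refine h2.trans (h3.trans ?_)
    calc _ ≤ 2 ^ n * ((1 / 2 + M * Real.exp (2 * C1)) * volume.real (ball (0 : Eu n) 1) * (2 * ρ) ^ (bet (γ p))) := by gcongr
      _ = _ := by ring
  exact le_of_mul_le_mul_left h5 hV

lemma ibp {w : Eu n → ℝ} {L : NNReal} (hw : LipschitzWith L w) (hc : HasCompactSupport w)
    (z : Eu n) :
    Integrable (fun x => inner ℝ (x - z) (gradient w x)) ∧
    ∫ x, inner ℝ (x - z) (gradient w x) = -(n * ∫ x, w x) := by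
  have hzero : ∀ x, x ∉ tsupport w → gradient w x = 0 := by
    intro x hx
    unfold gradient
    rw [image_eq_zero_of_notMem_tsupport (fun h => hx (tsupport_fderiv_subset ℝ h)), map_zero]
  have hi : ∀ i : Fin n, Integrable (fun x : Eu n => (x i - z i) * (gradient w x) i) := by
    intro i
    have hm : Measurable (fun x : Eu n => (x i - z i) * (gradient w x) i) := by
      have h1 : Measurable (fun x : Eu n => x i) := by fun_prop
      exact (h1.sub_const _).mul (h1.comp (grad_meas w))
    have hcomp : IsCompact (tsupport w) := hc
    obtain ⟨R, hR⟩ := hcomp.exists_bound_of_continuousOn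
      (f := fun x : Eu n => x i - z i) (by fun_prop)
    have : IntegrableOn (fun x : Eu n => (x i - z i) * (gradient w x) i) (tsupport w) := by
      refine Measure.integrableOn_of_bounded (M := R * L) hcomp.measure_lt_top.ne
        hm.aestronglyMeasurable ?_
      filter_upwards [ae_restrict_mem hcomp.measurableSet] with x hx
      rw [norm_mul]
      have h2 : ‖gradient w x i‖ ≤ L := (PiLp.norm_apply_le (gradient w x) i).trans (grad_norm_le hw x)
      exact mul_le_mul (hR x hx) h2 (norm_nonneg _) ((norm_nonneg _).trans (hR x hx))
    rw [integrableOn_iff_integrable_of_support_subset] at this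
    · exact this
    · intro x hx
      by_contra h
      exact hx (by simp [hzero x h])
  have hsum : ∀ x : Eu n, inner ℝ (x - z) (gradient w x) = ∑ i, (x i - z i) * (gradient w x) i := by
    intro x
    rw [PiLp.inner_apply]
    refine Finset.sum_congr rfl fun i _ => ?_
    simp [mul_comm]
  simp_rw [hsum]
  refine ⟨integrable_finsetSum _ fun i _ => hi i, ?_⟩
  rw [integral_finsetSum _ fun i _ => hi i]
  have key : ∀ i : Fin n, ∫ x : Eu n, (x i - z i) * (gradient w x) i = -∫ x, w x := by
    intro i
    have hf : LipschitzWith 1 (fun x : Eu n => x i - z i) := by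
      apply LipschitzWith.of_dist_le_mul
      intro x y
      rw [dist_eq_norm, dist_eq_norm]
      have := PiLp.norm_apply_le (x - y) i
      simpa using this
    have h1 := hf.integral_lineDeriv_mul_eq (μ := volume) hw hc (EuclideanSpace.single i (1:ℝ))
    have h2 : ∀ x : Eu n, lineDeriv ℝ (fun x : Eu n => x i - z i) x (EuclideanSpace.single i (1:ℝ)) = 1 := by
      intro x
      unfold lineDeriv
      have : (fun t : ℝ => (x + t • (EuclideanSpace.single i (1:ℝ) : Eu n)) i - z i)
        = fun t : ℝ => t + (x i - z i) := by
        ext t; simp; ring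
      rw [this]
      simp
    simp_rw [h2, one_mul] at h1
    rw [h1, ← integral_neg]
    apply integral_congr_ae
    filter_upwards [hw.ae_differentiableAt] with x hx
    rw [hx.lineDeriv_eq_fderiv, map_neg, ← inner_gradient_left (𝕜 := ℝ)]
    rw [EuclideanSpace.inner_single_right]
    simp [mul_comm]
  simp_rw [key]
  simp

lemma concave_ineq {a w m e : ℝ} (hw : 0 < w) (hwa : w ≤ a) (ham : a ≤ m)
    (he0 : 0 < e) (he1 : e ≤ 1) : e * m ^ (e - 1) * w ≤ a ^ e - (a - w) ^ e := by
  have ha : 0 < a := hw.trans_le hwa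
  have h1 := rpow_one_add_le_one_add_mul_self (s := -(w / a))
    (by rw [neg_le_neg_iff, div_le_one ha]; exact hwa) he0.le he1
  have h2 : a - w = a * (1 + -(w / a)) := by field_simp; ring
  have h3 : 0 ≤ 1 + -(w / a) := by
    have : w / a ≤ 1 := by rw [div_le_one ha]; exact hwa
    linarith
  have h4 : (a - w) ^ e ≤ a ^ e * (1 + e * -(w / a)) := by
    rw [h2, Real.mul_rpow ha.le h3]
    gcongr
  have h5 : a ^ e * (1 + e * -(w / a)) = a ^ e - e * a ^ (e - 1) * w := by
    rw [Real.rpow_sub_one ha.ne']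
    field_simp
    ring
  have h6 : m ^ (e - 1) ≤ a ^ (e - 1) := Real.rpow_le_rpow_of_nonpos ha ham (by linarith)
  have h7 : e * m ^ (e - 1) * w ≤ e * a ^ (e - 1) * w := by gcongr
  linarith

lemma nondeg (h : Hyp δ γ u M g d0 K) {z : Eu n} {r m θ : ℝ} (hr : 0 < r) (hm : 0 < m)
    (hps : closedBall z r ⊆ ball 0 1) (huz : 0 < u z)
    (hθ : 2 * n * (m / r ^ 2) < θ) (hθ2 : ∀ x ∈ ball z r, θ ≤ d0 * (g * m ^ (γ x - 1))) :
    ∃ x ∈ closedBall z r, m ≤ u x := by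
  by_contra hcon
  push Not at hcon
  set w : Eu n → ℝ := fun x => max (min (u x) m + (-(m / r ^ 2)) * qf z r x) 0 with hwdef
  have hwL : ∃ L : NNReal, LipschitzWith L w := by
    have h1 := (h.lip.min_const m).add
      ((lipschitzWith_smul (-(m / r ^ 2) : ℝ)).comp (qf_lip z hr.le))
    exact ⟨_, h1.max_const 0⟩
  obtain ⟨L, hL⟩ := hwL
  have hw0 : ∀ x, 0 ≤ w x := fun x => le_max_right _ _
  have hout : ∀ x, r ≤ ‖x - z‖ → w x = 0 := by
    intro x hx
    simp only [hwdef]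
    apply max_eq_right
    rw [qf_out z hx]
    have : m / r ^ 2 * r ^ 2 = m := by field_simp
    have := min_le_right (u x) m
    linarith
  have hin : ∀ x, 0 < w x → ‖x - z‖ < r ∧ u x < m ∧ w x = u x + (-(m / r ^ 2)) * qf z r x := by
    intro x hx
    have h1 : ‖x - z‖ < r := by
      by_contra hh
      exact hx.ne' (hout x (not_lt.mp hh))
    have h2 : u x < m := hcon x (by simpa [dist_eq_norm] using h1.le)
    refine ⟨h1, h2, ?_⟩
    have h3 : min (u x) m + (-(m / r ^ 2)) * qf z r x > 0 := by
      by_contra hh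
      exact hx.ne' (max_eq_right (not_lt.mp hh))
    simp only [hwdef]
    rw [max_eq_left h3.le, min_eq_left h2.le]
  have hsupp : ∀ x, x ∉ closedBall z r → w x = 0 := by
    intro x hx
    apply hout
    simp only [mem_closedBall, dist_eq_norm, not_le] at hx
    exact hx.le
  have hcs : HasCompactSupport w := HasCompactSupport.intro (isCompact_closedBall z r) hsupp
  obtain ⟨ib1, ib2⟩ := ibp hL hcs z
  have iw : Integrable w := hL.continuous.integrable_of_hasCompactSupport hcs
  have hφ : LipschitzWith _ (fun x => (-1 : ℝ) * w x) := (lipschitzWith_smul (-1 : ℝ)).comp hL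
  have hbv := basic_var (H := fun x => (-(2 * (m / r ^ 2))) * inner ℝ (x - z) (gradient w x)
      + (-θ) * w x) h.δm h.γm h.δbd h.γpos h.γ1 h.umin h.lip hφ hps
    (fun x hx => by simp [hsupp x hx])
    ((ib1.const_mul _).add (iw.const_mul _)).integrableOn
    (by
      filter_upwards [hL.ae_differentiableAt, h.lip.ae_differentiableAt] with x hx hxu hxB
      rcases (hw0 x).eq_or_lt with hx0 | hx0
      · rw [grad_const_mul _ _ _ hx, grad_zero_of_nonneg hw0 hx0.symm, ← hx0]
        simp
      · obtain ⟨h1, h2, h3⟩ := hin x hx0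
        have hev : w =ᶠ[nhds x] fun y => u y + (-(m / r ^ 2)) * qf z r y := by
          have : ∀ᶠ y in nhds x, 0 < w y :=
            (isOpen_lt continuous_const hL.continuous).mem_nhds hx0
          filter_upwards [this] with y hy
          exact (hin y hy).2.2
        have hq := qf_grad z h1
        have hgw : gradient w x = gradient u x + (-(2 * (m / r ^ 2))) • (x - z) := by
          rw [hev.gradient_eq, grad_add hxu (hq.differentiableAt.const_mul _),
            grad_const_mul _ _ _ hq.differentiableAt, hq.gradient, smul_smul]
          congr 2
          ring
        have hgu : gradient u x = gradient w x + (2 * (m / r ^ 2)) • (x - z) := by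
          rw [hgw, add_assoc, ← add_smul]
          simp
        rw [grad_const_mul _ _ _ hx, hgu, inner_smul_right, inner_add_left, inner_smul_left,
          norm_smul, real_inner_self_eq_norm_sq]
        have hqn : 0 ≤ (m / r ^ 2) * qf z r x := by
          have := qf_nonneg z r x
          positivity
        have hwa : w x ≤ u x := by rw [h3]; linarith
        have hua : 0 < u x := hx0.trans_le hwa
        have hγ := h.γpos x hxB
        have hc := concave_ineq hx0 hwa h2.le hγ (h.γ1 x hxB)
        rw [max_eq_left hua.le, max_eq_left (by linarith : 0 ≤ u x + -1 * w x)]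
        have e1 : u x + -1 * w x = u x - w x := by ring
        rw [e1]
        have hδ := h.δlow x hxB
        have hmp : 0 < m ^ (γ x - 1) := Real.rpow_pos_of_pos hm _
        have hd : θ * w x ≤ δ x * (u x ^ γ x - (u x - w x) ^ γ x) := by
          have hd0 := h.d0pos
          have hg0 := h.g0
          have hgl := h.γlow x hxB
          have hδ00 : 0 ≤ δ x := by linarith
          calc θ * w x ≤ d0 * (g * m ^ (γ x - 1)) * w x := by
                gcongr
                exact hθ2 x (by simpa [dist_eq_norm] using h1)
            _ ≤ d0 * (γ x * m ^ (γ x - 1)) * w x := by gcongr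
            _ = d0 * (γ x * m ^ (γ x - 1) * w x) := by ring
            _ ≤ δ x * (γ x * m ^ (γ x - 1) * w x) := by gcongr
            _ ≤ δ x * (u x ^ γ x - (u x - w x) ^ γ x) := by gcongr
        have hn : (0:ℝ) ≤ ‖gradient w x‖ ^ 2 := by positivity
        simp only [norm_neg, norm_one, one_mul, conj_trivial]
        linarith)
  have e0 : ∀ x, x ∉ ball (0 : Eu n) 1 → (-(2 * (m / r ^ 2))) * inner ℝ (x - z) (gradient w x)
      + (-θ) * w x = 0 := by
    intro x hx
    have h1 := hsupp x (fun hh => hx (hps hh))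
    rw [grad_zero_of_nonneg hw0 h1, h1]
    simp
  rw [setIntegral_eq_integral_of_forall_compl_eq_zero e0,
    integral_add (ib1.const_mul _) (iw.const_mul _), integral_const_mul, integral_const_mul, ib2] at hbv
  have hwz : w z = u z := by
    have : u z < m := hcon z (mem_closedBall_self hr.le)
    simp [hwdef, qf, hr.le, min_eq_left this.le, huz.le]
  have hpos : 0 < ∫ x, w x := by
    rw [integral_pos_iff_support_of_nonneg hw0 iw]
    exact (hL.continuous.isOpen_support).measure_pos volume ⟨z, by simp [hwz, huz.ne']⟩
  nlinarith
lemma osc_of_mod {Ctil : ℝ} (hCtil : 0 < Ctil) {ω : ℝ → ℝ}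
    (hωnn : ∀ t ∈ Ioc (0:ℝ) 1, 0 ≤ ω t)
    (hωmono : MonotoneOn ω (Ioc (0:ℝ) 1))
    (hmod : ∀ x ∈ ball (0 : Eu n) 1, ∀ y ∈ ball (0 : Eu n) 1, x ≠ y →
        |γ x - γ y| ≤ ω ‖x - y‖)
    (hω1 : ω 1 ≤ Ctil) {t₀ : ℝ} (ht₀ : t₀ ∈ Ioo (0:ℝ) 1)
    (hωlog : ∀ t ∈ Ioo (0:ℝ) t₀, ω t * Real.log (1 / t) ≤ Ctil) :
    Osc γ (t₀ / 16) (3 * Ctil) := by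
  intro r hr hrr x hx y hy hxy
  obtain ⟨h0, h1⟩ := ht₀
  by_cases hne : x = y
  · subst hne
    simp only [sub_self, abs_zero, zero_mul]
    positivity
  have hp : 0 < ‖x - y‖ := norm_pos_iff.mpr (sub_ne_zero.mpr hne)
  have h4 : (4 * r) ∈ Ioc (0:ℝ) 1 := ⟨by linarith, by linarith⟩
  have hm : |γ x - γ y| ≤ ω (4 * r) := (hmod x hx y hy hne).trans
    (hωmono ⟨hp, hxy.trans h4.2⟩ h4 hxy)
  have hm1 : ω (4 * r) ≤ Ctil := (hωmono h4 ⟨one_pos, le_rfl⟩ h4.2).trans hω1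
  have hl := hωlog (4 * r) ⟨h4.1, by linarith⟩
  have hlog : Real.log (1 / r) = Real.log (1 / (4 * r)) + Real.log 4 := by
    rw [← Real.log_mul (by positivity) (by norm_num)]
    congr 1
    field_simp
  have hl4 : Real.log 4 ≤ 2 := by
    have : (4:ℝ) = 2 ^ 2 := by norm_num
    rw [this, Real.log_pow]
    have := Real.log_two_lt_d9
    push_cast
    linarith
  have hl40 : 0 ≤ Real.log 4 := Real.log_nonneg (by norm_num)
  have hlr : 0 ≤ Real.log (1 / r) := Real.log_nonneg (by rw [le_div_iff₀ hr]; linarith)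
  have hω0 := hωnn _ h4
  calc |γ x - γ y| * Real.log (1 / r) ≤ ω (4 * r) * Real.log (1 / r) := by gcongr
    _ = ω (4 * r) * Real.log (1 / (4 * r)) + ω (4 * r) * Real.log 4 := by rw [hlog]; ring
    _ ≤ Ctil + Ctil * 2 := by gcongr
    _ = _ := by ring

lemma bet_diff {a b : ℝ} (ha : a ≤ 1) (hb : b ≤ 1) : |bet a - bet b| ≤ 2 * |a - b| := by
  unfold bet
  have h1 : 0 < 2 - a := by linarith
  have h2 : 0 < 2 - b := by linarith
  have h3 : 2 / (2 - a) - 2 / (2 - b) = 2 * (a - b) / ((2 - a) * (2 - b)) := by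
    field_simp
    ring
  rw [h3, abs_div, abs_mul, abs_of_pos (mul_pos h1 h2), abs_of_pos (two_pos : (0:ℝ) < 2)]
  apply div_le_self (by positivity)
  nlinarith

set_option maxHeartbeats 2000000 in
lemma porous (h : Hyp δ γ u M g d0 K) {r₁ C1 : ℝ} (hr₁0 : 0 < r₁) (hr₁ : r₁ ≤ 1 / 16)
    (ho : Osc γ r₁ C1) :
    ∃ κ ∈ Ioo (0:ℝ) 1, ∃ r₀ > (0:ℝ),
      ∀ r : ℝ, 0 < r → r ≤ r₀ →
        ∀ z ∈ freeBoundary u ∩ ball (0 : Eu n) (1/2),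
          ∃ y : Eu n, ball y (κ * r) ⊆ ball z r \ freeBoundary u := by
  have hM : 0 ≤ M := (abs_nonneg _).trans (h.δbd 0)
  have hd0 := h.d0pos
  have hg0 := h.g0
  set e := Real.exp (2 * C1) with he
  have he0 : 0 < e := Real.exp_pos _
  set Q := 1 / 2 + M * e with hQ
  have hQ0 : 0 < Q := by positivity
  set c := d0 * g / (d0 * g + (2 * n + 1) * e) with hc
  have hden : 0 < d0 * g + (2 * n + 1) * e := by positivity
  have hc0 : 0 < c := by positivity
  have hc1 : c ≤ 1 := by
    rw [hc, div_le_one hden]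
    have : 0 ≤ (2 * (n:ℝ) + 1) * e := by positivity
    linarith
  have hc2 : 2 * n * (c * e) < d0 * g := by
    have : 2 * n * (c * e) = (2 * n * e) * (d0 * g) / (d0 * g + (2 * n + 1) * e) := by
      rw [hc]; ring
    rw [this, div_lt_iff₀ hden]
    have hdg : 0 < d0 * g := by positivity
    nlinarith
  set D := 2 ^ n * Q * (8 * e) with hD
  have hD0 : 0 < D := by positivity
  refine ⟨min (1 / 8) (c / (2 * D)), ⟨by positivity, (min_le_left _ _).trans_lt (by norm_num)⟩,
    r₁, hr₁0, ?_⟩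
  set κ := min (1 / 8) (c / (2 * D)) with hκ
  have hκ0 : 0 < κ := by positivity
  have hκ8 : κ ≤ 1 / 8 := min_le_left _ _
  have hκD : κ * D < c := by
    have : κ ≤ c / (2 * D) := min_le_right _ _
    calc κ * D ≤ c / (2 * D) * D := by gcongr
      _ = c / 2 := by field_simp
      _ < c := by linarith
  intro r hr hrr z hz
  obtain ⟨⟨hzf, hzB⟩, hz2⟩ := hz
  have hz2' : ‖z‖ < 1 / 2 := by simpa using hz2
  set S := {x ∈ ball (0 : Eu n) 1 | 0 < u x} with hS
  have hSo : IsOpen S := by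
    have : S = ball (0 : Eu n) 1 ∩ {x | 0 < u x} := rfl
    rw [this]
    exact isOpen_ball.inter (isOpen_lt continuous_const h.lip.continuous)
  set R := r / 4 with hR
  have hR0 : 0 < R := by positivity
  have hR1 : R < 1 := by linarith
  obtain ⟨z', ⟨hz'B, hz'u⟩, hz'd⟩ := Metric.mem_closure_iff.mp hzf.1 R hR0
  rw [dist_eq_norm, norm_sub_rev] at hz'd
  set b := bet (γ z) with hb
  have hγz := h.γ1 z hzB
  have hγz0 := h.γpos z hzB
  have hb1 : 1 ≤ b := bet_ge hγz0 hγz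
  have hb2 : b ≤ 2 := bet_le hγz
  have hbi : b * γ z = 2 * b - 2 := bet_id hγz
  set m := c * R ^ b with hm
  have hRb : 0 < R ^ b := Real.rpow_pos_of_pos hR0 b
  have hm0 : 0 < m := by positivity
  have hlR : 0 ≤ Real.log (1 / R) := Real.log_nonneg (by rw [le_div_iff₀ hR0]; linarith)
  have hz'n : ‖z'‖ ≤ ‖z‖ + R := by
    have : z' = z + (z' - z) := by abel
    calc ‖z'‖ = ‖z + (z' - z)‖ := by rw [← this]
      _ ≤ _ := (norm_add_le _ _).trans (by linarith)
  have hsub : closedBall z' R ⊆ ball 0 1 := by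
    apply closedBall_subset_ball'
    rw [dist_zero_right]
    linarith
  have hθ : 2 * n * (m / R ^ 2) < d0 * g * (m / R ^ 2) / (c * e) := by
    rw [lt_div_iff₀ (by positivity)]
    have : 0 < m / R ^ 2 := by positivity
    nlinarith
  obtain ⟨y, hyB, hyu⟩ := nondeg h hR0 hm0 hsub hz'u hθ (by
    intro x hx
    have hxB := hsub (ball_subset_closedBall hx)
    have hxz' : ‖x - z'‖ < R := by simpa [dist_eq_norm] using hx
    have hxz : ‖z - x‖ ≤ 4 * R := by
      rw [norm_sub_rev]
      have : x - z = (x - z') + (z' - z) := by abel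
      rw [this]
      exact (norm_add_le _ _).trans (by linarith)
    have ho1 := ho R hR0 (by linarith) z hzB x hxB hxz
    have hγx := h.γ1 x hxB
    have e1 : R ^ (b * (γ z - γ x)) ≤ e := by
      apply rpow_small hR0 hR1
      rw [abs_mul, abs_of_nonneg (by linarith : 0 ≤ b)]
      have : 0 ≤ |γ z - γ x| * Real.log (1 / R) := by positivity
      nlinarith
    have e2 : m ^ (2 - γ x) ≤ c * (R ^ 2 * e) := by
      rw [hm, Real.mul_rpow hc0.le hRb.le, ← Real.rpow_mul hR0.le]
      have e3 : b * (2 - γ x) = 2 + b * (γ z - γ x) := by linarith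
      rw [e3, Real.rpow_add hR0, Real.rpow_two]
      have e4 : c ^ (2 - γ x) ≤ c := by
        have := Real.rpow_le_rpow_of_exponent_ge hc0 hc1 (by linarith : 1 ≤ 2 - γ x)
        rwa [Real.rpow_one] at this
      gcongr
    have e5 : m ^ (γ x - 1) = m / m ^ (2 - γ x) := by
      rw [eq_div_iff (Real.rpow_pos_of_pos hm0 _).ne', ← Real.rpow_add hm0]
      ring_nf
      exact Real.rpow_one m
    rw [e5]
    calc d0 * g * (m / R ^ 2) / (c * e) = d0 * (g * (m / (c * (R ^ 2 * e)))) := by field_simp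
      _ ≤ d0 * (g * (m / m ^ (2 - γ x))) := by
        have := Real.rpow_pos_of_pos hm0 (2 - γ x)
        gcongr)
  have hyz' : ‖y - z'‖ ≤ R := by simpa [dist_eq_norm] using hyB
  have hyz : ‖y - z‖ < 2 * R := by
    have : y - z = (y - z') + (z' - z) := by abel
    rw [this]
    exact (norm_add_le _ _).trans_lt (by linarith)
  have hκr : κ * r ≤ r / 8 := by
    have := mul_le_mul_of_nonneg_right hκ8 hr.le
    linarith
  have hκr0 : 0 < κ * r := by positivity
  refine ⟨y, fun p hp => ?_⟩
  have hpy : ‖p - y‖ < κ * r := by simpa [dist_eq_norm] using hp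
  have hpz : ‖p - z‖ < r := by
    have : p - z = (p - y) + (y - z) := by abel
    rw [this]
    exact (norm_add_le _ _).trans_lt (by linarith)
  refine ⟨by simpa [dist_eq_norm] using hpz, ?_⟩
  rintro ⟨hpf, hpB⟩
  have hpS : p ∉ S := by
    rw [hSo.frontier_eq] at hpf
    exact hpf.2
  have hup : u p = 0 := by
    have h0 := h.unn p hpB
    rcases h0.eq_or_lt with h1 | h1
    · exact h1.symm
    · exact absurd ⟨hpB, h1⟩ hpS
  have hpn : ‖p‖ ≤ ‖z‖ + r := by
    have : p = z + (p - z) := by abel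
    calc ‖p‖ = ‖z + (p - z)‖ := by rw [← this]
      _ ≤ _ := (norm_add_le _ _).trans (by linarith)
  have hgr := growth h (by linarith : r₁ < 1) ho hκr0 (by linarith : 2 * (κ * r) ≤ r₁)
    (by
      apply closedBall_subset_ball'
      rw [dist_zero_right]
      linarith) hup (x := y) (by rw [norm_sub_rev]; exact hpy.le)
  have ho2 := ho R hR0 (by linarith) p hpB z hzB (by linarith)
  have hγp := h.γ1 p hpB
  have hbp1 : 1 ≤ bet (γ p) := bet_ge (h.γpos p hpB) hγp
  have hbd := bet_diff hγp hγz
  have e1 : R ^ (bet (γ p) - b) ≤ e := by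
    apply rpow_small hR0 hR1
    calc |bet (γ p) - b| * Real.log (1 / R) ≤ 2 * |γ p - γ z| * Real.log (1 / R) := by gcongr
      _ ≤ 2 * C1 := by linarith
  have e2 : (2 * (κ * r)) ^ (bet (γ p)) ≤ 8 * κ * (e * R ^ b) := by
    have : 2 * (κ * r) = (8 * κ) * R := by rw [hR]; ring
    rw [this, Real.mul_rpow (by positivity) hR0.le]
    have e3 : (8 * κ) ^ (bet (γ p)) ≤ 8 * κ := by
      have := Real.rpow_le_rpow_of_exponent_ge (by positivity : 0 < 8 * κ) (by linarith) hbp1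
      rwa [Real.rpow_one] at this
    have e4 : R ^ (bet (γ p)) = R ^ (bet (γ p) - b) * R ^ b := by
      rw [← Real.rpow_add hR0]; congr 1; ring
    rw [e4]
    gcongr
  have hfin : c * R ^ b ≤ κ * D * R ^ b := by
    calc c * R ^ b ≤ u y := hyu
      _ ≤ 2 ^ n * Q * (2 * (κ * r)) ^ (bet (γ p)) := hgr
      _ ≤ 2 ^ n * Q * (8 * κ * (e * R ^ b)) := by gcongr
      _ = κ * D * R ^ b := by rw [hD]; ring
  have := le_of_mul_le_mul_right hfin hRb
  linarith

end Aux

theorem statement10 {n : ℕ} (hn : 2 ≤ n)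
    (δ γ : EuclideanSpace ℝ (Fin n) → ℝ)
    (hδm : Measurable δ) (hγm : Measurable γ)
    (hδbd : ∃ M, ∀ x, |δ x| ≤ M) (hγbd : ∃ M, ∀ x, |γ x| ≤ M)
    (hδ0 : ∀ x, 0 ≤ δ x)
    (hH1 : 0 < sInf (γ '' ball (0 : EuclideanSpace ℝ (Fin n)) 1))
    (hγ1 : ∀ x ∈ ball (0 : EuclideanSpace ℝ (Fin n)) 1, γ x ≤ 1)
    (δ₀ : ℝ) (hδ₀ : 0 < δ₀)
    (hδlow : ∀ x ∈ ball (0 : EuclideanSpace ℝ (Fin n)) 1, δ₀ ≤ δ x)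
    (u : EuclideanSpace ℝ (Fin n) → ℝ)
    (humin : IsLocalMinimizer δ γ u)
    (hu01 : ∀ x ∈ ball (0 : EuclideanSpace ℝ (Fin n)) 1, 0 ≤ u x ∧ u x ≤ 1)
    (Ctil : ℝ) (hCtil : 0 < Ctil) (ω : ℝ → ℝ)
    (hωnn : ∀ t ∈ Ioc (0:ℝ) 1, 0 ≤ ω t)
    (hωmono : MonotoneOn ω (Ioc (0:ℝ) 1))
    (hmod : ∀ x ∈ ball (0 : EuclideanSpace ℝ (Fin n)) 1,
      ∀ y ∈ ball (0 : EuclideanSpace ℝ (Fin n)) 1, x ≠ y →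
        |γ x - γ y| ≤ ω ‖x - y‖)
    (hω1 : ω 1 ≤ Ctil)
    (hωlog : ∃ t₀ ∈ Ioo (0:ℝ) 1, ∀ t ∈ Ioo (0:ℝ) t₀, ω t * Real.log (1 / t) ≤ Ctil) :
    ∃ κ ∈ Ioo (0:ℝ) 1, ∃ r₀ > (0:ℝ),
      ∀ r : ℝ, 0 < r → r ≤ r₀ →
        ∀ z ∈ freeBoundary u ∩ ball (0 : EuclideanSpace ℝ (Fin n)) (1/2),
          ∃ y : EuclideanSpace ℝ (Fin n),
            ball y (κ * r) ⊆ ball z r \ freeBoundary u := by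
  obtain ⟨M, hM⟩ := hδbd
  obtain ⟨N, hN⟩ := hγbd
  obtain ⟨K, hK⟩ := humin.1
  obtain ⟨t₀, ht₀, hlog⟩ := hωlog
  have hyp : Hyp δ γ u M (sInf (γ '' ball (0 : EuclideanSpace ℝ (Fin n)) 1)) δ₀ K :=
    { δm := hδm
      γm := hγm
      δbd := hM
      g0 := hH1
      γlow := fun x hx => csInf_le ⟨-N, by
        rintro _ ⟨y, _, rfl⟩
        exact (abs_le.mp (hN y)).1⟩ ⟨x, hx, rfl⟩
      γ1 := hγ1
      d0pos := hδ₀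
      δlow := hδlow
      umin := humin
      lip := hK
      unn := fun x hx => (hu01 x hx).1 }
  have ho := osc_of_mod hCtil hωnn hωmono hmod hω1 ht₀ hlog
  have h0 := ht₀.1
  have h1 := ht₀.2
  exact porous hyp (by linarith) (by linarith) ho

end
end

section
/- Let u be a local minimizer of J in B₁ with 0 ≤ u ≤ 1 which is continuously differentiable on B₁. Assume δ(x) ≥ δ₀ > 0 on B₁, 0 < γ_*(B₁) and γ^*(B₁) < 1, and that δ and γ are continuously differentiable on B₁ with Lipschitz continuous gradients (i.e., δ, γ ∈ W^{2,∞}(B₁)). If 0 ∈ F(u), then ∫_{Ω(u) ∩ B_{1/2}} u(x)^{−γ(x)/2} dx < ∞, i.e., the function x ↦ u(x)^{−γ(x)/2} is Lebesgue integrable on Ω(u) ∩ B_{1/2}. -/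
open Metric MeasureTheory Set Real

noncomputable section

/-- coordinate partial derivative -/
def dd {n : ℕ} (i : Fin n) (g : EuclideanSpace ℝ (Fin n) → ℝ) (x : EuclideanSpace ℝ (Fin n)) : ℝ :=
  fderiv ℝ g x (EuclideanSpace.single i (1:ℝ))

/-- weak form of `Δ u = f` in `Ω` -/
def WeakEq {n : ℕ} (Ω : Set (EuclideanSpace ℝ (Fin n))) (u f : EuclideanSpace ℝ (Fin n) → ℝ) : Prop :=
  ∀ ξ : EuclideanSpace ℝ (Fin n) → ℝ, ContDiff ℝ 1 ξ → HasCompactSupport ξ → tsupport ξ ⊆ Ω →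
    ∫ x, (∑ i, dd i u x * dd i ξ x) = - ∫ x, f x * ξ x

lemma gradient_coord {n : ℕ} (g : EuclideanSpace ℝ (Fin n) → ℝ) (x : EuclideanSpace ℝ (Fin n))
    (i : Fin n) : (gradient g x) i = dd i g x := by
  have := inner_gradient_left (𝕜 := ℝ) (f := g) (x := x) (y := EuclideanSpace.single i (1:ℝ))
  rw [EuclideanSpace.inner_single_right] at this
  simpa [dd] using this

lemma norm_gradient_sq {n : ℕ} (g : EuclideanSpace ℝ (Fin n) → ℝ) (x : EuclideanSpace ℝ (Fin n)) :
    ‖gradient g x‖ ^ 2 = ∑ i, (dd i g x) ^ 2 := by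
  rw [EuclideanSpace.real_norm_sq_eq]
  simp [gradient_coord]

lemma dd_sum_le {n : ℕ} {g : EuclideanSpace ℝ (Fin n) → ℝ} {C : NNReal} (hg : LipschitzWith C g)
    (x : EuclideanSpace ℝ (Fin n)) : ∑ i, (dd i g x) ^ 2 ≤ (C:ℝ) ^ 2 := by
  rw [← norm_gradient_sq]
  have : ‖gradient g x‖ = ‖fderiv ℝ g x‖ := by simp [gradient]
  rw [this]
  have := norm_fderiv_le_of_lipschitz ℝ (x₀ := x) hg
  gcongr

lemma measurable_dd {n : ℕ} (i : Fin n) (g : EuclideanSpace ℝ (Fin n) → ℝ) : Measurable (dd i g) :=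
  measurable_fderiv_apply_const ℝ g _

lemma energy_integrable {n : ℕ} {δ γ v : EuclideanSpace ℝ (Fin n) → ℝ} {C : NNReal}
    (hδm : Measurable δ) (hγm : Measurable γ) (hδbd : ∃ M, ∀ x, |δ x| ≤ M)
    (hγ : ∀ x ∈ ball (0 : EuclideanSpace ℝ (Fin n)) 1, 0 < γ x ∧ γ x < 1)
    (hv : LipschitzWith C v) :
    IntegrableOn (fun x => ((1:ℝ)/2 * ‖gradient v x‖ ^ 2 + δ x * (max (v x) 0) ^ (γ x)))
      (ball (0 : EuclideanSpace ℝ (Fin n)) 1) := by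
  obtain ⟨M, hM⟩ := hδbd
  obtain ⟨A, hA⟩ := (isCompact_closedBall (0 : EuclideanSpace ℝ (Fin n)) 1).exists_bound_of_continuousOn
    hv.continuous.continuousOn
  have hmeas : Measurable (fun x => ((1:ℝ)/2 * ‖gradient v x‖ ^ 2 + δ x * (max (v x) 0) ^ (γ x))) := by
    simp_rw [norm_gradient_sq]
    have h1 := fun i => measurable_dd i v
    have h2 := hv.continuous.measurable
    fun_prop
  refine Measure.integrableOn_of_bounded (M := (C:ℝ)^2 + M * (1 + A)) (measure_ball_lt_top).ne
    hmeas.aestronglyMeasurable ?_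
  rw [ae_restrict_iff' measurableSet_ball]
  filter_upwards with x hx
  have h1 := dd_sum_le hv x
  have h0 : 0 ≤ ∑ i, (dd i v x) ^ 2 := Finset.sum_nonneg fun i _ => sq_nonneg _
  have h2 := hA x (ball_subset_closedBall hx)
  obtain ⟨h3, h4⟩ := hγ x hx
  have hm0 : 0 ≤ max (v x) 0 := le_max_right _ _
  have h5 : (max (v x) 0) ^ (γ x) ≤ 1 + max (v x) 0 := by
    rcases le_total (max (v x) 0) 1 with h | h
    · have := Real.rpow_le_one hm0 h h3.le
      linarith
    · have := Real.rpow_le_rpow_of_exponent_le h h4.le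
      rw [Real.rpow_one] at this
      linarith
  have h6 : max (v x) 0 ≤ A := by
    refine max_le ((le_abs_self _).trans h2) ((norm_nonneg _).trans h2)
  have h7 : 0 ≤ (max (v x) 0) ^ (γ x) := Real.rpow_nonneg hm0 _
  rw [norm_gradient_sq, Real.norm_eq_abs]
  refine (abs_add_le _ _).trans ?_
  have hM0 : 0 ≤ M := (abs_nonneg _).trans (hM x)
  rw [abs_mul (δ x), abs_of_nonneg h7, abs_of_nonneg (by positivity)]
  have : |δ x| * (max (v x) 0) ^ (γ x) ≤ M * (1 + A) := by
    have := hM x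
    gcongr
    linarith
  linarith

lemma euler_lagrange {n : ℕ} {δ γ u : EuclideanSpace ℝ (Fin n) → ℝ}
    (hδm : Measurable δ) (hγm : Measurable γ) (hδbd : ∃ M, ∀ x, |δ x| ≤ M)
    (hδ : ∀ x ∈ ball (0 : EuclideanSpace ℝ (Fin n)) 1, 0 ≤ δ x)
    (hγ : ∀ x ∈ ball (0 : EuclideanSpace ℝ (Fin n)) 1, 0 < γ x ∧ γ x < 1)
    (hu : ContDiffOn ℝ 1 u (ball (0 : EuclideanSpace ℝ (Fin n)) 1))
    (hfc : ContinuousOn (fun x => γ x * δ x * u x ^ (γ x - 1))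
      {x ∈ ball (0 : EuclideanSpace ℝ (Fin n)) 1 | 0 < u x})
    (humin : IsLocalMinimizer δ γ u) :
    WeakEq {x ∈ ball (0 : EuclideanSpace ℝ (Fin n)) 1 | 0 < u x} u
      (fun x => γ x * δ x * u x ^ (γ x - 1)) := by
  intro ξ hξ hξc hξs
  obtain ⟨⟨C, hC⟩, hmin⟩ := humin
  obtain ⟨D, hD⟩ := hξ.lipschitzWith_of_hasCompactSupport hξc one_ne_zero
  set B := ball (0 : EuclideanSpace ℝ (Fin n)) 1 with hB
  have hsB : tsupport ξ ⊆ B := fun x hx => (hξs hx).1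
  have hΩo : IsOpen {x ∈ B | 0 < u x} :=
    isOpen_ball.inter (isOpen_lt continuous_const hC.continuous)
  have hdξc : ∀ i, Continuous (dd i ξ) := fun i =>
    (hξ.continuous_fderiv one_ne_zero).clm_apply continuous_const
  have hdξs : ∀ i, tsupport (dd i ξ) ⊆ tsupport ξ := fun i => by
    refine closure_minimal ?_ (isClosed_tsupport _)
    intro x hx
    by_contra h
    apply hx
    have : fderiv ℝ ξ x = 0 := by
      by_contra h2
      exact h (support_fderiv_subset ℝ h2)
    simp [dd, this]
  have hdu : ∀ i, ContinuousOn (dd i u) B := fun i =>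
    (hu.continuousOn_fderiv_of_isOpen isOpen_ball le_rfl).clm_apply continuousOn_const
  have hduξ : ∀ i, Continuous (fun x => dd i u x * dd i ξ x) := fun i => by
    refine ContinuousOn.continuous_of_tsupport_subset (s := B) ?_ isOpen_ball ?_
    · exact (hdu i).mul (hdξc i).continuousOn
    · exact (tsupport_mul_subset_right).trans ((hdξs i).trans hsB)
  have hfξ : Continuous (fun x => (γ x * δ x * u x ^ (γ x - 1)) * ξ x) := by
    refine ContinuousOn.continuous_of_tsupport_subset (s := {x ∈ B | 0 < u x}) ?_ hΩo ?_
    · exact hfc.mul hξ.continuous.continuousOn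
    · exact (tsupport_mul_subset_right).trans hξs
  have hdξcs : ∀ i, HasCompactSupport (dd i ξ) := fun i =>
    hξc.of_isClosed_subset (isClosed_tsupport _) (hdξs i)
  have hi1 : ∀ i, Integrable (fun x => dd i u x * dd i ξ x) := fun i =>
    (hduξ i).integrable_of_hasCompactSupport ((hdξcs i).mul_left)
  have hi2 : Integrable (fun x => (γ x * δ x * u x ^ (γ x - 1)) * ξ x) :=
    hfξ.integrable_of_hasCompactSupport (hξc.mul_left)
  have hi3 : ∀ i, Integrable (fun x => (dd i ξ x) ^ 2) := fun i => by
    have : Integrable (fun x => dd i ξ x * dd i ξ x) :=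
      ((hdξc i).mul (hdξc i)).integrable_of_hasCompactSupport ((hdξcs i).mul_left)
    simpa [sq] using this
  have hi1' : Integrable (fun x => ∑ i, dd i u x * dd i ξ x) := integrable_finsetSum _ fun i _ => hi1 i
  have hi3' : Integrable (fun x => ∑ i, (dd i ξ x) ^ 2) := integrable_finsetSum _ fun i _ => hi3 i
  set I1 := ∫ x, (∑ i, dd i u x * dd i ξ x) with hI1
  set I2 := ∫ x, (γ x * δ x * u x ^ (γ x - 1)) * ξ x with hI2
  set I3 := ∫ x, ∑ i, (dd i ξ x) ^ 2 with hI3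
  -- lower bound of u on the support
  obtain ⟨t0, ht0, hlow⟩ : ∃ t0 > 0, ∀ x ∈ tsupport ξ, t0 * |ξ x| ≤ u x := by
    rcases (tsupport ξ).eq_empty_or_nonempty with he | hne
    · exact ⟨1, one_pos, by simp [he]⟩
    obtain ⟨a, ha, hmin'⟩ := hξc.isCompact.exists_isMinOn hne hC.continuous.continuousOn
    obtain ⟨A, hA⟩ := hξc.isCompact.exists_bound_of_continuousOn hξ.continuous.continuousOn
    have hA0 : 0 ≤ A := (norm_nonneg _).trans (hA a ha)
    have hua : 0 < u a := (hξs ha).2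
    refine ⟨u a / (A + 1), by positivity, fun x hx => ?_⟩
    have h1 : u a ≤ u x := hmin' hx
    have h2 := hA x hx
    rw [Real.norm_eq_abs] at h2
    calc u a / (A+1) * |ξ x| ≤ u a / (A+1) * (A + 1) := by gcongr; linarith
      _ = u a := by field_simp
      _ ≤ u x := h1
  have key : ∀ t : ℝ, |t| ≤ t0 → 0 ≤ t * (I1 + I2) + t ^ 2 / 2 * I3 := by
    intro t ht
    have hv : LipschitzWith (C + ‖t‖₊ * D) (fun x => u x + t * ξ x) := by
      have h1 : LipschitzWith (‖t‖₊ * D) (fun x => t * ξ x) := by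
        have := (lipschitzWith_smul (β := ℝ) t).comp hD
        simpa [Function.comp_def] using this
      exact hC.add h1
    have hJ := hmin (fun x => u x + t * ξ x) ⟨_, hv⟩ ⟨tsupport ξ, hξc.isCompact, hsB, by
      intro x hx
      by_contra h
      apply hx
      simp [image_eq_zero_of_notMem_tsupport h]⟩
    have hIu := energy_integrable hδm hγm hδbd hγ hC
    have hIv := energy_integrable hδm hγm hδbd hγ hv
    unfold energyJ at hJ
    rw [← sub_nonneg, ← integral_sub hIv hIu] at hJ
    have hIr : Integrable (fun x => t * ((∑ i, dd i u x * dd i ξ x) +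
        (γ x * δ x * u x ^ (γ x - 1)) * ξ x) + t ^ 2 / 2 * ∑ i, (dd i ξ x) ^ 2) :=
      ((hi1'.add hi2).const_mul t).add (hi3'.const_mul _)
    have hle : ∫ x in B, (((1:ℝ)/2 * ‖gradient (fun x => u x + t * ξ x) x‖ ^ 2 + δ x * (max (u x + t * ξ x) 0) ^ (γ x))
        - ((1:ℝ)/2 * ‖gradient u x‖ ^ 2 + δ x * (max (u x) 0) ^ (γ x))) ≤
        ∫ x in B, (t * ((∑ i, dd i u x * dd i ξ x) +
        (γ x * δ x * u x ^ (γ x - 1)) * ξ x) + t ^ 2 / 2 * ∑ i, (dd i ξ x) ^ 2) := by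
      refine setIntegral_mono_on (hIv.sub hIu) hIr.integrableOn measurableSet_ball ?_
      intro x hx
      have hdx : DifferentiableAt ℝ u x := (hu.differentiableOn one_ne_zero).differentiableAt
        (isOpen_ball.mem_nhds hx)
      have hdξ : DifferentiableAt ℝ ξ x := (hξ.differentiable one_ne_zero) x
      have hgr : ∀ i, dd i (fun x => u x + t * ξ x) x = dd i u x + t * dd i ξ x := by
        intro i
        have h1 := (hdx.hasFDerivAt.add (hdξ.hasFDerivAt.const_mul t)).fderiv
        unfold dd
        erw [h1]
        simp
      rw [norm_gradient_sq, norm_gradient_sq]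
      simp_rw [hgr]
      have hsq : ∑ i, (dd i u x + t * dd i ξ x) ^ 2 = ∑ i, (dd i u x)^2 +
          2 * t * (∑ i, dd i u x * dd i ξ x) + t^2 * ∑ i, (dd i ξ x)^2 := by
        rw [Finset.mul_sum, Finset.mul_sum, ← Finset.sum_add_distrib, ← Finset.sum_add_distrib]
        refine Finset.sum_congr rfl fun i _ => by ring
      rw [hsq]
      have hpot : δ x * (max (u x + t * ξ x) 0) ^ (γ x) - δ x * (max (u x) 0) ^ (γ x) ≤
          t * ((γ x * δ x * u x ^ (γ x - 1)) * ξ x) := by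
        by_cases hxs : x ∈ tsupport ξ
        · have hux : 0 < u x := (hξs hxs).2
          have h1 : |t * ξ x| ≤ u x := by
            rw [abs_mul]
            exact (mul_le_mul_of_nonneg_right ht (abs_nonneg _)).trans (hlow x hxs)
          have h2 : 0 ≤ u x + t * ξ x := by have := neg_abs_le (t * ξ x); linarith
          rw [max_eq_left h2, max_eq_left hux.le]
          have h3 : u x + t * ξ x = u x * (1 + t * ξ x / u x) := by field_simp
          have h4 : -1 ≤ t * ξ x / u x := by
            rw [le_div_iff₀ hux]; have := neg_abs_le (t * ξ x); linarith
          have h5 := rpow_one_add_le_one_add_mul_self h4 (hγ x hx).1.le (hγ x hx).2.le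
          have h6 : u x ^ (γ x) = u x ^ (γ x - 1) * u x := by
            rw [Real.rpow_sub_one hux.ne']; field_simp
          have h8 : 0 < u x ^ (γ x) := Real.rpow_pos_of_pos hux _
          rw [h3, Real.mul_rpow hux.le (by linarith)]
          have h7 : u x ^ (γ x) * (1 + t * ξ x / u x) ^ (γ x) ≤ u x ^ (γ x) * (1 + γ x * (t * ξ x / u x)) := by
            gcongr
          have h9 : u x ^ (γ x) * (1 + γ x * (t * ξ x / u x)) = u x ^ (γ x) + u x ^ (γ x - 1) * γ x * (t * ξ x) := by
            rw [h6]; field_simp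
          rw [h9] at h7
          have := mul_le_mul_of_nonneg_left h7 (hδ x hx)
          nlinarith
        · simp [image_eq_zero_of_notMem_tsupport hxs]
      linarith
    have heq : ∫ x in B, (t * ((∑ i, dd i u x * dd i ξ x) +
        (γ x * δ x * u x ^ (γ x - 1)) * ξ x) + t ^ 2 / 2 * ∑ i, (dd i ξ x) ^ 2) =
        t * (I1 + I2) + t ^ 2 / 2 * I3 := by
      rw [setIntegral_eq_integral_of_forall_compl_eq_zero]
      · have hs : Integrable (fun x => t * ((∑ i, dd i u x * dd i ξ x) +
            (γ x * δ x * u x ^ (γ x - 1)) * ξ x)) := (hi1'.add hi2).const_mul t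
        rw [integral_add hs (hi3'.const_mul _), integral_const_mul,
          integral_const_mul, integral_add hi1' hi2]
      · intro x hx
        have h1 : x ∉ tsupport ξ := fun h => hx (hsB h)
        have h2 : ∀ i, dd i ξ x = 0 := fun i => by
          have : x ∉ tsupport (dd i ξ) := fun h => h1 (hdξs i h)
          exact image_eq_zero_of_notMem_tsupport this
        simp [h2, image_eq_zero_of_notMem_tsupport h1]
    rw [heq] at hle
    exact hJ.trans hle
  -- conclude
  have hI3 : 0 ≤ I3 := integral_nonneg fun x => Finset.sum_nonneg fun i _ => sq_nonneg _
  have hsum : I1 + I2 = 0 := by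
    by_contra hne
    set S := I1 + I2
    set s := min t0 (|S| / (I3 + 1)) with hs
    have hS : 0 < |S| := abs_pos.mpr hne
    have hs0 : 0 < s := lt_min ht0 (by positivity)
    have hs1 : s * I3 ≤ |S| := by
      have : s ≤ |S| / (I3+1) := min_le_right _ _
      rw [le_div_iff₀ (by positivity)] at this
      nlinarith
    rcases lt_or_gt_of_ne hne with h | h
    · have := key s (by rw [abs_of_pos hs0]; exact min_le_left _ _)
      rw [abs_of_neg h] at hs1
      nlinarith
    · have := key (-s) (by rw [abs_neg, abs_of_pos hs0]; exact min_le_left _ _)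
      rw [abs_of_pos h] at hs1
      nlinarith
  linarith


/-- directional derivative -/
def dv {n : ℕ} (e : EuclideanSpace ℝ (Fin n)) (g : EuclideanSpace ℝ (Fin n) → ℝ)
    (x : EuclideanSpace ℝ (Fin n)) : ℝ := fderiv ℝ g x e

/-- convolution -/
def cv {n : ℕ} (η g : EuclideanSpace ℝ (Fin n) → ℝ) (x : EuclideanSpace ℝ (Fin n)) : ℝ :=
  convolution η g (ContinuousLinearMap.lsmul ℝ ℝ) volume x

lemma cv_eq {n : ℕ} (η g : EuclideanSpace ℝ (Fin n) → ℝ) (x : EuclideanSpace ℝ (Fin n)) :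
    cv η g x = ∫ t, η (x - t) * g t := by
  unfold cv
  rw [convolution_eq_swap]
  simp

lemma dv_contDiff {n : ℕ} {e : EuclideanSpace ℝ (Fin n)} {η : EuclideanSpace ℝ (Fin n) → ℝ} {k m : WithTop ℕ∞}
    (hη : ContDiff ℝ m η) (h : k + 1 ≤ m) : ContDiff ℝ k (dv e η) :=
  (hη.fderiv_right h).clm_apply contDiff_const

lemma dv_tsupport {n : ℕ} {e : EuclideanSpace ℝ (Fin n)} {η : EuclideanSpace ℝ (Fin n) → ℝ} :
    tsupport (dv e η) ⊆ tsupport η := tsupport_fderiv_apply_subset ℝ e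

lemma dv_compact {n : ℕ} {e : EuclideanSpace ℝ (Fin n)} {η : EuclideanSpace ℝ (Fin n) → ℝ}
    (hη : HasCompactSupport η) : HasCompactSupport (dv e η) :=
  HasCompactSupport.fderiv_apply (𝕜 := ℝ) hη e

lemma cv_hasFDerivAt {n : ℕ} {η g : EuclideanSpace ℝ (Fin n) → ℝ} (hη : ContDiff ℝ 1 η)
    (hc : HasCompactSupport η) (hg : LocallyIntegrable g) (x : EuclideanSpace ℝ (Fin n)) :
    ∃ L : EuclideanSpace ℝ (Fin n) →L[ℝ] ℝ, HasFDerivAt (cv η g) L x ∧ ∀ e, L e = cv (dv e η) g x := by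
  refine ⟨_, hc.hasFDerivAt_convolution_left (ContinuousLinearMap.lsmul ℝ ℝ) hη hg x, fun e => ?_⟩
  unfold cv
  rw [convolution_def, convolution_def, ContinuousLinearMap.integral_apply]
  · rfl
  · exact (hc.fderiv ℝ).convolutionExists_left _ (hη.continuous_fderiv one_ne_zero) hg x

lemma cv_line {n : ℕ} {η g : EuclideanSpace ℝ (Fin n) → ℝ} (hη : ContDiff ℝ 1 η)
    (hc : HasCompactSupport η) (hg : LocallyIntegrable g) (x e : EuclideanSpace ℝ (Fin n)) (t : ℝ) :
    HasDerivAt (fun t : ℝ => cv η g (x + t • e)) (cv (dv e η) g (x + t • e)) t := by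
  obtain ⟨L, hL, hLe⟩ := cv_hasFDerivAt hη hc hg (x + t • e)
  rw [← hLe]
  have h2 : HasDerivAt (fun t : ℝ => x + t • e) e t := by
    simpa using ((hasDerivAt_id t).smul_const e).const_add x
  exact hL.comp_hasDerivAt t h2

lemma contDiff_tsupp {n : ℕ} {g : EuclideanSpace ℝ (Fin n) → ℝ}
    (h : ∀ x ∈ tsupport g, ContDiffAt ℝ 1 g x) : ContDiff ℝ 1 g := by
  rw [contDiff_iff_contDiffAt]
  intro x
  by_cases hx : x ∈ tsupport g
  · exact h x hx
  · exact (contDiffAt_const (c := (0:ℝ))).congr_of_eventuallyEq (notMem_tsupport_iff_eventuallyEq.mp hx)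

/-- the reflected kernel -/
lemma refl_kernel {n : ℕ} {η : EuclideanSpace ℝ (Fin n) → ℝ} (hη : ContDiff ℝ 1 η)
    (hc : HasCompactSupport η) (x : EuclideanSpace ℝ (Fin n)) :
    ContDiff ℝ 1 (fun t => η (x - t)) ∧ HasCompactSupport (fun t => η (x - t)) ∧
    (∀ e t, dv e (fun t => η (x - t)) t = - dv e η (x - t)) ∧
    (∀ t, t ∈ tsupport (fun t => η (x - t)) → x - t ∈ tsupport η) := by
  have hdiff := hη.differentiable one_ne_zero
  refine ⟨hη.comp (contDiff_const.sub contDiff_id), ?_, ?_, ?_⟩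
  · exact hc.comp_homeomorph (Homeomorph.subLeft x)
  · intro e t
    unfold dv
    by_cases hm : DifferentiableAt ℝ η (x - t)
    · have h1 : HasFDerivAt (fun t => x - t) (-ContinuousLinearMap.id ℝ _) t :=
        (hasFDerivAt_id t).const_sub x
      have h2 := (hm.hasFDerivAt.comp t h1).fderiv
      erw [h2]
      simp
    · exact absurd (hdiff _) hm
  · intro t ht
    have hcl : IsClosed ((fun t => x - t) ⁻¹' tsupport η) :=
      (isClosed_tsupport η).preimage (by fun_prop)
    refine closure_minimal ?_ hcl ht
    intro s hs
    exact subset_tsupport _ hs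

lemma cv_parts_lip {n : ℕ} {η u : EuclideanSpace ℝ (Fin n) → ℝ} {C : NNReal} (hη : ContDiff ℝ 1 η)
    (hc : HasCompactSupport η) (hu : LipschitzWith C u) (x e : EuclideanSpace ℝ (Fin n)) :
    cv (dv e η) u x = cv η (dv e u) x := by
  obtain ⟨h1, h2, h3, -⟩ := refl_kernel hη hc x
  obtain ⟨D, hD⟩ := h1.lipschitzWith_of_hasCompactSupport h2 one_ne_zero
  have := hu.integral_lineDeriv_mul_eq (μ := volume) hD h2 e
  rw [cv_eq, cv_eq]
  have hl : ∫ t, lineDeriv ℝ u t e * η (x - t) = ∫ t, η (x - t) * dv e u t := by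
    refine integral_congr_ae ?_
    filter_upwards [hu.ae_differentiableAt] with t ht
    rw [ht.lineDeriv_eq_fderiv, mul_comm]; rfl
  have hr : ∫ t, lineDeriv ℝ (fun t => η (x - t)) t (-e) * u t = ∫ t, dv e η (x - t) * u t := by
    refine integral_congr_ae ?_
    filter_upwards with t
    rw [((h1.differentiable one_ne_zero) t).lineDeriv_eq_fderiv]
    have := h3 e t
    unfold dv at this ⊢
    rw [map_neg, this, neg_neg]
  rw [← hl, ← hr, this]

lemma integral_dv_eq_zero {n : ℕ} {P : EuclideanSpace ℝ (Fin n) → ℝ} (hP : ContDiff ℝ 1 P)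
    (hc : HasCompactSupport P) (e : EuclideanSpace ℝ (Fin n)) : ∫ t, dv e P t = 0 := by
  obtain ⟨D, hD⟩ := hP.lipschitzWith_of_hasCompactSupport hc one_ne_zero
  have := (LipschitzWith.const (1:ℝ) : LipschitzWith 0 (fun _ : EuclideanSpace ℝ (Fin n) => (1:ℝ))).integral_lineDeriv_mul_eq
    (μ := volume) hD hc (-e)
  simp only [neg_neg, mul_one] at this
  have h0 : ∀ t : EuclideanSpace ℝ (Fin n), lineDeriv ℝ (fun _ : EuclideanSpace ℝ (Fin n) => (1:ℝ)) t (-e) = 0 := by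
    intro t; simp [lineDeriv]
  simp only [h0, zero_mul, integral_zero] at this
  rw [this]
  refine integral_congr_ae (Filter.Eventually.of_forall fun t => ?_)
  exact (((hP.differentiable one_ne_zero) t).lineDeriv_eq_fderiv).symm

lemma dv_continuousOn {n : ℕ} {g : EuclideanSpace ℝ (Fin n) → ℝ} {Ω : Set (EuclideanSpace ℝ (Fin n))}
    (hΩ : IsOpen Ω) (hg : ContDiffOn ℝ 1 g Ω) (e : EuclideanSpace ℝ (Fin n)) :
    ContinuousOn (dv e g) Ω :=
  (hg.continuousOn_fderiv_of_isOpen hΩ le_rfl).clm_apply continuousOn_const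

lemma cv_parts_C1 {n : ℕ} {η f : EuclideanSpace ℝ (Fin n) → ℝ} {Ω : Set (EuclideanSpace ℝ (Fin n))}
    (hΩ : IsOpen Ω) (hη : ContDiff ℝ 1 η)
    (hc : HasCompactSupport η) (hf : ContDiffOn ℝ 1 f Ω) (x e : EuclideanSpace ℝ (Fin n))
    (hx : ∀ t, x - t ∈ tsupport η → t ∈ Ω) :
    cv (dv e η) f x = cv η (dv e f) x := by
  obtain ⟨h1, h2, h3, h4⟩ := refl_kernel hη hc x
  have hs : tsupport (fun t => η (x - t)) ⊆ Ω := fun t ht => hx t (h4 t ht)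
  set ζ := fun t => η (x - t) with hζ
  have hP : ContDiff ℝ 1 (fun t => ζ t * f t) := by
    refine contDiff_tsupp fun t ht => ?_
    have ht' : t ∈ Ω := hs (tsupport_mul_subset_left ht)
    exact h1.contDiffAt.mul (hf.contDiffAt (hΩ.mem_nhds ht'))
  have hPc : HasCompactSupport (fun t => ζ t * f t) := h2.mul_right
  have h0 := integral_dv_eq_zero hP hPc e
  have hd : ∀ t, dv e (fun t => ζ t * f t) t = ζ t * dv e f t - dv e η (x - t) * f t := by
    intro t
    by_cases ht : t ∈ tsupport ζ
    · have hft := ((hf.differentiableOn one_ne_zero).differentiableAt (hΩ.mem_nhds (hs ht)))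
      have := ((h1.differentiable one_ne_zero) t).hasFDerivAt.mul hft.hasFDerivAt
      have h5 := this.fderiv
      have h6 := h3 e t
      unfold dv at h6 ⊢
      erw [h5]
      simp only [add_apply, smul_apply, smul_eq_mul]
      rw [h6]; ring
    · have h5 : t ∉ tsupport (fun t => ζ t * f t) := fun h => ht (tsupport_mul_subset_left h)
      have h6 : dv e (fun t => ζ t * f t) t = 0 :=
        image_eq_zero_of_notMem_tsupport fun h => h5 (dv_tsupport h)
      have h7 : dv e ζ t = 0 := image_eq_zero_of_notMem_tsupport fun h => ht (dv_tsupport h)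
      rw [h3] at h7
      rw [h6, image_eq_zero_of_notMem_tsupport ht, neg_eq_zero.mp h7]; ring
  simp_rw [hd] at h0
  have i1 : Integrable (fun t => ζ t * dv e f t) := by
    refine Continuous.integrable_of_hasCompactSupport ?_ h2.mul_right
    refine ContinuousOn.continuous_of_tsupport_subset (s := Ω) ?_ hΩ (tsupport_mul_subset_left.trans hs)
    exact h1.continuous.continuousOn.mul (dv_continuousOn hΩ hf e)
  have i2 : Integrable (fun t => dv e η (x - t) * f t) := by
    have i2' : Integrable (fun t => dv e ζ t * f t) := by
      refine Continuous.integrable_of_hasCompactSupport ?_ (dv_compact h2).mul_right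
      refine ContinuousOn.continuous_of_tsupport_subset (s := Ω) ?_ hΩ
        (tsupport_mul_subset_left.trans (dv_tsupport.trans hs))
      exact (dv_contDiff (k := 0) h1 (by simp)).continuous.continuousOn.mul hf.continuousOn
    have : (fun t => dv e η (x - t) * f t) = fun t => -(dv e ζ t * f t) := by
      ext t; rw [h3]; ring
    rw [this]; exact i2'.neg
  rw [integral_sub i1 i2] at h0
  rw [cv_eq, cv_eq]
  linarith

lemma cv_weak {n : ℕ} {η u f : EuclideanSpace ℝ (Fin n) → ℝ} {Ω : Set (EuclideanSpace ℝ (Fin n))}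
    {C : NNReal} (hη : ContDiff ℝ 2 η)
    (hc : HasCompactSupport η) (hu : LipschitzWith C u) (hw : WeakEq Ω u f)
    (x : EuclideanSpace ℝ (Fin n))
    (hx : ∀ t, x - t ∈ tsupport η → t ∈ Ω) :
    ∑ i, cv (dv (EuclideanSpace.single i 1) (dv (EuclideanSpace.single i 1) η)) u x = cv η f x := by
  have hη1 : ContDiff ℝ 1 η := hη.of_le (by norm_num)
  obtain ⟨h1, h2, h3, h4⟩ := refl_kernel hη1 hc x
  have hs : tsupport (fun t => η (x - t)) ⊆ Ω := fun t ht => hx t (h4 t ht)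
  set ζ := fun t => η (x - t) with hζ
  have hwζ := hw ζ h1 h2 hs
  have hintg : ∀ i, Integrable (fun t => dd i u t * dd i ζ t) := by
    intro i
    have : Integrable (dd i ζ) := by
      refine Continuous.integrable_of_hasCompactSupport ?_ (dv_compact h2)
      exact (dv_contDiff (k := 0) h1 (by simp)).continuous
    refine this.bdd_mul (c := C) (measurable_dd i u).aestronglyMeasurable ?_
    filter_upwards with t
    have h5 := dd_sum_le hu t
    have h6 : (dd i u t)^2 ≤ ∑ i, (dd i u t)^2 :=
      Finset.single_le_sum (f := fun i => (dd i u t)^2) (fun i _ => sq_nonneg _) (Finset.mem_univ i)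
    rw [Real.norm_eq_abs]
    exact abs_le_of_sq_le_sq (h6.trans h5) C.2
  have hterm : ∀ i, cv (dv (EuclideanSpace.single i 1) (dv (EuclideanSpace.single i 1) η)) u x =
      - ∫ t, dd i u t * dd i ζ t := by
    intro i
    rw [cv_parts_lip (dv_contDiff hη (by norm_num)) (dv_compact hc) hu, cv_eq, ← integral_neg]
    refine integral_congr_ae (Filter.Eventually.of_forall fun t => ?_)
    have : dd i ζ t = - dv (EuclideanSpace.single i 1) η (x - t) := h3 _ t
    simp only [this]
    simp only [dd, dv]; ring
  simp_rw [hterm]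
  rw [Finset.sum_neg_distrib, ← integral_finsetSum _ (fun i _ => hintg i), hwζ, neg_neg, cv_eq]
  refine integral_congr_ae (Filter.Eventually.of_forall fun t => ?_)
  simp only [hζ]; ring


lemma second_order {q q' : ℝ → ℝ} {c : ℝ} (h : ∀ᶠ t in nhds (0:ℝ), HasDerivAt q (q' t) t)
    (h2 : HasDerivAt q' c 0) (hm : IsLocalMax q 0) : q' 0 = 0 ∧ c ≤ 0 := by
  have h0 := h.self_of_nhds
  have hz : q' 0 = 0 := hm.hasDerivAt_eq_zero h0
  refine ⟨hz, ?_⟩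
  by_contra hc
  push Not at hc
  have hd : deriv q =ᶠ[nhds 0] q' := h.mono fun t ht => ht.deriv
  have hdd : deriv (deriv q) 0 = c := by rw [hd.deriv_eq]; exact h2.deriv
  have hmin := isLocalMin_of_deriv_deriv_pos (f := q) (x₀ := 0) (by rw [hdd]; exact hc)
    (by rw [h0.deriv, hz]) h0.continuousAt
  have hconst : q =ᶠ[nhds 0] fun _ => q 0 := by
    filter_upwards [hm, hmin] with t h1 h2
    exact le_antisymm h1 h2
  have h3 : deriv q =ᶠ[nhds 0] fun _ => 0 := by
    have := hconst.deriv
    simpa using this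
  have h4 : deriv (deriv q) 0 = 0 := by rw [h3.deriv_eq]; simp
  rw [hdd] at h4
  exact hc.ne' h4

lemma line_ineq {w w1 v v1 p p1 r r1 : ℝ → ℝ} {w2 v2 p2 r2 K Λ : ℝ}
    (hw : ∀ t, HasDerivAt w (w1 t) t) (hw1 : HasDerivAt w1 w2 0)
    (hv : ∀ t, HasDerivAt v (v1 t) t) (hv1 : HasDerivAt v1 v2 0)
    (hp : ∀ t, HasDerivAt p (p1 t) t) (hp1 : HasDerivAt p1 p2 0)
    (hr : ∀ t, HasDerivAt r (r1 t) t) (hr1 : HasDerivAt r1 r2 0)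
    (hv0 : 0 < v 0)
    (hm : IsLocalMax (fun t => w t ^ 2 - K * v t ^ p t - Λ * v t - r t) 0) :
    (K * (v1 0 * p 0 * v 0 ^ (p 0 - 1) + p1 0 * v 0 ^ p 0 * log (v 0)) + Λ * v1 0 + r1 0) ^ 2
      + 4 * w 0 ^ 3 * w2 ≤
    2 * w 0 ^ 2 * (K * (v2 * p 0 * v 0 ^ (p 0 - 1) + (2 * v1 0 * p1 0 * v 0 ^ (p 0 - 1)
      + 2 * v1 0 * p 0 * p1 0 * v 0 ^ (p 0 - 1) * log (v 0)
      + p 0 * (p 0 - 1) * v1 0 ^ 2 * v 0 ^ (p 0 - 2)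
      + p2 * v 0 ^ p 0 * log (v 0) + p1 0 ^ 2 * v 0 ^ p 0 * log (v 0) ^ 2)) + Λ * v2 + r2) := by
  have hev : ∀ᶠ t in nhds (0:ℝ), 0 < v t := (hv 0).continuousAt.eventually (lt_mem_nhds hv0)
  have h1 : ∀ᶠ t in nhds (0:ℝ), HasDerivAt (fun t => w t ^ 2 - K * v t ^ p t - Λ * v t - r t)
      (2 * w t * w1 t - K * (v1 t * p t * v t ^ (p t - 1) + p1 t * v t ^ p t * log (v t)) - Λ * v1 t - r1 t) t := by
    filter_upwards [hev] with t ht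
    have := ((((hw t).pow 2).sub (((hv t).rpow (hp t) ht).const_mul K)).sub ((hv t).const_mul Λ)).sub (hr t)
    refine this.congr_deriv ?_
    simp
  have e1 : v 0 ^ (p 0) = v 0 ^ (p 0 - 1) * v 0 := by
    rw [Real.rpow_sub_one hv0.ne']; field_simp
  have e2 : v 0 ^ (p 0 - 1 - 1) = v 0 ^ (p 0 - 2) := by congr 1; ring
  have h2 : HasDerivAt (fun t => 2 * w t * w1 t - K * (v1 t * p t * v t ^ (p t - 1) + p1 t * v t ^ p t * log (v t)) - Λ * v1 t - r1 t)
      (2 * w1 0 ^ 2 + 2 * w 0 * w2 - (K * (v2 * p 0 * v 0 ^ (p 0 - 1) + (2 * v1 0 * p1 0 * v 0 ^ (p 0 - 1)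
      + 2 * v1 0 * p 0 * p1 0 * v 0 ^ (p 0 - 1) * log (v 0)
      + p 0 * (p 0 - 1) * v1 0 ^ 2 * v 0 ^ (p 0 - 2)
      + p2 * v 0 ^ p 0 * log (v 0) + p1 0 ^ 2 * v 0 ^ p 0 * log (v 0) ^ 2)) + Λ * v2 + r2)) 0 := by
    have a1 := ((hw 0).const_mul 2).mul hw1
    have a2 := (hv1.mul (hp 0)).mul ((hv 0).rpow ((hp 0).sub_const 1) hv0)
    have a3 := (hp1.mul ((hv 0).rpow (hp 0) hv0)).mul ((hv 0).log hv0.ne')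
    have := ((a1.sub ((a2.add a3).const_mul K)).sub (hv1.const_mul Λ)).sub hr1
    refine this.congr_deriv ?_
    simp only [Pi.mul_apply]
    rw [e2, e1]
    field_simp
    ring
  obtain ⟨h3, h4⟩ := second_order h1 h2 hm
  have h5 : K * (v1 0 * p 0 * v 0 ^ (p 0 - 1) + p1 0 * v 0 ^ p 0 * log (v 0)) + Λ * v1 0 + r1 0 =
    2 * w 0 * w1 0 := by linarith
  rw [h5]
  have := mul_le_mul_of_nonneg_left h4 (show 0 ≤ 2 * w 0 ^ 2 by positivity)
  linarith

lemma smooth_line {n : ℕ} {g : EuclideanSpace ℝ (Fin n) → ℝ} (hg : ContDiff ℝ 1 g)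
    (x e : EuclideanSpace ℝ (Fin n)) (t : ℝ) :
    HasDerivAt (fun t : ℝ => g (x + t • e)) (dv e g (x + t • e)) t := by
  have h2 : HasDerivAt (fun t : ℝ => x + t • e) e t := by
    simpa using ((hasDerivAt_id t).smul_const e).const_add x
  exact ((hg.differentiable one_ne_zero) _).hasFDerivAt.comp_hasDerivAt t h2

lemma cv_tendsto {n : ℕ} {φ : ℕ → ContDiffBump (0 : EuclideanSpace ℝ (Fin n))}
    {g : EuclideanSpace ℝ (Fin n) → ℝ} {k : ℕ → EuclideanSpace ℝ (Fin n)} {a : EuclideanSpace ℝ (Fin n)}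
    (hφ : Filter.Tendsto (fun j => (φ j).rOut) Filter.atTop (nhds 0))
    (hg : Measurable g) (hga : ContinuousAt g a) (hk : Filter.Tendsto k Filter.atTop (nhds a)) :
    Filter.Tendsto (fun j => cv ((φ j).normed volume) g (k j)) Filter.atTop (nhds (g a)) := by
  refine ContDiffBump.convolution_tendsto_right (g := fun _ => g) hφ
    (Filter.Eventually.of_forall fun _ => hg.aestronglyMeasurable) ?_ hk
  exact hga.tendsto.comp Filter.tendsto_snd

lemma key_ineq {n : ℕ} {Ω : Set (EuclideanSpace ℝ (Fin n))} (hΩ : IsOpen Ω)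
    {u f p r : EuclideanSpace ℝ (Fin n) → ℝ} {C : NNReal} (hu : LipschitzWith C u)
    (huC : ContDiffOn ℝ 1 u Ω) (hfC : ContDiffOn ℝ 1 f Ω) (hfm : Measurable f)
    (hw : WeakEq Ω u f) (hp : ContDiff ℝ 2 p) (hr : ContDiff ℝ 2 r) {K Λ : ℝ}
    {xs e : EuclideanSpace ℝ (Fin n)} (hxs : xs ∈ Ω) (hupos : 0 < u xs) (hppos : 0 < p xs)
    (hmax : ∀ᶠ x in nhds xs, dv e u x ^ 2 - K * u x ^ p x - Λ * u x - r x ≤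
      dv e u xs ^ 2 - K * u xs ^ p xs - Λ * u xs - r xs) :
    (∑ i, (K * (dd i u xs * p xs * u xs ^ (p xs - 1) + dd i p xs * u xs ^ p xs * log (u xs))
        + Λ * dd i u xs + dd i r xs) ^ 2)
      + 4 * dv e u xs ^ 3 * dv e f xs ≤
    2 * dv e u xs ^ 2 * ((K * (p xs * u xs ^ (p xs - 1)) + Λ) * f xs +
      ∑ i, (K * (2 * dd i u xs * dd i p xs * u xs ^ (p xs - 1)
      + 2 * dd i u xs * p xs * dd i p xs * u xs ^ (p xs - 1) * log (u xs)
      + p xs * (p xs - 1) * dd i u xs ^ 2 * u xs ^ (p xs - 2)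
      + dd i (dd i p) xs * u xs ^ p xs * log (u xs)
      + dd i p xs ^ 2 * u xs ^ p xs * log (u xs) ^ 2) + (dd i (dd i r) xs + 2))) := by
  -- the small ball
  have hpc : Continuous p := hp.continuous
  obtain ⟨ρ, hρ, hball⟩ : ∃ ρ > 0, closedBall xs ρ ⊆ {x | x ∈ Ω ∧ 0 < p x ∧
      dv e u x ^ 2 - K * u x ^ p x - Λ * u x - r x ≤
      dv e u xs ^ 2 - K * u xs ^ p xs - Λ * u xs - r xs} := by
    have : {x | x ∈ Ω ∧ 0 < p x ∧
      dv e u x ^ 2 - K * u x ^ p x - Λ * u x - r x ≤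
      dv e u xs ^ 2 - K * u xs ^ p xs - Λ * u xs - r xs} ∈ nhds xs := by
      filter_upwards [hΩ.mem_nhds hxs, hpc.continuousAt.eventually (lt_mem_nhds hppos), hmax] with x h1 h2 h3
      exact ⟨h1, h2, h3⟩
    exact Metric.nhds_basis_closedBall.mem_iff.mp this
  let φ : ℕ → ContDiffBump (0 : EuclideanSpace ℝ (Fin n)) := fun j =>
    ⟨1 / (2 * ((j:ℝ) + 1)), 1 / ((j:ℝ) + 1), by positivity, by
      have : (0:ℝ) ≤ j := by positivity
      exact one_div_lt_one_div_of_lt (by positivity) (by linarith)⟩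
  have hφ : Filter.Tendsto (fun j => (φ j).rOut) Filter.atTop (nhds 0) :=
    tendsto_one_div_add_atTop_nhds_zero_nat
  let η : ℕ → EuclideanSpace ℝ (Fin n) → ℝ := fun j => (φ j).normed volume
  have hη : ∀ j, ContDiff ℝ 4 (η j) := fun j => (φ j).contDiff_normed (n := 4)
  have hηc : ∀ j, HasCompactSupport (η j) := fun j => (φ j).hasCompactSupport_normed
  have hul : LocallyIntegrable u := hu.continuous.locallyIntegrable
  have hη1 : ∀ j, ContDiff ℝ 1 (η j) := fun j => (hη j).of_le (by norm_num)
  have hη2 : ∀ j, ContDiff ℝ 2 (η j) := fun j => (hη j).of_le (by norm_num)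
  have hd3 : ∀ j e, ContDiff ℝ 3 (dv e (η j)) := fun j e => dv_contDiff (hη j) (by norm_num)
  have hd1 : ∀ j e, ContDiff ℝ 1 (dv e (η j)) := fun j e => (hd3 j e).of_le (by norm_num)
  have hdd1 : ∀ j e e', ContDiff ℝ 1 (dv e' (dv e (η j))) := fun j e e' =>
    dv_contDiff (hd3 j e) (by norm_num)
  have hvcont : ∀ j, Continuous (cv (η j) u) := fun j => by
    rw [continuous_iff_continuousAt]
    intro x
    obtain ⟨L, hL, -⟩ := cv_hasFDerivAt (hη1 j) (hηc j) hul x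
    exact hL.continuousAt
  have hwcont : ∀ j, Continuous (cv (dv e (η j)) u) := fun j => by
    rw [continuous_iff_continuousAt]
    intro x
    obtain ⟨L, hL, -⟩ := cv_hasFDerivAt (hd1 j e) (dv_compact (hηc j)) hul x
    exact hL.continuousAt
  let q : ℕ → EuclideanSpace ℝ (Fin n) → ℝ := fun j x =>
    cv (dv e (η j)) u x ^ 2 - K * cv (η j) u x ^ p x - Λ * cv (η j) u x - (r x + ‖x - xs‖ ^ 2)
  have hq : ∀ j, ContinuousOn (q j) (closedBall xs ρ) := by
    intro j
    have h1 : ContinuousOn (fun x => cv (η j) u x ^ p x) (closedBall xs ρ) :=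
      (hvcont j).continuousOn.rpow hpc.continuousOn fun x hx => Or.inr (hball hx).2.1
    have h2 := hr.continuous
    have h3 := hwcont j
    have h4 := hvcont j
    exact (((h3.pow 2).continuousOn.sub (h1.const_mul K)).sub (h4.continuousOn.const_mul Λ)).sub
      (by fun_prop)
  have hex : ∀ j, ∃ x ∈ closedBall xs ρ, ∀ y ∈ closedBall xs ρ, q j y ≤ q j x := fun j => by
    obtain ⟨x, hx, h⟩ := (isCompact_closedBall xs ρ).exists_isMaxOn ⟨xs, mem_closedBall_self hρ.le⟩ (hq j)
    exact ⟨x, hx, fun y hy => h hy⟩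
  choose X hX hXm using hex
  obtain ⟨a, ha, ψ, hψ, hXa⟩ := (isCompact_closedBall xs ρ).tendsto_subseq hX
  have hφψ : Filter.Tendsto (fun j => (φ (ψ j)).rOut) Filter.atTop (nhds 0) := hφ.comp hψ.tendsto_atTop
  have hmdu : ∀ e, Measurable (dv e u) := fun e => measurable_fderiv_apply_const ℝ u e
  have hduc : ∀ e, ∀ a ∈ Ω, ContinuousAt (dv e u) a := fun e a ha =>
    (dv_continuousOn hΩ huC e).continuousAt (hΩ.mem_nhds ha)
  have hqlim : ∀ (k : ℕ → EuclideanSpace ℝ (Fin n)) (b : EuclideanSpace ℝ (Fin n)), b ∈ closedBall xs ρ →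
      Filter.Tendsto k Filter.atTop (nhds b) →
      Filter.Tendsto (fun j => q (ψ j) (k j)) Filter.atTop
        (nhds (dv e u b ^ 2 - K * u b ^ p b - Λ * u b - (r b + ‖b - xs‖^2))) := by
    intro k b hb hk
    have t1 := cv_tendsto hφψ hu.continuous.measurable hu.continuous.continuousAt hk
    have t2 := cv_tendsto hφψ (hmdu e) (hduc e b (hball hb).1) hk
    have t2' : Filter.Tendsto (fun j => cv (dv e (η (ψ j))) u (k j)) Filter.atTop (nhds (dv e u b)) := by
      refine t2.congr fun j => ?_
      exact (cv_parts_lip (hη1 _) (hηc _) hu _ _).symm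
    have t3 : Filter.Tendsto (fun j => p (k j)) Filter.atTop (nhds (p b)) :=
      (hpc.tendsto b).comp hk
    have t4 : Filter.Tendsto (fun j => r (k j)) Filter.atTop (nhds (r b)) :=
      (hr.continuous.tendsto b).comp hk
    have t5 := t1.rpow t3 (Or.inr (hball hb).2.1)
    exact (((t2'.pow 2).sub (t5.const_mul K)).sub (t1.const_mul Λ)).sub
      (t4.add ((hk.sub_const xs).norm.pow 2))
  have haxs : a = xs := by
    have l1 := hqlim _ a ha hXa
    have l2 := hqlim (fun _ => xs) xs (mem_closedBall_self hρ.le) tendsto_const_nhds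
    have hle := le_of_tendsto_of_tendsto' l2 l1 (fun j => hXm (ψ j) xs (mem_closedBall_self hρ.le))
    have h3 := (hball ha).2.2
    have h4 : ‖a - xs‖ ^ 2 ≤ 0 := by
      simp only [sub_self, norm_zero] at hle
      linarith
    have h5 : ‖a - xs‖ = 0 := by
      have := norm_nonneg (a - xs)
      nlinarith
    exact sub_eq_zero.mp (norm_eq_zero.mp h5)
  subst haxs
  set Y : ℕ → EuclideanSpace ℝ (Fin n) := fun j => X (ψ j) with hY
  have hYa : Filter.Tendsto Y Filter.atTop (nhds a) := hXa
  have tv : Filter.Tendsto (fun j => cv (η (ψ j)) u (Y j)) Filter.atTop (nhds (u a)) :=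
    cv_tendsto hφψ hu.continuous.measurable hu.continuous.continuousAt hYa
  have tdu : ∀ e, Filter.Tendsto (fun j => cv (dv e (η (ψ j))) u (Y j)) Filter.atTop (nhds (dv e u a)) := by
    intro e
    refine (cv_tendsto hφψ (hmdu e) (hduc e a hxs) hYa).congr fun j => ?_
    exact (cv_parts_lip (hη1 _) (hηc _) hu _ _).symm
  have tf : Filter.Tendsto (fun j => cv (η (ψ j)) f (Y j)) Filter.atTop (nhds (f a)) :=
    cv_tendsto hφψ hfm (hfC.continuousOn.continuousAt (hΩ.mem_nhds hxs)) hYa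
  have tdf : Filter.Tendsto (fun j => cv (η (ψ j)) (dv e f) (Y j)) Filter.atTop (nhds (dv e f a)) :=
    cv_tendsto hφψ (measurable_fderiv_apply_const ℝ f e)
      ((dv_continuousOn hΩ hfC e).continuousAt (hΩ.mem_nhds hxs)) hYa
  have tcont : ∀ {g : EuclideanSpace ℝ (Fin n) → ℝ}, Continuous g →
      Filter.Tendsto (fun j => g (Y j)) Filter.atTop (nhds (g a)) := fun hg => (hg.tendsto a).comp hYa
  have hdpc : ∀ i, ContDiff ℝ 1 (dd i p) := fun i => dv_contDiff hp (by norm_num)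
  have hdrc : ∀ i, ContDiff ℝ 1 (dd i r) := fun i => dv_contDiff hr (by norm_num)
  have hddpc : ∀ i, Continuous (dd i (dd i p)) := fun i => (dv_contDiff (k := 0) (hdpc i) (by norm_num)).continuous
  have hddrc : ∀ i, Continuous (dd i (dd i r)) := fun i => (dv_contDiff (k := 0) (hdrc i) (by norm_num)).continuous
  have tp := tcont hpc
  have tdp := fun i => tcont (hdpc i).continuous
  have tddp := fun i => tcont (hddpc i)
  have tdr := fun i => tcont (hdrc i).continuous
  have tddr := fun i => tcont (hddrc i)
  have tlog := tv.log hupos.ne'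
  have tp0 := tv.rpow tp (Or.inl hupos.ne')
  have tp1 := tv.rpow (tp.sub_const 1) (Or.inl hupos.ne')
  have tp2 := tv.rpow (tp.sub_const 2) (Or.inl hupos.ne')
  have tnorm : ∀ i : Fin n, Filter.Tendsto (fun j => 2 * inner ℝ (Y j - a) (EuclideanSpace.single i (1:ℝ)))
      Filter.atTop (nhds 0) := by
    intro i
    have : Continuous (fun y : EuclideanSpace ℝ (Fin n) => 2 * inner ℝ (y - a) (EuclideanSpace.single i (1:ℝ))) := by
      fun_prop
    simpa using tcont this
  have hev : ∀ᶠ j in Filter.atTop,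
    (∑ i, (K * (cv (dv (EuclideanSpace.single i 1) (η (ψ j))) u (Y j) * p (Y j) * cv (η (ψ j)) u (Y j) ^ (p (Y j) - 1)
        + dd i p (Y j) * cv (η (ψ j)) u (Y j) ^ p (Y j) * log (cv (η (ψ j)) u (Y j)))
        + Λ * cv (dv (EuclideanSpace.single i 1) (η (ψ j))) u (Y j) +
          (dd i r (Y j) + 2 * inner ℝ (Y j - a) (EuclideanSpace.single i (1:ℝ)))) ^ 2)
      + 4 * cv (dv e (η (ψ j))) u (Y j) ^ 3 * cv (η (ψ j)) (dv e f) (Y j) ≤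
    2 * cv (dv e (η (ψ j))) u (Y j) ^ 2 * ((K * (p (Y j) * cv (η (ψ j)) u (Y j) ^ (p (Y j) - 1)) + Λ)
      * cv (η (ψ j)) f (Y j) +
      ∑ i, (K * (2 * cv (dv (EuclideanSpace.single i 1) (η (ψ j))) u (Y j) * dd i p (Y j) * cv (η (ψ j)) u (Y j) ^ (p (Y j) - 1)
      + 2 * cv (dv (EuclideanSpace.single i 1) (η (ψ j))) u (Y j) * p (Y j) * dd i p (Y j) * cv (η (ψ j)) u (Y j) ^ (p (Y j) - 1) * log (cv (η (ψ j)) u (Y j))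
      + p (Y j) * (p (Y j) - 1) * cv (dv (EuclideanSpace.single i 1) (η (ψ j))) u (Y j) ^ 2 * cv (η (ψ j)) u (Y j) ^ (p (Y j) - 2)
      + dd i (dd i p) (Y j) * cv (η (ψ j)) u (Y j) ^ p (Y j) * log (cv (η (ψ j)) u (Y j))
      + dd i p (Y j) ^ 2 * cv (η (ψ j)) u (Y j) ^ p (Y j) * log (cv (η (ψ j)) u (Y j)) ^ 2)
      + (dd i (dd i r) (Y j) + 2))) := by
    have hdist : Filter.Tendsto (fun j => (φ (ψ j)).rOut + dist (Y j) a) Filter.atTop (nhds 0) := by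
      have := hφψ.add (tendsto_iff_dist_tendsto_zero.mp hYa)
      simpa using this
    filter_upwards [hdist.eventually (gt_mem_nhds hρ), tv.eventually (lt_mem_nhds hupos)] with j hj1 hj2
    have hrout : 0 < (φ (ψ j)).rOut := (φ (ψ j)).rOut_pos
    have hYball : Y j ∈ ball a ρ := by
      rw [mem_ball]; linarith
    have hsup : ∀ t, Y j - t ∈ tsupport (η (ψ j)) → t ∈ Ω := by
      intro t ht
      have h1 : tsupport (η (ψ j)) = closedBall 0 (φ (ψ j)).rOut := (φ (ψ j)).tsupport_normed_eq
      rw [h1, mem_closedBall, dist_zero_right] at ht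
      refine (hball ?_).1
      rw [mem_closedBall]
      have h2 : dist t a ≤ dist t (Y j) + dist (Y j) a := dist_triangle _ _ _
      rw [dist_comm t (Y j), dist_eq_norm (Y j) t] at h2
      linarith
    have hlap : ∑ i, cv (dv (EuclideanSpace.single i 1) (dv (EuclideanSpace.single i 1) (η (ψ j)))) u (Y j) =
        cv (η (ψ j)) f (Y j) := cv_weak (hη2 _) (hηc _) hu hw _ hsup
    have hlapw : ∑ i, cv (dv (EuclideanSpace.single i 1) (dv (EuclideanSpace.single i 1) (dv e (η (ψ j))))) u (Y j) =
        cv (η (ψ j)) (dv e f) (Y j) := by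
      rw [cv_weak ((hd3 _ _).of_le (by norm_num)) (dv_compact (hηc _)) hu hw _
        (fun t ht => hsup t (dv_tsupport ht))]
      exact cv_parts_C1 hΩ (hη1 _) (hηc _) hfC _ _ hsup
    have hone : ∀ i, (K * (cv (dv (EuclideanSpace.single i 1) (η (ψ j))) u (Y j) * p (Y j) * cv (η (ψ j)) u (Y j) ^ (p (Y j) - 1)
        + dd i p (Y j) * cv (η (ψ j)) u (Y j) ^ p (Y j) * log (cv (η (ψ j)) u (Y j)))
        + Λ * cv (dv (EuclideanSpace.single i 1) (η (ψ j))) u (Y j) +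
          (dd i r (Y j) + 2 * inner ℝ (Y j - a) (EuclideanSpace.single i (1:ℝ)))) ^ 2
      + 4 * cv (dv e (η (ψ j))) u (Y j) ^ 3 *
        cv (dv (EuclideanSpace.single i 1) (dv (EuclideanSpace.single i 1) (dv e (η (ψ j))))) u (Y j) ≤
      2 * cv (dv e (η (ψ j))) u (Y j) ^ 2 * ((K * (p (Y j) * cv (η (ψ j)) u (Y j) ^ (p (Y j) - 1)) + Λ)
      * cv (dv (EuclideanSpace.single i 1) (dv (EuclideanSpace.single i 1) (η (ψ j)))) u (Y j) +
      (K * (2 * cv (dv (EuclideanSpace.single i 1) (η (ψ j))) u (Y j) * dd i p (Y j) * cv (η (ψ j)) u (Y j) ^ (p (Y j) - 1)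
      + 2 * cv (dv (EuclideanSpace.single i 1) (η (ψ j))) u (Y j) * p (Y j) * dd i p (Y j) * cv (η (ψ j)) u (Y j) ^ (p (Y j) - 1) * log (cv (η (ψ j)) u (Y j))
      + p (Y j) * (p (Y j) - 1) * cv (dv (EuclideanSpace.single i 1) (η (ψ j))) u (Y j) ^ 2 * cv (η (ψ j)) u (Y j) ^ (p (Y j) - 2)
      + dd i (dd i p) (Y j) * cv (η (ψ j)) u (Y j) ^ p (Y j) * log (cv (η (ψ j)) u (Y j))
      + dd i p (Y j) ^ 2 * cv (η (ψ j)) u (Y j) ^ p (Y j) * log (cv (η (ψ j)) u (Y j)) ^ 2)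
      + (dd i (dd i r) (Y j) + 2))) := by
      intro i
      set ei : EuclideanSpace ℝ (Fin n) := EuclideanSpace.single i (1:ℝ) with hei
      have hnorm : ∀ t : ℝ, ‖Y j + t • ei - a‖ ^ 2 = ‖Y j - a‖ ^ 2 + t * (2 * inner ℝ (Y j - a) ei) + t ^ 2 := by
        intro t
        have h1 : Y j + t • ei - a = (Y j - a) + t • ei := by abel
        rw [h1, norm_add_sq_real, inner_smul_right, norm_smul, mul_pow]
        have h2 : ‖ei‖ = 1 := by simp [hei]
        rw [h2]; simp; ring
      have hd0 : ∀ t : ℝ, HasDerivAt (fun t : ℝ => ‖Y j - a‖ ^ 2 + t * (2 * inner ℝ (Y j - a) ei) + t ^ 2)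
          (2 * inner ℝ (Y j - a) ei + 2 * t) t := by
        intro t
        have := (((hasDerivAt_id t).mul_const (2 * inner ℝ (Y j - a) ei)).const_add (‖Y j - a‖ ^ 2)).add
          ((hasDerivAt_id t).pow 2)
        refine this.congr_deriv ?_
        simp
      have hd00 : HasDerivAt (fun t : ℝ => 2 * inner ℝ (Y j - a) ei + 2 * t) 2 0 := by
        have := ((hasDerivAt_id (0:ℝ)).const_mul 2).const_add (2 * inner ℝ (Y j - a) ei)
        simpa using this
      have hr1 : ContDiff ℝ 1 r := hr.of_le (by norm_num)
      have hp1 : ContDiff ℝ 1 p := hp.of_le (by norm_num)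
      have hmain := line_ineq (K := K) (Λ := Λ)
        (w := fun t : ℝ => cv (dv e (η (ψ j))) u (Y j + t • ei))
        (v := fun t : ℝ => cv (η (ψ j)) u (Y j + t • ei))
        (p := fun t : ℝ => p (Y j + t • ei))
        (r := fun t : ℝ => r (Y j + t • ei) + (‖Y j - a‖ ^ 2 + t * (2 * inner ℝ (Y j - a) ei) + t ^ 2))
        (fun t => cv_line (hd1 _ _) (dv_compact (hηc _)) hul (Y j) ei t)
        (cv_line (hdd1 _ _ _) (dv_compact (dv_compact (hηc _))) hul (Y j) ei 0)
        (fun t => cv_line (hη1 _) (hηc _) hul (Y j) ei t)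
        (cv_line (hd1 _ _) (dv_compact (hηc _)) hul (Y j) ei 0)
        (fun t => smooth_line hp1 (Y j) ei t)
        (smooth_line (hdpc i) (Y j) ei 0)
        (fun t => (smooth_line hr1 (Y j) ei t).add (hd0 t))
        ((smooth_line (hdrc i) (Y j) ei 0).add hd00)
        (by simpa using hj2)
        (by
          have hcont : Filter.Tendsto (fun t : ℝ => Y j + t • ei) (nhds 0) (nhds (Y j)) := by
            have : Continuous (fun t : ℝ => Y j + t • ei) := by fun_prop
            simpa using this.tendsto 0
          have hnb := hcont.eventually (isOpen_ball.mem_nhds hYball)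
          filter_upwards [hnb] with t ht
          have := hXm (ψ j) _ (ball_subset_closedBall ht)
          simp only [q] at this
          rw [hnorm] at this
          simpa using this)
      simp only [Pi.add_apply, zero_smul, add_zero, mul_zero] at hmain
      change _ ≤ 2 * _ * (K * (_ + (2 * _ * dd i p (Y j) * _ + 2 * _ * _ * dd i p (Y j) * _ * _ + _
        + dd i (dd i p) (Y j) * _ * _ + dd i p (Y j) ^ 2 * _ * _)) + _ + (dd i (dd i r) (Y j) + 2)) at hmain
      refine hmain.trans (le_of_eq ?_)
      ring
    have hsum := Finset.sum_le_sum (fun i (_ : i ∈ Finset.univ) => hone i)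
    rw [Finset.sum_add_distrib, ← Finset.mul_sum, ← Finset.mul_sum, Finset.sum_add_distrib,
      ← Finset.mul_sum, hlap, hlapw] at hsum
    exact hsum
  refine le_of_tendsto_of_tendsto ?_ ?_ hev
  · refine Filter.Tendsto.add (tendsto_finsetSum _ fun i _ => ?_) ((((tdu e).pow 3).const_mul 4).mul tdf)
    have := (((((((tdu (EuclideanSpace.single i 1)).mul tp).mul tp1).add (((tdp i).mul tp0).mul tlog)).const_mul K).add
      ((tdu (EuclideanSpace.single i 1)).const_mul Λ)).add ((tdr i).add (tnorm i))).pow 2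
    rw [add_zero] at this
    exact this
  · refine (((tdu e).pow 2).const_mul 2).mul (Filter.Tendsto.add
      ((((tp.mul tp1).const_mul K).add_const Λ).mul tf) (tendsto_finsetSum _ fun i _ => ?_))
    have td := tdu (EuclideanSpace.single i 1)
    exact ((((((((td.const_mul 2).mul (tdp i)).mul tp1).add (((((td.const_mul 2).mul tp).mul (tdp i)).mul tp1).mul tlog)).add
      (((tp.mul (tp.sub_const 1)).mul (td.pow 2)).mul tp2)).add (((tddp i).mul tp0).mul tlog)).add
      ((((tdp i).pow 2).mul tp0).mul (tlog.pow 2))).const_mul K).add ((tddr i).add_const 2)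



lemma rpow_half_log {u p p0 : ℝ} (hu : 0 < u) (hp0 : 0 < p0) (hp : p0 ≤ p) :
    u ^ (p / 2) * (- log u) ≤ 2 / p0 := by
  have hp' : 0 < p := hp0.trans_le hp
  have hs : 0 < u ^ (p / 2) := rpow_pos_of_pos hu _
  have h1 : log (u ^ (p / 2)) = p / 2 * log u := log_rpow hu _
  have h2 : - log (u ^ (p / 2)) ≤ (u ^ (p / 2))⁻¹ - 1 := by
    rw [← log_inv]; exact log_le_sub_one_of_pos (inv_pos.mpr hs)
  have h3 : u ^ (p / 2) * (- log (u ^ (p/2))) ≤ 1 := by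
    have := mul_le_mul_of_nonneg_left h2 hs.le
    rw [mul_sub, mul_inv_cancel₀ hs.ne'] at this
    linarith
  rw [h1] at h3
  have h4 : 2 / p ≤ 2 / p0 := by gcongr
  have h5 : u ^ (p / 2) * (- log u) ≤ 2 / p := by
    rw [le_div_iff₀ hp']; nlinarith
  exact h5.trans h4

set_option maxHeartbeats 800000 in
lemma alg_contra {K P P2 R2 C1 C2 p0 η c5 : ℝ} (hK : 0 ≤ K) (hP : 0 ≤ P) (hP2 : 0 ≤ P2)
    (hR2 : 0 ≤ R2) (hC1 : 0 ≤ C1) (hC2 : 0 ≤ C2) (hp0 : 0 < p0) (hη : 0 < η) (hc5 : 0 < c5) :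
    ∃ Λ > 0, ∀ w u p γ δ S G T : ℝ, 0 < w → 0 < u → u ≤ 1 → p0 ≤ p → p ≤ γ → γ ≤ 1 → 0 ≤ γ * δ →
      (2 + η) * (γ * δ) ≤ K * p → c5 ≤ 2 * (K * p) * (1 - p) - 4 * (γ * δ) * (1 - γ) →
      (K * (p * u ^ (p - 1)) + Λ) ^ 2 * w ^ 2 - 2 * (K * (p * u ^ (p - 1)) + Λ) * w * (C1 * w) ≤ S →
      - (γ * δ * (1 - γ) * u ^ (γ - 2) * w + C2 * u ^ (γ - 1) * (1 - log u)) ≤ G →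
      T ≤ K * (2 * w * P * u ^ (p - 1) + 2 * w * P * u ^ (p - 1) * (- log u)
        + p * (p - 1) * w ^ 2 * u ^ (p - 2) + P2 * u ^ p * (- log u) + P ^ 2 * u ^ p * (log u) ^ 2) + R2 →
      S + 4 * w ^ 3 * G ≤ 2 * w ^ 2 * ((K * (p * u ^ (p - 1)) + Λ) * (γ * δ * u ^ (γ - 1)) + T) → False := by
  set θ := η / (2 + η) with hθ
  have hθ0 : 0 < θ := by positivity
  have hθ1 : θ ≤ 1 := by rw [hθ, div_le_one (by positivity)]; linarith
  set H := 1 + 2 / p0 with hH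
  have hH1 : 1 ≤ H := by rw [hH]; have : 0 < 2 / p0 := by positivity
                         linarith
  set C6 := 4 * C2 + 4 * K * P with hC6
  have hC60 : 0 ≤ C6 := by positivity
  set C10 := C6 ^ 2 / (4 * c5) * H ^ 2 + 2 * K * (P2 * H + P ^ 2 * H ^ 2) + 2 * R2 with hC10
  have hC100 : 0 ≤ C10 := by positivity
  refine ⟨(2 * C1 + C10 + 1) / θ, by positivity, ?_⟩
  set Λ := (2 * C1 + C10 + 1) / θ with hΛ
  have hΛθ : θ * Λ = 2 * C1 + C10 + 1 := by rw [hΛ]; field_simp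
  have hΛ0 : 0 < Λ := by positivity
  have hΛ1 : 1 ≤ Λ := by
    have := mul_le_mul_of_nonneg_right hθ1 hΛ0.le
    linarith
  intro w u p γ δ S G T hw hu hu1 hp hpγ hγ1 hγδ hKp hc hS hG hT hmain
  have hp' : 0 < p := hp0.trans_le hp
  set h := u ^ (p / 2) with hh
  have hh0 : 0 < h := rpow_pos_of_pos hu _
  have hh1 : h ≤ 1 := rpow_le_one hu.le hu1 (by positivity)
  have e0 : u ^ p = h ^ 2 := by
    rw [hh, ← rpow_natCast, ← rpow_mul hu.le]; congr 1; push_cast; ring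
  have e1 : u ^ (p - 1) = h ^ 2 / u := by rw [rpow_sub_one hu.ne', e0]
  have e2 : u ^ (p - 2) = h ^ 2 / u ^ 2 := by
    rw [rpow_sub hu, e0, rpow_two]
  have g1 : u ^ (γ - 1) ≤ h ^ 2 / u := by
    rw [← e1]; exact rpow_le_rpow_of_exponent_ge hu hu1 (by linarith)
  have g2 : u ^ (γ - 2) ≤ h ^ 2 / u ^ 2 := by
    rw [← e2]; exact rpow_le_rpow_of_exponent_ge hu hu1 (by linarith)
  set l := - log u with hl
  have hl0 : 0 ≤ l := by have := log_nonpos hu.le hu1; linarith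
  have hlh : h * l ≤ 2 / p0 := rpow_half_log hu hp0 hp
  have hHl : h * (1 + l) ≤ H := by
    have : h * (1 + l) = h + h * l := by ring
    rw [hH, this]; linarith
  have hl2 : log u ^ 2 = l ^ 2 := by rw [hl]; ring
  have hl1 : 1 - log u = 1 + l := by rw [hl]; ring
  rw [hl2, e0, e1, e2] at hT
  rw [hl1] at hG
  rw [e1] at hS hmain
  set A := K * (p * (h ^ 2 / u)) + Λ with hA
  have hau : 0 ≤ K * (p * (h ^ 2 / u)) := by positivity
  have hAΛ : Λ ≤ A := by linarith
  set y := w * h / u with hy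
  have hy0 : 0 < y := by positivity
  -- bound of f
  have hf : (2 + η) * (γ * δ * u ^ (γ - 1)) ≤ A := by
    have : (2 + η) * (γ * δ * u ^ (γ - 1)) ≤ (2 + η) * (γ * δ * (h ^ 2 / u)) := by gcongr
    have h2 : (2 + η) * (γ * δ * (h ^ 2 / u)) ≤ K * p * (h ^ 2 / u) := by
      have := mul_le_mul_of_nonneg_right hKp (by positivity : 0 ≤ h ^ 2 / u)
      linarith
    have h3 : K * p * (h ^ 2 / u) = K * (p * (h ^ 2 / u)) := by ring
    linarith
  have hf2 : 2 * (γ * δ * u ^ (γ - 1)) ≤ (1 - θ) * A := by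
    have : (1 - θ) = 2 / (2 + η) := by rw [hθ]; field_simp; ring
    rw [this, div_mul_eq_mul_div, le_div_iff₀ (by positivity)]
    linarith
  -- bound of G
  have hGw : - (γ * δ * (1 - γ) * y ^ 2 + C2 * y * H) ≤ w * G := by
    have i1 : γ * δ * (1 - γ) * u ^ (γ - 2) * w ≤ γ * δ * (1 - γ) * (h ^ 2 / u ^ 2) * w := by
      have : 0 ≤ 1 - γ := by linarith
      gcongr
    have i2 : C2 * u ^ (γ - 1) * (1 + l) ≤ C2 * (h ^ 2 / u) * (1 + l) := by gcongr
    have i3 : -(γ * δ * (1 - γ) * (h ^ 2 / u ^ 2) * w + C2 * (h ^ 2 / u) * (1 + l)) ≤ G := by linarith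
    have i4 := mul_le_mul_of_nonneg_left i3 hw.le
    have i5 : w * -(γ * δ * (1 - γ) * (h ^ 2 / u ^ 2) * w + C2 * (h ^ 2 / u) * (1 + l))
      = -(γ * δ * (1 - γ) * y ^ 2 + C2 * y * (h * (1 + l))) := by rw [hy]; field_simp
    have i6 : C2 * y * (h * (1 + l)) ≤ C2 * y * H := by gcongr
    linarith
  -- bound of T
  have hTw : T ≤ 2 * K * P * y * H - K * p * (1 - p) * y ^ 2 + K * (P2 * H + P ^ 2 * H ^ 2) + R2 := by
    have i1 : K * (2 * w * P * (h ^ 2 / u) + 2 * w * P * (h ^ 2 / u) * l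
        + p * (p - 1) * w ^ 2 * (h ^ 2 / u ^ 2) + P2 * h ^ 2 * l + P ^ 2 * h ^ 2 * l ^ 2) + R2
      = 2 * K * P * y * (h * (1 + l)) - K * p * (1 - p) * y ^ 2 + K * (P2 * (h * (h * l)) + P ^ 2 * (h * l) ^ 2) + R2 := by
      rw [hy]; field_simp; ring
    have i2 : 2 * K * P * y * (h * (1 + l)) ≤ 2 * K * P * y * H := by gcongr
    have hlH : h * l ≤ H := by rw [hH]; linarith
    have hl00 : 0 ≤ h * l := by positivity
    have i3 : h * (h * l) ≤ H := (mul_le_of_le_one_left hl00 hh1).trans hlH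
    have i4 : K * (P2 * (h * (h * l)) + P ^ 2 * (h * l) ^ 2) ≤ K * (P2 * H + P ^ 2 * H ^ 2) := by gcongr
    linarith
  -- combine
  have k1 : A ^ 2 * w ^ 2 - 2 * A * w * (C1 * w) + 4 * w ^ 2 * (- (γ * δ * (1 - γ) * y ^ 2 + C2 * y * H))
      ≤ 2 * w ^ 2 * (A * (γ * δ * u ^ (γ - 1)) + T) := by
    have : 4 * w ^ 2 * (- (γ * δ * (1 - γ) * y ^ 2 + C2 * y * H)) ≤ 4 * w ^ 2 * (w * G) := by gcongr
    have e : 4 * w ^ 2 * (w * G) = 4 * w ^ 3 * G := by ring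
    linarith
  have k2 : w ^ 2 * (A ^ 2 - 2 * A * C1 - 4 * (γ * δ * (1 - γ) * y ^ 2 + C2 * y * H))
      ≤ w ^ 2 * (2 * (A * (γ * δ * u ^ (γ - 1)) + T)) := by linarith
  have k3 := le_of_mul_le_mul_left k2 (by positivity)
  have k4 : 2 * (A * (γ * δ * u ^ (γ - 1))) ≤ (1 - θ) * A ^ 2 := by
    have := mul_le_mul_of_nonneg_left hf2 (by linarith : 0 ≤ A)
    linarith
  have k5 : c5 * y ^ 2 ≤ (2 * (K * p) * (1 - p) - 4 * (γ * δ) * (1 - γ)) * y ^ 2 := by gcongr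
  have k6 : C6 * y * H ≤ c5 * y ^ 2 + C6 ^ 2 / (4 * c5) * H ^ 2 := by
    have : c5 * y ^ 2 + C6 ^ 2 / (4 * c5) * H ^ 2 - C6 * y * H = c5 * (y - C6 * H / (2 * c5)) ^ 2 := by
      field_simp; ring
    have h2 : 0 ≤ c5 * (y - C6 * H / (2 * c5)) ^ 2 := by positivity
    linarith
  have k7 : θ * A ^ 2 - 2 * A * C1 ≤ C10 := by
    rw [hC10]
    have : C6 * y * H = 4 * C2 * y * H + 4 * K * P * y * H := by rw [hC6]; ring
    linarith
  have k8 : θ * Λ ≤ θ * A := by gcongr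
  have k9 : 1 ≤ A := by linarith
  have k10 : C10 + 1 ≤ θ * A - 2 * C1 := by linarith
  have k11 : 1 * (C10 + 1) ≤ A * (θ * A - 2 * C1) := mul_le_mul k9 k10 (by positivity) (by linarith)
  have k12 : A * (θ * A - 2 * C1) = θ * A ^ 2 - 2 * A * C1 := by ring
  linarith



lemma dv_inner {n : ℕ} (g : EuclideanSpace ℝ (Fin n) → ℝ) (x e : EuclideanSpace ℝ (Fin n)) :
    dv e g x = inner ℝ (gradient g x) e :=
  (inner_gradient_left (𝕜 := ℝ) (f := g) (x := x) (y := e)).symm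

lemma norm_gradient {n : ℕ} (g : EuclideanSpace ℝ (Fin n) → ℝ) (x : EuclideanSpace ℝ (Fin n)) :
    ‖gradient g x‖ = ‖fderiv ℝ g x‖ := by simp [gradient]

lemma sum_dd_mul {n : ℕ} (g h : EuclideanSpace ℝ (Fin n) → ℝ) (x : EuclideanSpace ℝ (Fin n)) :
    ∑ i, dd i g x * dd i h x = inner ℝ (gradient g x) (gradient h x) := by
  rw [PiLp.inner_apply]
  refine Finset.sum_congr rfl fun i _ => ?_
  rw [gradient_coord, gradient_coord]
  simp [mul_comm]

/-- quadratic polynomial around `x0` -/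
def quad {n : ℕ} (c : ℝ) (D : EuclideanSpace ℝ (Fin n) →L[ℝ] ℝ) (L : ℝ)
    (x0 x : EuclideanSpace ℝ (Fin n)) : ℝ := c + D (x - x0) + L * ‖x - x0‖ ^ 2

lemma quad_contDiff {n : ℕ} (c : ℝ) (D : EuclideanSpace ℝ (Fin n) →L[ℝ] ℝ) (L : ℝ)
    (x0 : EuclideanSpace ℝ (Fin n)) : ContDiff ℝ 2 (quad c D L x0) := by
  unfold quad
  refine (contDiff_const.add (D.contDiff.comp (contDiff_id.sub contDiff_const))).add
    (contDiff_const.mul ((contDiff_id.sub contDiff_const).norm_sq ℝ))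

lemma quad_fderiv {n : ℕ} (c : ℝ) (D : EuclideanSpace ℝ (Fin n) →L[ℝ] ℝ) (L : ℝ)
    (x0 x : EuclideanSpace ℝ (Fin n)) :
    HasFDerivAt (quad c D L x0) (D + (2 * L) • innerSL ℝ (x - x0)) x := by
  have h1 : HasFDerivAt (fun x => x - x0) (ContinuousLinearMap.id ℝ (EuclideanSpace ℝ (Fin n))) x :=
    (hasFDerivAt_id x).sub_const x0
  have h2 := ((D.hasFDerivAt (x := x - x0)).comp x h1).const_add c
  have h3 := (h1.norm_sq).const_mul L
  refine (h2.add h3).congr_fderiv ?_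
  ext v
  simp
  ring

lemma quad_dv {n : ℕ} (c : ℝ) (D : EuclideanSpace ℝ (Fin n) →L[ℝ] ℝ) (L : ℝ)
    (x0 x e : EuclideanSpace ℝ (Fin n)) : dv e (quad c D L x0) x = D e + 2 * L * inner ℝ (x - x0) e := by
  unfold dv
  rw [(quad_fderiv c D L x0 x).fderiv]
  simp only [ContinuousLinearMap.add_apply, ContinuousLinearMap.smul_apply, innerSL_apply_apply, smul_eq_mul]

lemma quad_dd2 {n : ℕ} (c : ℝ) (D : EuclideanSpace ℝ (Fin n) →L[ℝ] ℝ) (L : ℝ)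
    (x0 x : EuclideanSpace ℝ (Fin n)) (i : Fin n) : dd i (dd i (quad c D L x0)) x = 2 * L := by
  have h : dd i (quad c D L x0) = quad (D (EuclideanSpace.single i 1))
      ((2 * L) • innerSL ℝ (EuclideanSpace.single i (1:ℝ))) 0 x0 := by
    ext y
    have := quad_dv c D L x0 y (EuclideanSpace.single i 1)
    change dv _ _ _ = _
    rw [this, quad, real_inner_comm]
    simp
  rw [h]
  change dv _ _ _ = _
  rw [quad_dv]
  simp

lemma quad_gradient_norm {n : ℕ} (c : ℝ) (D : EuclideanSpace ℝ (Fin n) →L[ℝ] ℝ) (L : ℝ)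
    (x0 x : EuclideanSpace ℝ (Fin n)) :
    ‖gradient (quad c D L x0) x‖ ≤ ‖D‖ + 2 * |L| * ‖x - x0‖ := by
  rw [norm_gradient, (quad_fderiv c D L x0 x).fderiv]
  refine (norm_add_le _ _).trans ?_
  rw [norm_smul, innerSL_apply_norm]
  simp

lemma quad_minorant {n : ℕ} {γ : EuclideanSpace ℝ (Fin n) → ℝ}
    (hγC1 : ContDiffOn ℝ 1 γ (ball (0 : EuclideanSpace ℝ (Fin n)) 1)) {L : NNReal}
    (hL : LipschitzOnWith L (fun x => gradient γ x) (ball (0 : EuclideanSpace ℝ (Fin n)) 1))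
    {x0 x : EuclideanSpace ℝ (Fin n)} (hx0 : x0 ∈ ball (0 : EuclideanSpace ℝ (Fin n)) 1)
    (hx : x ∈ ball (0 : EuclideanSpace ℝ (Fin n)) 1) :
    quad (γ x0) (fderiv ℝ γ x0) (-L) x0 x ≤ γ x := by
  have hseg : segment ℝ x0 x ⊆ ball (0 : EuclideanSpace ℝ (Fin n)) 1 :=
    (convex_ball _ _).segment_subset hx0 hx
  have h1 := (convex_segment x0 x).norm_image_sub_le_of_norm_hasFDerivWithin_le' (𝕜 := ℝ) (f := γ)
    (f' := fderiv ℝ γ) (C := L * ‖x - x0‖) (φ := fderiv ℝ γ x0)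
    (fun y hy => ((hγC1.differentiableOn one_ne_zero).differentiableAt
      (isOpen_ball.mem_nhds (hseg hy))).hasFDerivAt.hasFDerivWithinAt)
    (by
      intro y hy
      have h2 := hL.dist_le_mul y (hseg hy) x0 hx0
      rw [dist_eq_norm, dist_eq_norm] at h2
      have h3 : ‖gradient γ y - gradient γ x0‖ = ‖fderiv ℝ γ y - fderiv ℝ γ x0‖ := by
        unfold gradient
        rw [← map_sub, LinearIsometryEquiv.norm_map]
      rw [← h3]
      refine h2.trans ?_
      have h4 : ‖y - x0‖ ≤ ‖x - x0‖ := by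
        rw [segment_eq_image'] at hy
        obtain ⟨t, ht, rfl⟩ := hy
        simp only [add_sub_cancel_left, norm_smul, Real.norm_eq_abs, abs_of_nonneg ht.1]
        exact mul_le_of_le_one_left (norm_nonneg _) ht.2
      gcongr)
    (left_mem_segment ℝ x0 x) (right_mem_segment ℝ x0 x)
  rw [Real.norm_eq_abs, abs_le] at h1
  unfold quad
  nlinarith [h1.1]

lemma gradient_bounded {n : ℕ} {γ : EuclideanSpace ℝ (Fin n) → ℝ} {L : NNReal}
    (hL : LipschitzOnWith L (fun x => gradient γ x) (ball (0 : EuclideanSpace ℝ (Fin n)) 1))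
    {x : EuclideanSpace ℝ (Fin n)}
    (hx : x ∈ ball (0 : EuclideanSpace ℝ (Fin n)) 1) :
    ‖fderiv ℝ γ x‖ ≤ ‖fderiv ℝ γ 0‖ + L := by
  have h2 := hL.dist_le_mul x hx 0 (by simp)
  rw [dist_eq_norm] at h2
  rw [mem_ball] at hx
  rw [← norm_gradient, ← norm_gradient]
  have h3 : ‖gradient γ x‖ ≤ ‖gradient γ 0‖ + ‖gradient γ x - gradient γ 0‖ := by
    have := norm_add_le (gradient γ 0) (gradient γ x - gradient γ 0)
    simpa using this
  have : (L:ℝ) * dist x 0 ≤ L * 1 := by gcongr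
  linarith

/-- lower bound for the derivative of the right hand side -/
lemma f_deriv_lower {n : ℕ} {δ γ u : EuclideanSpace ℝ (Fin n) → ℝ} {x e : EuclideanSpace ℝ (Fin n)}
    (hδ : DifferentiableAt ℝ δ x) (hγ : DifferentiableAt ℝ γ x) (hu : DifferentiableAt ℝ u x)
    (hupos : 0 < u x) (hu1 : u x ≤ 1) {G D Δ : ℝ} (hG : ‖fderiv ℝ γ x‖ ≤ G) (hD : ‖fderiv ℝ δ x‖ ≤ D)
    (hγ0 : 0 ≤ γ x) (hγ1 : γ x ≤ 1) (hδ0 : 0 ≤ δ x) (hΔ : δ x ≤ Δ) (he : ‖e‖ = 1) :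
    - (γ x * δ x * (1 - γ x) * u x ^ (γ x - 2) * dv e u x +
      (2 * G * Δ + D) * u x ^ (γ x - 1) * (1 - log (u x))) ≤
    dv e (fun x => γ x * δ x * u x ^ (γ x - 1)) x := by
  have hd := (hγ.hasFDerivAt.mul hδ.hasFDerivAt).mul
    (hu.hasFDerivAt.rpow (hγ.hasFDerivAt.sub_const 1) hupos)
  have hdv : dv e (fun x => γ x * δ x * u x ^ (γ x - 1)) x =
      (γ x * dv e δ x + δ x * dv e γ x) * u x ^ (γ x - 1) + γ x * δ x *
        ((γ x - 1) * u x ^ (γ x - 2) * dv e u x + u x ^ (γ x - 1) * log (u x) * dv e γ x) := by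
    have h : fderiv ℝ (fun x => γ x * δ x * u x ^ (γ x - 1)) x = _ := hd.fderiv
    unfold dv
    rw [h]
    have e2 : γ x - 1 - 1 = γ x - 2 := by ring
    simp [e2]
    ring
  have a1 : |dv e γ x| ≤ G := by
    have := (fderiv ℝ γ x).le_opNorm e
    rw [he, mul_one] at this
    exact this.trans hG
  have a2 : |dv e δ x| ≤ D := by
    have := (fderiv ℝ δ x).le_opNorm e
    rw [he, mul_one] at this
    exact this.trans hD
  have hl := log_nonpos hupos.le hu1
  have hup : 0 < u x ^ (γ x - 1) := rpow_pos_of_pos hupos _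
  rw [hdv]
  have hG0 : 0 ≤ G := (abs_nonneg _).trans a1
  have hD0 : 0 ≤ D := (abs_nonneg _).trans a2
  have hΔ0 : 0 ≤ Δ := hδ0.trans hΔ
  have b1 : |γ x * dv e δ x| ≤ D := by
    rw [abs_mul, abs_of_nonneg hγ0]
    exact (mul_le_of_le_one_left (abs_nonneg _) hγ1).trans a2
  have b2 : |δ x * dv e γ x| ≤ G * Δ := by
    rw [abs_mul, abs_of_nonneg hδ0, mul_comm]; gcongr
  have b3 : |γ x * δ x * dv e γ x| ≤ G * Δ := by
    rw [mul_assoc, abs_mul, abs_of_nonneg hγ0]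
    exact (mul_le_of_le_one_left (abs_nonneg _) hγ1).trans b2
  have c1 : - (D + G * Δ) ≤ γ x * dv e δ x + δ x * dv e γ x := by
    have := (abs_le.mp b1).1
    have := (abs_le.mp b2).1
    linarith
  have c2 : - (G * Δ) * (- log (u x)) ≤ γ x * δ x * dv e γ x * log (u x) := by
    have := (abs_le.mp b3).2
    nlinarith
  have c3 : - ((2 * G * Δ + D) * (1 - log (u x))) ≤
      γ x * dv e δ x + δ x * dv e γ x + γ x * δ x * dv e γ x * log (u x) := by
    have : 0 ≤ G * Δ := by positivity
    nlinarith
  have c4 := mul_le_mul_of_nonneg_left c3 hup.le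
  nlinarith [c4]



lemma sum_sq_coord {n : ℕ} (g : EuclideanSpace ℝ (Fin n) → ℝ) (x b : EuclideanSpace ℝ (Fin n)) (A : ℝ) :
    ∑ i, (A * dd i g x + b i) ^ 2 = ‖A • gradient g x + b‖ ^ 2 := by
  rw [EuclideanSpace.real_norm_sq_eq]
  simp [gradient_coord]

set_option maxHeartbeats 1000000 in
lemma grad_core {n : ℕ} {δ γ u : EuclideanSpace ℝ (Fin n) → ℝ} {C : NNReal} (hu : LipschitzWith C u)
    (hu01 : ∀ x ∈ ball (0 : EuclideanSpace ℝ (Fin n)) 1, 0 ≤ u x ∧ u x ≤ 1)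
    (huC1 : ContDiffOn ℝ 1 u (ball (0 : EuclideanSpace ℝ (Fin n)) 1))
    (hfC : ContDiffOn ℝ 1 (fun x => γ x * δ x * u x ^ (γ x - 1))
      {x ∈ ball (0 : EuclideanSpace ℝ (Fin n)) 1 | 0 < u x})
    (hfm : Measurable (fun x => γ x * δ x * u x ^ (γ x - 1)))
    (hw : WeakEq {x ∈ ball (0 : EuclideanSpace ℝ (Fin n)) 1 | 0 < u x} u
      (fun x => γ x * δ x * u x ^ (γ x - 1)))
    {K P C2 p0 η c5 L R : ℝ} (hK : 0 ≤ K) (hP : 0 ≤ P) (hC2 : 0 ≤ C2) (hp0 : 0 < p0)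
    (hη : 0 < η) (hc5 : 0 < c5) (hL : 0 ≤ L) (hR : 0 < R) :
    ∃ Λ > 0, ∀ x0, closedBall x0 R ⊆ ball (0 : EuclideanSpace ℝ (Fin n)) 1 →
      (∀ x ∈ closedBall x0 R,
        p0 ≤ quad (γ x0) (fderiv ℝ γ x0) (-L) x0 x ∧
        quad (γ x0) (fderiv ℝ γ x0) (-L) x0 x ≤ γ x ∧ γ x ≤ 1 ∧ 0 ≤ γ x * δ x ∧
        (2 + η) * (γ x * δ x) ≤ K * quad (γ x0) (fderiv ℝ γ x0) (-L) x0 x ∧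
        c5 ≤ 2 * (K * quad (γ x0) (fderiv ℝ γ x0) (-L) x0 x) * (1 - quad (γ x0) (fderiv ℝ γ x0) (-L) x0 x)
          - 4 * (γ x * δ x) * (1 - γ x) ∧
        ‖gradient (quad (γ x0) (fderiv ℝ γ x0) (-L) x0) x‖ ≤ P ∧
        (0 < u x → ∀ e, ‖e‖ = 1 →
          - (γ x * δ x * (1 - γ x) * u x ^ (γ x - 2) * dv e u x +
            C2 * u x ^ (γ x - 1) * (1 - log (u x))) ≤
          dv e (fun x => γ x * δ x * u x ^ (γ x - 1)) x)) →
      ‖gradient u x0‖ ^ 2 ≤ K * u x0 ^ γ x0 + Λ * u x0 := by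
  set M : ℝ := (C:ℝ) ^ 2 / R ^ 2 with hM
  have hM0 : 0 ≤ M := by positivity
  have hMR : M * R ^ 2 = (C:ℝ) ^ 2 := by rw [hM]; field_simp
  obtain ⟨Λ, hΛ0, hΛ⟩ := alg_contra (K := K) (P := P) (P2 := 2 * n * L) (R2 := 2 * n * M + 2 * n)
    (C1 := √K * P * (2 / p0) + 2 * √M) (C2 := C2) (p0 := p0) (η := η) (c5 := c5)
    hK hP (by positivity) (by positivity) (by positivity) hC2 hp0 hη hc5
  refine ⟨Λ, hΛ0, ?_⟩
  intro x0 hsub hx0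
  set B := ball (0 : EuclideanSpace ℝ (Fin n)) 1 with hB
  set p := quad (γ x0) (fderiv ℝ γ x0) (-L) x0 with hp
  set r := quad 0 (0 : EuclideanSpace ℝ (Fin n) →L[ℝ] ℝ) M x0 with hr
  have hrx : ∀ x, r x = M * ‖x - x0‖ ^ 2 := by intro x; simp [hr, quad]
  have hpx0 : p x0 = γ x0 := by simp [hp, quad]
  by_contra hcon
  push Not at hcon
  have hpc : Continuous p := (quad_contDiff _ _ _ _).continuous
  have hgc : ContinuousOn (fun x => ‖gradient u x‖ ^ 2) B := by
    simp_rw [norm_gradient]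
    exact ((huC1.continuousOn_fderiv_of_isOpen isOpen_ball le_rfl).norm).pow 2
  set Q : EuclideanSpace ℝ (Fin n) → ℝ := fun x => ‖gradient u x‖ ^ 2 - K * u x ^ p x - Λ * u x - r x with hQ
  have hQc : ContinuousOn Q (closedBall x0 R) := by
    have h1 : ContinuousOn (fun x => u x ^ p x) (closedBall x0 R) :=
      hu.continuous.continuousOn.rpow hpc.continuousOn
        (fun x hx => Or.inr (hp0.trans_le (hx0 x hx).1))
    have h2 : Continuous r := (quad_contDiff _ _ _ _).continuous
    exact (((hgc.mono hsub).sub (h1.const_mul K)).sub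
      (hu.continuous.continuousOn.const_mul Λ)).sub h2.continuousOn
  obtain ⟨xs, hxs, hmaxs⟩ := (isCompact_closedBall x0 R).exists_isMaxOn ⟨x0, mem_closedBall_self hR.le⟩ hQc
  have hQxs : 0 < Q xs := by
    refine lt_of_lt_of_le ?_ (hmaxs (mem_closedBall_self hR.le))
    simp only [hQ, hrx, hpx0]
    simp
    linarith
  have hxsB : xs ∈ B := hsub hxs
  obtain ⟨hu0, hu1⟩ := hu01 xs hxsB
  obtain ⟨q1, q2, q3, q4, q5, q6, q7, q8⟩ := hx0 xs hxs
  have hpos : 0 < u xs := by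
    rcases hu0.lt_or_eq with h | h
    · exact h
    · exfalso
      have hmin : IsLocalMin u xs := by
        filter_upwards [isOpen_ball.mem_nhds hxsB] with y hy
        rw [← h]; exact (hu01 y hy).1
      have h1 : gradient u xs = 0 := by
        have : ‖gradient u xs‖ = 0 := by rw [norm_gradient, hmin.fderiv_eq_zero, norm_zero]
        exact norm_eq_zero.mp this
      have h2 : (0:ℝ) ^ p xs = 0 := zero_rpow (hp0.trans_le q1).ne'
      have h3 : 0 ≤ r xs := by rw [hrx]; positivity
      simp only [hQ, h1, ← h, h2] at hQxs
      simp at hQxs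
      linarith
  have hpw0 : 0 < u xs ^ p xs := rpow_pos_of_pos hpos _
  have hball : xs ∈ ball x0 R := by
    rw [mem_ball]
    rcases (mem_closedBall.mp hxs).lt_or_eq with h | h
    · exact h
    · exfalso
      have h1 : ‖gradient u xs‖ ^ 2 ≤ (C:ℝ) ^ 2 := by
        rw [norm_gradient_sq]; exact dd_sum_le hu xs
      have h2 : r xs = (C:ℝ) ^ 2 := by rw [hrx, ← dist_eq_norm, h, hMR]
      have h3 : 0 ≤ K * u xs ^ p xs := by positivity
      have h4 : 0 ≤ Λ * u xs := by positivity
      simp only [hQ, h2] at hQxs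
      linarith
  set g := gradient u xs with hg
  set w := ‖g‖ with hwdef
  have hw2 : K * u xs ^ p xs + Λ * u xs + M * ‖xs - x0‖ ^ 2 < w ^ 2 := by
    simp only [hQ, hrx] at hQxs
    linarith
  have hwpos : 0 < w := by
    have h3 : 0 ≤ K * u xs ^ p xs := by positivity
    have h4 : 0 < Λ * u xs := by positivity
    have h5 : 0 ≤ M * ‖xs - x0‖ ^ 2 := by positivity
    have h6 : w ≠ 0 := by intro h; rw [h] at hw2; norm_num at hw2; linarith
    exact lt_of_le_of_ne (norm_nonneg _) h6.symm
  set e := w⁻¹ • g with he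
  have henorm : ‖e‖ = 1 := by
    rw [he, norm_smul, norm_inv, norm_norm]
    exact inv_mul_cancel₀ hwpos.ne'
  have hdve : dv e u xs = w := by
    rw [dv_inner, ← hg, he, inner_smul_right, real_inner_self_eq_norm_sq, ← hwdef]
    field_simp
  have hdvle : ∀ x, dv e u x ^ 2 ≤ ‖gradient u x‖ ^ 2 := by
    intro x
    have := abs_real_inner_le_norm (gradient u x) e
    rw [henorm, mul_one, ← dv_inner] at this
    exact sq_le_sq' (by linarith [(abs_le.mp this).1]) (abs_le.mp this).2
  have hkey := key_ineq (Ω := {x ∈ B | 0 < u x})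
    (isOpen_ball.inter (isOpen_lt continuous_const hu.continuous)) hu
    (huC1.mono fun x hx => hx.1) hfC hfm hw (quad_contDiff (γ x0) (fderiv ℝ γ x0) (-L) x0)
    (quad_contDiff 0 (0 : EuclideanSpace ℝ (Fin n) →L[ℝ] ℝ) M x0) (K := K) (Λ := Λ) (xs := xs) (e := e)
    ⟨hxsB, hpos⟩ hpos (hp0.trans_le q1) (by
      filter_upwards [isOpen_ball.mem_nhds hball] with x hx
      have h1 := hmaxs (ball_subset_closedBall hx)
      have h2 := hdvle x
      rw [hdve]
      simp only [hQ, mem_setOf_eq] at h1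
      simp only [← hp, ← hr]
      linarith)
  rw [← hp, ← hr, hdve] at hkey
  have hlog : log (u xs) ≤ 0 := log_nonpos hu0 hu1
  set A := K * (p xs * u xs ^ (p xs - 1)) + Λ with hA
  have hA0 : 0 ≤ A := by
    have : 0 ≤ p xs := hp0.le.trans q1
    positivity
  set b := (K * (u xs ^ p xs * log (u xs))) • gradient p xs + gradient r xs with hb
  have hS : ∑ i, (K * (dd i u xs * p xs * u xs ^ (p xs - 1) + dd i p xs * u xs ^ p xs * log (u xs))
        + Λ * dd i u xs + dd i r xs) ^ 2 = ‖A • g + b‖ ^ 2 := by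
    rw [hg, ← sum_sq_coord]
    refine Finset.sum_congr rfl fun i _ => ?_
    rw [hb]
    simp only [PiLp.add_apply, PiLp.smul_apply, gradient_coord, smul_eq_mul, hA]
    ring
  have hrg : ‖gradient r xs‖ ≤ 2 * M * ‖xs - x0‖ := by
    have := quad_gradient_norm 0 (0 : EuclideanSpace ℝ (Fin n) →L[ℝ] ℝ) M x0 xs
    rw [norm_zero, zero_add, abs_of_nonneg hM0] at this
    exact this
  have hbn : ‖b‖ ≤ (√K * P * (2 / p0) + 2 * √M) * w := by
    set h := u xs ^ (p xs / 2) with hh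
    have hh0 : 0 < h := rpow_pos_of_pos hpos _
    have e0 : u xs ^ p xs = h ^ 2 := by
      rw [hh, ← rpow_natCast, ← rpow_mul hu0]; congr 1; push_cast; ring
    have hlh : h * (- log (u xs)) ≤ 2 / p0 := rpow_half_log hpos hp0 q1
    have hsK : √K ^ 2 = K := sq_sqrt hK
    have hsM : √M ^ 2 = M := sq_sqrt hM0
    have h4 : 0 < Λ * u xs := by positivity
    have w1 : √K * h ≤ w := by
      apply le_of_sq_le_sq _ hwpos.le
      rw [mul_pow, hsK, ← e0]
      have h5 : 0 ≤ M * ‖xs - x0‖ ^ 2 := by positivity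
      linarith
    have w2 : √M * ‖xs - x0‖ ≤ w := by
      apply le_of_sq_le_sq _ hwpos.le
      rw [mul_pow, hsM]
      have h5 : 0 ≤ K * u xs ^ p xs := by positivity
      linarith
    have n1 : ‖(K * (u xs ^ p xs * log (u xs))) • gradient p xs‖ ≤ (√K * P * (2 / p0)) * w := by
      rw [norm_smul, Real.norm_eq_abs, abs_mul, abs_mul, abs_of_nonneg hK, abs_of_pos hpw0,
        abs_of_nonpos hlog, e0]
      have hnl : 0 ≤ - log (u xs) := by linarith
      calc K * (h ^ 2 * - log (u xs)) * ‖gradient p xs‖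
          = √K * (√K * h) * (h * - log (u xs)) * ‖gradient p xs‖ := by
            nth_rw 1 [← hsK]; ring
        _ ≤ √K * w * (2 / p0) * P := by gcongr
        _ = _ := by ring
    have n2 : ‖gradient r xs‖ ≤ 2 * √M * w := by
      refine hrg.trans ?_
      calc 2 * M * ‖xs - x0‖ = 2 * √M * (√M * ‖xs - x0‖) := by nth_rw 1 [← hsM]; ring
        _ ≤ _ := by gcongr
    have := norm_add_le ((K * (u xs ^ p xs * log (u xs))) • gradient p xs) (gradient r xs)
    rw [← hb] at this
    linarith
  refine hΛ w (u xs) (p xs) (γ xs) (δ xs) _ _ _ hwpos hpos hu1 q1 q2 q3 q4 q5 q6 ?_ ?_ ?_ hkey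
  · rw [hS, norm_add_sq_real, norm_smul, Real.norm_eq_abs, mul_pow, sq_abs, ← hwdef, inner_smul_left]
    have h1 := abs_real_inner_le_norm g b
    have h2 := (abs_le.mp h1).1
    have h3 : ‖g‖ * ‖b‖ ≤ w * ((√K * P * (2 / p0) + 2 * √M) * w) := by
      rw [← hwdef]; gcongr
    have h4 : A * -(w * ((√K * P * (2 / p0) + 2 * √M) * w)) ≤ A * inner ℝ g b := by
      apply mul_le_mul_of_nonneg_left _ hA0
      linarith
    have h5 := sq_nonneg ‖b‖
    simp only [conj_trivial]
    linarith
  · have := q8 hpos e henorm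
    rw [hdve] at this
    exact this
  · simp only [hp, hr, quad_dd2]
    simp only [← hp, ← hr]
    have hsum : ∑ i, (K * (2 * dd i u xs * dd i p xs * u xs ^ (p xs - 1)
      + 2 * dd i u xs * p xs * dd i p xs * u xs ^ (p xs - 1) * log (u xs)
      + p xs * (p xs - 1) * dd i u xs ^ 2 * u xs ^ (p xs - 2)
      + 2 * -L * u xs ^ p xs * log (u xs)
      + dd i p xs ^ 2 * u xs ^ p xs * log (u xs) ^ 2) + (2 * M + 2)) =
      K * (2 * u xs ^ (p xs - 1) * (∑ i, dd i u xs * dd i p xs)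
        + 2 * p xs * u xs ^ (p xs - 1) * log (u xs) * (∑ i, dd i u xs * dd i p xs)
        + p xs * (p xs - 1) * u xs ^ (p xs - 2) * (∑ i, dd i u xs ^ 2)
        + n * (2 * -L * u xs ^ p xs * log (u xs))
        + u xs ^ p xs * log (u xs) ^ 2 * (∑ i, dd i p xs ^ 2)) + n * (2 * M + 2) := by
      simp only [Finset.sum_add_distrib, Finset.mul_sum, mul_add, Finset.sum_const, Finset.card_univ,
        Fintype.card_fin, nsmul_eq_mul]
      have : ∀ a b c d e f a' b' c' d' e' f': ℝ, a = a' → b = b' → c = c' → d = d' → e = e' → f = f' →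
        a + b + c + d + e + f = a' + b' + c' + d' + e' + f' := by intros; simp [*]
      rw [← add_assoc, ← add_assoc]
      congr 2
      congr 1
      · congr 1
        · congr 1
          · congr 1 <;> exact Finset.sum_congr rfl fun i _ => by ring
          · exact Finset.sum_congr rfl fun i _ => by ring
        · ring
      · exact Finset.sum_congr rfl fun i _ => by ring
    rw [hsum, sum_dd_mul, ← norm_gradient_sq, ← norm_gradient_sq, ← hg, ← hwdef]
    set I := inner ℝ g (gradient p xs) with hI
    have hI1 : |I| ≤ w * P := by
      refine (abs_real_inner_le_norm _ _).trans ?_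
      rw [← hwdef]; gcongr
    have hu1p : 0 < u xs ^ (p xs - 1) := rpow_pos_of_pos hpos _
    have t1 : 2 * u xs ^ (p xs - 1) * I ≤ 2 * w * P * u xs ^ (p xs - 1) := by
      have := mul_le_mul_of_nonneg_left (abs_le.mp hI1).2 hu1p.le
      linarith
    have hpp : 0 ≤ p xs := hp0.le.trans q1
    have t2 : 2 * p xs * u xs ^ (p xs - 1) * log (u xs) * I ≤ 2 * w * P * u xs ^ (p xs - 1) * (- log (u xs)) := by
      have h1 : p xs * (-I) ≤ w * P := by
        have h2 : p xs * (-I) ≤ p xs * (w * P) := mul_le_mul_of_nonneg_left (by linarith [(abs_le.mp hI1).1]) hpp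
        have h3 : p xs * (w * P) ≤ 1 * (w * P) := mul_le_mul_of_nonneg_right (q2.trans q3) (by positivity)
        linarith
      have hnn : 0 ≤ u xs ^ (p xs - 1) * (- log (u xs)) := mul_nonneg hu1p.le (by linarith)
      have := mul_le_mul_of_nonneg_left h1 hnn
      linarith
    have t3 : u xs ^ p xs * log (u xs) ^ 2 * ‖gradient p xs‖ ^ 2 ≤ P ^ 2 * u xs ^ p xs * log (u xs) ^ 2 := by
      have : ‖gradient p xs‖ ^ 2 ≤ P ^ 2 := by gcongr
      have := mul_le_mul_of_nonneg_left this (by positivity : 0 ≤ u xs ^ p xs * log (u xs) ^ 2)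
      linarith
    refine add_le_add (mul_le_mul_of_nonneg_left ?_ hK) (le_of_eq (by ring))
    linarith



/-- the standing assumptions -/
structure Standing {n : ℕ} (δ γ u : EuclideanSpace ℝ (Fin n) → ℝ) (C : NNReal) : Prop where
  hu : LipschitzWith C u
  hu01 : ∀ x ∈ ball (0 : EuclideanSpace ℝ (Fin n)) 1, 0 ≤ u x ∧ u x ≤ 1
  huC1 : ContDiffOn ℝ 1 u (ball (0 : EuclideanSpace ℝ (Fin n)) 1)
  hδC1 : ContDiffOn ℝ 1 δ (ball (0 : EuclideanSpace ℝ (Fin n)) 1)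
  hγC1 : ContDiffOn ℝ 1 γ (ball (0 : EuclideanSpace ℝ (Fin n)) 1)
  hδm : Measurable δ
  hγm : Measurable γ
  hδ : ∀ x ∈ ball (0 : EuclideanSpace ℝ (Fin n)) 1, 0 < δ x
  hγ : ∀ x ∈ ball (0 : EuclideanSpace ℝ (Fin n)) 1, 0 < γ x ∧ γ x < 1
  hw : WeakEq {x ∈ ball (0 : EuclideanSpace ℝ (Fin n)) 1 | 0 < u x} u
      (fun x => γ x * δ x * u x ^ (γ x - 1))
  hδW2 : ∃ L, LipschitzOnWith L (fun x => gradient δ x)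
      (ball (0 : EuclideanSpace ℝ (Fin n)) 1)
  hγW2 : ∃ L, LipschitzOnWith L (fun x => gradient γ x)
      (ball (0 : EuclideanSpace ℝ (Fin n)) 1)

lemma f_contDiffOn {n : ℕ} {δ γ u : EuclideanSpace ℝ (Fin n) → ℝ}
    (huC1 : ContDiffOn ℝ 1 u (ball (0 : EuclideanSpace ℝ (Fin n)) 1))
    (hδC1 : ContDiffOn ℝ 1 δ (ball (0 : EuclideanSpace ℝ (Fin n)) 1))
    (hγC1 : ContDiffOn ℝ 1 γ (ball (0 : EuclideanSpace ℝ (Fin n)) 1)) :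
    ContDiffOn ℝ 1 (fun x => γ x * δ x * u x ^ (γ x - 1))
      {x ∈ ball (0 : EuclideanSpace ℝ (Fin n)) 1 | 0 < u x} := by
  have hs : {x ∈ ball (0 : EuclideanSpace ℝ (Fin n)) 1 | 0 < u x} ⊆ ball 0 1 := fun x hx => hx.1
  refine ((hγC1.mono hs).mul (hδC1.mono hs)).mul ?_
  intro x hx
  exact ((huC1.mono hs) x hx).rpow (((hγC1.mono hs) x hx).sub contDiffWithinAt_const) hx.2.ne'

lemma grad_local {n : ℕ} {δ γ u : EuclideanSpace ℝ (Fin n) → ℝ} {C : NNReal} (S : Standing δ γ u C)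
    {x1 : EuclideanSpace ℝ (Fin n)} (hx1 : x1 ∈ ball (0 : EuclideanSpace ℝ (Fin n)) 1)
    {K : ℝ} (hK : 2 * δ x1 < K) :
    ∃ Λ > 0, ∃ R > 0, ∀ x0 ∈ ball x1 R, ‖gradient u x0‖ ^ 2 ≤ K * u x0 ^ γ x0 + Λ * u x0 := by
  obtain ⟨L, hL⟩ := S.hγW2
  obtain ⟨L', hL'⟩ := S.hδW2
  set B := ball (0 : EuclideanSpace ℝ (Fin n)) 1 with hB
  have hd1 := S.hδ x1 hx1
  obtain ⟨hg1, hg1'⟩ := S.hγ x1 hx1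
  set δ1 := δ x1 with hδ1
  set γ1 := γ x1 with hγ1
  have hK0 : 0 < K := by linarith
  set η := (K / δ1 - 2) / 2 with hη
  have hηK : (2 + 2 * η) * δ1 = K := by rw [hη]; field_simp; ring
  have hη0 : 0 < η := by
    have : 0 < η * δ1 := by nlinarith
    exact pos_of_mul_pos_left this hd1.le
  set c5 := η * δ1 * γ1 * (1 - γ1) with hc5
  have hc50 : 0 < c5 := by
    have : 0 < 1 - γ1 := by linarith
    positivity
  have hcont : ∀ᶠ z : ℝ × ℝ × ℝ in nhds (γ1, δ1, γ1), γ1 / 2 < z.2.2 ∧ z.1 < 1 ∧ 0 < z.1 ∧ 0 < z.2.1 ∧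
      z.2.1 < δ1 + 1 ∧ 0 < K * z.2.2 - (2 + η) * (z.1 * z.2.1) ∧
      c5 < 2 * (K * z.2.2) * (1 - z.2.2) - 4 * (z.1 * z.2.1) * (1 - z.1) := by
    refine Filter.Eventually.and ?_ (Filter.Eventually.and ?_ (Filter.Eventually.and ?_
      (Filter.Eventually.and ?_ (Filter.Eventually.and ?_ (Filter.Eventually.and ?_ ?_)))))
    · exact ContinuousAt.eventually_lt (by fun_prop) (by fun_prop) (by simp; linarith)
    · exact ContinuousAt.eventually_lt (by fun_prop) (by fun_prop) (by simpa using hg1')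
    · exact ContinuousAt.eventually_lt (by fun_prop) (by fun_prop) (by simpa using hg1)
    · exact ContinuousAt.eventually_lt (by fun_prop) (by fun_prop) (by simpa using hd1)
    · exact ContinuousAt.eventually_lt (by fun_prop) (by fun_prop) (by simp)
    · refine ContinuousAt.eventually_lt (by fun_prop) (by fun_prop) ?_
      simp only
      rw [← hηK]
      have : 0 < η * δ1 * γ1 := by positivity
      nlinarith
    · refine ContinuousAt.eventually_lt (by fun_prop) (by fun_prop) ?_
      simp only
      rw [← hηK]
      have : 2 * ((2 + 2 * η) * δ1 * γ1) * (1 - γ1) - 4 * (γ1 * δ1) * (1 - γ1) = 4 * c5 := by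
        rw [hc5]; ring
      linarith
  obtain ⟨ε, hε, hcont⟩ := Metric.eventually_nhds_iff_ball.mp hcont
  set G := ‖fderiv ℝ γ 0‖ + L with hG
  set D := ‖fderiv ℝ δ 0‖ + L' with hD
  have hG0 : 0 ≤ G := by positivity
  have hD0 : 0 ≤ D := by positivity
  have hBn : B ∈ nhds x1 := isOpen_ball.mem_nhds hx1
  obtain ⟨ρ, hρ, hρs⟩ : ∃ ρ > 0, ball x1 ρ ⊆ {x | x ∈ B ∧ |γ x - γ1| < ε / 2 ∧ |δ x - δ1| < ε} := by
    apply Metric.mem_nhds_iff.mp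
    have c1 : ContinuousAt γ x1 := S.hγC1.continuousOn.continuousAt hBn
    have c2 : ContinuousAt δ x1 := S.hδC1.continuousOn.continuousAt hBn
    filter_upwards [hBn, c1.eventually (Metric.ball_mem_nhds _ (half_pos hε)),
      c2.eventually (Metric.ball_mem_nhds _ hε)] with x h1 h2 h3
    rw [Real.dist_eq] at h2 h3
    exact ⟨h1, h2, h3⟩
  set R := min (ρ / 2) (min 1 (ε / (4 * (G + L + 1)))) with hR
  have hR0 : 0 < R := by positivity
  have hR1 : R ≤ 1 := (min_le_right _ _).trans (min_le_left _ _)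
  have hRρ : R ≤ ρ / 2 := min_le_left _ _
  have hRε : (G + L) * R < ε / 2 := by
    have h1 : R ≤ ε / (4 * (G + L + 1)) := (min_le_right _ _).trans (min_le_right _ _)
    rw [le_div_iff₀ (by positivity)] at h1
    nlinarith
  obtain ⟨Λ, hΛ0, hΛ⟩ := grad_core S.hu S.hu01 S.huC1 (f_contDiffOn S.huC1 S.hδC1 S.hγC1)
    (by
      have h1 := S.hγm
      have h2 := S.hδm
      have h3 := S.hu.continuous.measurable
      fun_prop) S.hw (K := K) (P := G + 2 * L) (C2 := 2 * G * (δ1 + 1) + D) (p0 := γ1 / 2) (η := η) (c5 := c5)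
    (L := L) (R := R) hK0.le (by positivity) (by positivity) (by positivity) hη0 hc50 L.2 hR0
  refine ⟨Λ, hΛ0, R, hR0, fun x0 hx0 => ?_⟩
  have hsub : closedBall x0 R ⊆ ball x1 ρ := by
    intro x hx
    rw [mem_closedBall] at hx
    rw [mem_ball] at hx0 ⊢
    have := dist_triangle x x0 x1
    linarith
  have hx0ρ := hρs (hsub (mem_closedBall_self hR0.le))
  refine hΛ x0 (fun x hx => (hρs (hsub hx)).1) fun x hx => ?_
  obtain ⟨hxB, hxγ, hxδ⟩ := hρs (hsub hx)
  have hxn : ‖x - x0‖ ≤ R := by rw [← dist_eq_norm]; exact hx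
  have hgr0 : ‖fderiv ℝ γ x0‖ ≤ G := gradient_bounded hL hx0ρ.1
  set q := quad (γ x0) (fderiv ℝ γ x0) (-L) x0 x with hq
  have hqγ : |q - γ1| < ε := by
    have h1 : |q - γ x0| ≤ (G + L) * R := by
      have e1 : q - γ x0 = fderiv ℝ γ x0 (x - x0) + (-L) * ‖x - x0‖ ^ 2 := by rw [hq, quad]; ring
      rw [e1]
      refine (abs_add_le _ _).trans ?_
      have h2 := (fderiv ℝ γ x0).le_opNorm (x - x0)
      rw [Real.norm_eq_abs] at h2
      have h3 : ‖fderiv ℝ γ x0‖ * ‖x - x0‖ ≤ G * R := by gcongr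
      have h4 : |(-L) * ‖x - x0‖ ^ 2| ≤ L * R := by
        rw [abs_mul, abs_neg, abs_of_nonneg L.coe_nonneg, abs_of_nonneg (by positivity)]
        have : ‖x - x0‖ ^ 2 ≤ R := by
          have : ‖x - x0‖ ^ 2 ≤ R ^ 2 := by gcongr
          nlinarith
        gcongr
      linarith
    have h2 : |q - γ1| ≤ |q - γ x0| + |γ x0 - γ1| := abs_sub_le _ _ _
    linarith [hx0ρ.2.1]
  have hz := hcont (γ x, δ x, q) (by
    rw [mem_ball, Prod.dist_eq, Prod.dist_eq]
    simp only [Real.dist_eq]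
    exact max_lt (by linarith) (max_lt hxδ hqγ))
  obtain ⟨z1, z2, z3, z4, z5, z6, z7⟩ := hz
  simp only at z1 z2 z3 z4 z5 z6 z7
  refine ⟨z1.le, quad_minorant S.hγC1 hL hx0ρ.1 hxB, z2.le, by positivity, by linarith, z7.le, ?_, ?_⟩
  · refine (quad_gradient_norm _ _ _ _ _).trans ?_
    rw [abs_neg, abs_of_nonneg L.coe_nonneg]
    have : 2 * (L:ℝ) * ‖x - x0‖ ≤ 2 * L * 1 := by
      have := hxn.trans hR1
      gcongr
    linarith
  · intro hux e he
    have hn := isOpen_ball.mem_nhds hxB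
    exact f_deriv_lower ((S.hδC1.differentiableOn one_ne_zero).differentiableAt hn)
      ((S.hγC1.differentiableOn one_ne_zero).differentiableAt hn)
      ((S.huC1.differentiableOn one_ne_zero).differentiableAt hn) hux (S.hu01 x hxB).2
      (gradient_bounded hL hxB) (gradient_bounded hL' hxB) z3.le z2.le z4.le z5.le he



lemma integrable_of_tsupp {n : ℕ} {g h : EuclideanSpace ℝ (Fin n) → ℝ} {Ω : Set (EuclideanSpace ℝ (Fin n))}
    (hΩ : IsOpen Ω) (hg : ContinuousOn g Ω) (hh : Continuous h) (hc : HasCompactSupport h)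
    (hs : tsupport h ⊆ Ω) : Integrable (fun x => g x * h x) := by
  have hsup : tsupport (fun x => g x * h x) ⊆ tsupport h := tsupport_mul_subset_right
  refine Continuous.integrable_of_hasCompactSupport ?_ (hc.mul_left (f := g))
  rw [continuous_iff_continuousAt]
  intro x
  by_cases hx : x ∈ tsupport h
  · exact (hg.continuousAt (hΩ.mem_nhds (hs hx))).mul hh.continuousAt
  · have h1 := notMem_tsupport_iff_eventuallyEq.mp (fun h => hx (hsup h))
    exact (continuousAt_const (y := (0:ℝ))).congr h1.symm

/-- truncated power -/
def psi (s τ t : ℝ) : ℝ := t ^ (-s) * Real.smoothTransition (t / τ - 1)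

lemma psi_hasDerivAt {s τ t : ℝ} (ht : 0 < t) :
    HasDerivAt (psi s τ) (-s * t ^ (-s - 1) * Real.smoothTransition (t / τ - 1) +
      t ^ (-s) * (deriv Real.smoothTransition (t / τ - 1) * (1 / τ))) t := by
  have h1 : HasDerivAt (fun t : ℝ => t ^ (-s)) (-s * t ^ (-s - 1)) t :=
    Real.hasDerivAt_rpow_const (Or.inl ht.ne')
  have h2 : HasDerivAt (fun t : ℝ => t / τ - 1) (1 / τ) t :=
    ((hasDerivAt_id t).div_const τ).sub_const 1
  have h3 : DifferentiableAt ℝ Real.smoothTransition (t / τ - 1) :=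
    (Real.smoothTransition.contDiff (n := 1)).differentiable one_ne_zero _
  have h4 := h3.hasDerivAt.comp t h2
  exact h1.mul h4

lemma psi_contDiffAt {s τ t : ℝ} (ht : 0 < t) : ContDiffAt ℝ 1 (psi s τ) t := by
  unfold psi
  refine (contDiffAt_id.rpow_const_of_ne ht.ne').mul ?_
  exact (Real.smoothTransition.contDiff (n := 1)).contDiffAt.comp t
    ((contDiffAt_id.div_const τ).sub contDiffAt_const)

lemma psi_zero {s τ t : ℝ} (hτ : 0 < τ) (ht : t ≤ τ) : psi s τ t = 0 := by
  unfold psi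
  rw [Real.smoothTransition.zero_of_nonpos, mul_zero]
  rw [sub_nonpos, div_le_one hτ]; exact ht

lemma trunc_tsupport {n : ℕ} {φ u : EuclideanSpace ℝ (Fin n) → ℝ} {Ψ : ℝ → ℝ} {τ : ℝ}
    (hu : Continuous u) (hΨ : ∀ t ≤ τ, Ψ t = 0) :
    tsupport (fun x => φ x * Ψ (u x)) ⊆ tsupport φ ∩ {x | τ ≤ u x} := by
  refine subset_inter tsupport_mul_subset_left ?_
  refine closure_minimal ?_ (isClosed_le continuous_const hu)
  intro x hx
  simp only [mem_setOf_eq]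
  by_contra h
  apply hx
  simp [hΨ (u x) (not_le.mp h).le]

set_option maxHeartbeats 1000000 in
lemma test_estimate {n : ℕ} {δ γ u φ : EuclideanSpace ℝ (Fin n) → ℝ} {C : NNReal} (S : Standing δ γ u C)
    {s K Λ κ τ : ℝ} (hs : 0 < s) (hK : 0 ≤ K) (hΛ : 0 ≤ Λ) (hτ : 0 < τ)
    (hφ : ContDiff ℝ 1 φ) (hφ0 : ∀ x, 0 ≤ φ x) (hφc : HasCompactSupport φ)
    (hφB : tsupport φ ⊆ ball (0 : EuclideanSpace ℝ (Fin n)) 1)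
    (h1 : ∀ x ∈ tsupport φ, ‖gradient u x‖ ^ 2 ≤ K * u x ^ γ x + Λ * u x)
    (h2 : ∀ x ∈ tsupport φ, 0 < u x → κ * u x ^ γ x ≤ γ x * δ x * u x ^ γ x - s * ‖gradient u x‖ ^ 2)
    (h3 : ∀ x ∈ tsupport φ, 2 * s ≤ γ x) :
    Integrable (fun x => u x ^ (γ x - 1 - s) * (φ x * Real.smoothTransition (u x / τ - 1))) ∧
    κ * ∫ x, u x ^ (γ x - 1 - s) * (φ x * Real.smoothTransition (u x / τ - 1)) ≤
      √(K + Λ) * ∫ x, ‖gradient φ x‖ := by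
  set Ω := {x ∈ ball (0 : EuclideanSpace ℝ (Fin n)) 1 | 0 < u x} with hΩdef
  have hΩ : IsOpen Ω := isOpen_ball.inter (isOpen_lt continuous_const S.hu.continuous)
  have huc := S.hu.continuous
  have hΩB : Ω ⊆ ball (0 : EuclideanSpace ℝ (Fin n)) 1 := fun x hx => hx.1
  set ξ : EuclideanSpace ℝ (Fin n) → ℝ := fun x => φ x * psi s τ (u x) with hξ
  have hξs : tsupport ξ ⊆ tsupport φ ∩ {x | τ ≤ u x} := trunc_tsupport huc (fun t ht => psi_zero hτ ht)
  have hξΩ : tsupport ξ ⊆ Ω := fun x hx => ⟨hφB (hξs hx).1, hτ.trans_le (hξs hx).2⟩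
  have hξc : HasCompactSupport ξ := hφc.mul_right
  have hudiff : ∀ x ∈ Ω, ContDiffAt ℝ 1 u x := fun x hx => S.huC1.contDiffAt (isOpen_ball.mem_nhds hx.1)
  have hξC : ContDiff ℝ 1 ξ := by
    apply contDiff_tsupp
    intro x hx
    have hx' := hξΩ hx
    exact hφ.contDiffAt.mul ((psi_contDiffAt hx'.2).comp x (hudiff x hx'))
  have hfC := f_contDiffOn S.huC1 S.hδC1 S.hγC1
  rw [← hΩdef] at hfC
  have hweak := S.hw ξ hξC hξc hξΩ
  -- integrability
  have i1 : Integrable (fun x => (γ x * δ x * u x ^ (γ x - 1)) * ξ x) :=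
    integrable_of_tsupp hΩ hfC.continuousOn hξC.continuous hξc hξΩ
  have i2 : Integrable (fun x => ∑ i, dd i u x * dd i ξ x) := by
    refine integrable_finsetSum _ fun i _ => ?_
    exact integrable_of_tsupp hΩ (dv_continuousOn hΩ (S.huC1.mono hΩB) _)
      (dv_contDiff (k := 0) hξC (by norm_num)).continuous (dv_compact hξc) (dv_tsupport.trans hξΩ)
  have hgφ : Integrable (fun x => ‖gradient φ x‖) := by
    simp_rw [norm_gradient]
    refine Continuous.integrable_of_hasCompactSupport ?_ ?_
    · exact (hφ.continuous_fderiv one_ne_zero).norm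
    · exact (hφc.fderiv (𝕜 := ℝ)).norm
  have iW : Integrable (fun x => u x ^ (γ x - 1 - s) * (φ x * Real.smoothTransition (u x / τ - 1))) := by
    refine integrable_of_tsupp hΩ ?_ ?_ ?_ ?_
    · refine huc.continuousOn.rpow (((S.hγC1.continuousOn.mono hΩB).sub continuousOn_const).sub continuousOn_const)
        (fun x hx => Or.inl hx.2.ne')
    · exact hφ.continuous.mul (Real.smoothTransition.continuous.comp ((huc.div_const τ).sub continuous_const))
    · exact hφc.mul_right
    · have : tsupport (fun x => φ x * Real.smoothTransition (u x / τ - 1)) ⊆ tsupport φ ∩ {x | τ ≤ u x} := by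
        refine trunc_tsupport (Ψ := fun t => Real.smoothTransition (t / τ - 1)) huc (fun t ht => ?_)
        apply Real.smoothTransition.zero_of_nonpos
        rw [sub_nonpos, div_le_one hτ]; exact ht
      exact fun x hx => ⟨hφB (this hx).1, hτ.trans_le (this hx).2⟩
  refine ⟨iW, ?_⟩
  have hE : ∫ x, ((∑ i, dd i u x * dd i ξ x) + (γ x * δ x * u x ^ (γ x - 1)) * ξ x) = 0 := by
    rw [integral_add i2 i1, hweak]; ring
  have hlow : ∀ x, κ * (u x ^ (γ x - 1 - s) * (φ x * Real.smoothTransition (u x / τ - 1)))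
      - √(K + Λ) * ‖gradient φ x‖ ≤
      (∑ i, dd i u x * dd i ξ x) + (γ x * δ x * u x ^ (γ x - 1)) * ξ x := by
    intro x
    by_cases hx : x ∈ Ω ∧ x ∈ tsupport φ
    · obtain ⟨hxΩ, hxφ⟩ := hx
      have hpos : 0 < u x := hxΩ.2
      have hu1 := (S.hu01 x hxΩ.1).2
      obtain ⟨hγ0, hγ1⟩ := S.hγ x hxΩ.1
      set χ := Real.smoothTransition (u x / τ - 1) with hχ
      have hχ0 : 0 ≤ χ := Real.smoothTransition.nonneg _
      have hχ1 : χ ≤ 1 := Real.smoothTransition.le_one _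
      set d := deriv Real.smoothTransition (u x / τ - 1) with hd
      have hd0 : 0 ≤ d := Real.smoothTransition.monotone.deriv_nonneg
      have hdd : ∀ i, dd i ξ x = dd i φ x * psi s τ (u x) + φ x *
          ((-s * u x ^ (-s - 1) * χ + u x ^ (-s) * (d * (1 / τ))) * dd i u x) := by
        intro i
        have a1 := (hφ.differentiable one_ne_zero x).hasFDerivAt
        have a2 := ((hudiff x hxΩ).differentiableAt one_ne_zero).hasFDerivAt
        have a3 := (psi_hasDerivAt (s := s) (τ := τ) hpos).comp_hasFDerivAt x a2
        have a4 := (a1.mul a3).fderiv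
        unfold dd
        change fderiv ℝ (fun x => φ x * (psi s τ ∘ u) x) x _ = _
        have a5 : fderiv ℝ (fun x => φ x * (psi s τ ∘ u) x) x = _ := a4
        rw [a5]
        simp
        ring
      have hsum : ∑ i, dd i u x * dd i ξ x = psi s τ (u x) * inner ℝ (gradient u x) (gradient φ x) +
          φ x * (-s * u x ^ (-s - 1) * χ + u x ^ (-s) * (d * (1 / τ))) * ‖gradient u x‖ ^ 2 := by
        rw [← sum_dd_mul, norm_gradient_sq, Finset.mul_sum, Finset.mul_sum, ← Finset.sum_add_distrib]
        refine Finset.sum_congr rfl fun i _ => ?_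
        rw [hdd]; ring
      rw [hsum]
      have hpsi : psi s τ (u x) = u x ^ (-s) * χ := rfl
      have us0 : 0 < u x ^ (-s) := rpow_pos_of_pos hpos _
      -- first term
      have t1 : - (√(K + Λ) * ‖gradient φ x‖) ≤ psi s τ (u x) * inner ℝ (gradient u x) (gradient φ x) := by
        have b1 : u x ^ (-s) * ‖gradient u x‖ ≤ √(K + Λ) := by
          apply Real.le_sqrt_of_sq_le
          have e1 : (u x ^ (-s)) ^ 2 = u x ^ (-2 * s) := by
            rw [← rpow_natCast, ← rpow_mul hpos.le]; congr 1; push_cast; ring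
          rw [mul_pow, e1]
          have b2 := mul_le_mul_of_nonneg_left (h1 x hxφ) (rpow_pos_of_pos hpos (-2 * s)).le
          have b3 : u x ^ (-2 * s) * u x ^ γ x ≤ 1 := by
            rw [← rpow_add hpos]; exact rpow_le_one hpos.le hu1 (by linarith [h3 x hxφ])
          have b4 : u x ^ (-2 * s) * u x ≤ 1 := by
            rw [← rpow_add_one hpos.ne']; exact rpow_le_one hpos.le hu1 (by linarith [h3 x hxφ])
          have b5 := mul_le_mul_of_nonneg_left b3 hK
          have b6 := mul_le_mul_of_nonneg_left b4 hΛ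
          linarith
        have b7 := (abs_le.mp (abs_real_inner_le_norm (gradient u x) (gradient φ x))).1
        rw [hpsi]
        have b8 : u x ^ (-s) * χ * (‖gradient u x‖ * ‖gradient φ x‖) ≤ √(K + Λ) * ‖gradient φ x‖ := by
          calc u x ^ (-s) * χ * (‖gradient u x‖ * ‖gradient φ x‖)
              = χ * ((u x ^ (-s) * ‖gradient u x‖) * ‖gradient φ x‖) := by ring
            _ ≤ 1 * (√(K + Λ) * ‖gradient φ x‖) := by gcongr
            _ = _ := one_mul _
        have b9 := mul_le_mul_of_nonneg_left b7 (by positivity : 0 ≤ u x ^ (-s) * χ)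
        linarith
      -- second term
      have e1 : u x ^ (-s) = u x ^ (-s - 1) * u x := by rw [← rpow_add_one hpos.ne']; congr 1; ring
      have e2 : u x ^ (γ x - 1 - s) = u x ^ (-s - 1) * u x ^ γ x := by rw [← rpow_add hpos]; congr 1; ring
      have e3 : u x ^ (γ x - 1) * u x = u x ^ γ x := by rw [← rpow_add_one hpos.ne']; congr 1; ring
      have t2 : κ * (u x ^ (γ x - 1 - s) * (φ x * χ)) ≤
          φ x * (-s * u x ^ (-s - 1) * χ + u x ^ (-s) * (d * (1 / τ))) * ‖gradient u x‖ ^ 2 +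
          γ x * δ x * u x ^ (γ x - 1) * ξ x := by
        have c0 : 0 ≤ φ x * (u x ^ (-s) * (d * (1 / τ))) * ‖gradient u x‖ ^ 2 := by
          have := hφ0 x
          positivity
        have c1 : 0 ≤ φ x * χ * u x ^ (-s - 1) := by
          have := hφ0 x
          have := (rpow_pos_of_pos hpos (-s - 1)).le
          positivity
        have c2 := mul_le_mul_of_nonneg_left (h2 x hxφ hpos) c1
        have c3 : γ x * δ x * u x ^ (γ x - 1) * ξ x = φ x * χ * u x ^ (-s - 1) * (γ x * δ x * u x ^ γ x) := by
          simp only [hξ]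
          rw [hpsi, e1, ← e3]; ring
        rw [c3, e2]
        linarith
      linarith
    · have hx' : x ∉ tsupport ξ := fun h => hx ⟨hξΩ h, (hξs h).1⟩
      have z1 : ξ x = 0 := image_eq_zero_of_notMem_tsupport hx'
      have z2 : ∀ i, dd i ξ x = 0 := fun i => image_eq_zero_of_notMem_tsupport (fun h => hx' (dv_tsupport h))
      have z3 : φ x * Real.smoothTransition (u x / τ - 1) = 0 := by
        by_cases hpos : 0 < u x
        · have : φ x * (u x ^ (-s) * Real.smoothTransition (u x / τ - 1)) = 0 := z1
          have us0 : u x ^ (-s) ≠ 0 := (rpow_pos_of_pos hpos _).ne'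
          rcases mul_eq_zero.mp this with h | h
          · simp [h]
          · rcases mul_eq_zero.mp h with h | h
            · exact absurd h us0
            · simp [h]
        · rw [Real.smoothTransition.zero_of_nonpos, mul_zero]
          have : u x / τ ≤ 0 := div_nonpos_of_nonpos_of_nonneg (not_lt.mp hpos) hτ.le
          linarith
      simp only [z1, z2, z3, mul_zero, Finset.sum_const_zero, add_zero]
      have : 0 ≤ √(K + Λ) * ‖gradient φ x‖ := by positivity
      linarith
  have hintg := integral_mono ((iW.const_mul κ).sub (hgφ.const_mul (√(K + Λ)))) (i2.add i1) hlow
  simp only [Pi.sub_apply, Pi.add_apply] at hintg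
  rw [hE, integral_sub (iW.const_mul κ) (hgφ.const_mul _), integral_const_mul, integral_const_mul] at hintg
  linarith



lemma local_integrable {n : ℕ} {δ γ u : EuclideanSpace ℝ (Fin n) → ℝ} {C : NNReal} (S : Standing δ γ u C)
    {x1 : EuclideanSpace ℝ (Fin n)} (hx1 : x1 ∈ ball (0 : EuclideanSpace ℝ (Fin n)) 1) (hux1 : u x1 = 0) :
    ∃ r > 0, IntegrableOn (fun x => (u x) ^ (-(γ x) / 2))
      ({x ∈ ball (0 : EuclideanSpace ℝ (Fin n)) 1 | 0 < u x} ∩ ball x1 r) := by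
  set B := ball (0 : EuclideanSpace ℝ (Fin n)) 1 with hB
  have hd1 := S.hδ x1 hx1
  obtain ⟨hg1, hg1'⟩ := S.hγ x1 hx1
  set δ1 := δ x1 with hδ1
  set γ1 := γ x1 with hγ1
  obtain ⟨s, hs1, hs2⟩ : ∃ s, max (3 * γ1 / 2 - 1) 0 < s ∧ s < γ1 / 2 :=
    exists_between (max_lt (by linarith) (by linarith))
  have hs0 : 0 < s := (le_max_right _ _).trans_lt hs1
  have hs3 : 3 * γ1 / 2 - 1 < s := (le_max_left _ _).trans_lt hs1
  obtain ⟨K, hK1, hK2⟩ : ∃ K, 2 * δ1 < K ∧ K < γ1 * δ1 / s := by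
    apply exists_between
    rw [lt_div_iff₀ hs0]
    nlinarith
  rw [lt_div_iff₀ hs0] at hK2
  have hK0 : 0 < K := by linarith
  set κ := (γ1 * δ1 - K * s) / 4 with hκ
  have hκ0 : 0 < κ := by rw [hκ]; linarith
  obtain ⟨Λ, hΛ0, R, hR0, hgrad⟩ := grad_local S hx1 hK1
  have hBn : B ∈ nhds x1 := isOpen_ball.mem_nhds hx1
  have c1 : ContinuousAt γ x1 := S.hγC1.continuousOn.continuousAt hBn
  have c2 : ContinuousAt δ x1 := S.hδC1.continuousOn.continuousAt hBn
  have c3 : ContinuousAt u x1 := S.hu.continuous.continuousAt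
  have c4 : ContinuousAt (fun x => u x ^ (1 - γ x)) x1 :=
    c3.rpow (continuousAt_const.sub c1) (Or.inr (by simp only [← hγ1]; linarith))
  obtain ⟨ρ, hρ, hρs⟩ : ∃ ρ > 0, ball x1 ρ ⊆ {x | x ∈ B ∧ x ∈ ball x1 R ∧ 3 * γ x / 2 - 1 < s ∧ s < γ x / 2 ∧
      K * s + 2 * κ < γ x * δ x ∧ s * Λ * u x ^ (1 - γ x) < κ} := by
    apply Metric.mem_nhds_iff.mp
    have d1 : ∀ᶠ x in nhds x1, 3 * γ x / 2 - 1 < s :=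
      ContinuousAt.eventually_lt (((c1.const_mul 3).div_const 2).sub_const 1) continuousAt_const hs3
    have d2 : ∀ᶠ x in nhds x1, s < γ x / 2 :=
      ContinuousAt.eventually_lt continuousAt_const (c1.div_const 2) hs2
    have d3 : ∀ᶠ x in nhds x1, K * s + 2 * κ < γ x * δ x :=
      ContinuousAt.eventually_lt continuousAt_const (c1.mul c2) (by rw [← hγ1, ← hδ1, hκ]; linarith)
    have d4 : ∀ᶠ x in nhds x1, s * Λ * u x ^ (1 - γ x) < κ :=
      ContinuousAt.eventually_lt (c4.const_mul (s * Λ)) continuousAt_const (by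
        rw [hux1, zero_rpow (by rw [← hγ1]; linarith)]; simpa using hκ0)
    filter_upwards [hBn, Metric.ball_mem_nhds x1 hR0, d1, d2, d3, d4] with x a1 a2 a3 a4 a5 a6
    exact ⟨a1, a2, a3, a4, a5, a6⟩
  let φ : ContDiffBump x1 := ⟨ρ / 4, ρ / 2, by positivity, by linarith⟩
  have hφs : tsupport φ ⊆ ball x1 ρ := by
    rw [φ.tsupport_eq]
    exact closedBall_subset_ball (by change ρ / 2 < ρ; linarith)
  have htest := fun (τ : ℝ) (hτ : 0 < τ) => test_estimate (φ := φ) (τ := τ) (κ := κ) (s := s) S hs0 hK0.le hΛ0.le hτ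
    (φ.contDiff (n := 1)) (fun x => φ.nonneg) φ.hasCompactSupport (fun x hx => (hρs (hφs hx)).1)
    (fun x hx => hgrad x (hρs (hφs hx)).2.1)
    (by
      intro x hx hpos
      obtain ⟨-, a2, -, -, a5, a6⟩ := hρs (hφs hx)
      have g1 := hgrad x a2
      have hup : 0 < u x ^ γ x := rpow_pos_of_pos hpos _
      have e1 : u x = u x ^ (1 - γ x) * u x ^ γ x := by
        rw [← rpow_add hpos]; simp
      have g2 := mul_le_mul_of_nonneg_left g1 hs0.le
      have g3 := mul_le_mul_of_nonneg_right a6.le hup.le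
      have g4 := mul_le_mul_of_nonneg_right a5.le hup.le
      have g5 : s * Λ * u x = s * Λ * u x ^ (1 - γ x) * u x ^ γ x := by
        nth_rw 1 [e1]; ring
      nlinarith)
    (fun x hx => by linarith [(hρs (hφs hx)).2.2.2.1])
  set I := √(K + Λ) * (∫ x, ‖gradient φ x‖) / κ with hI
  refine ⟨ρ / 4, by positivity, ?_⟩
  set E := {x ∈ B | 0 < u x} ∩ ball x1 (ρ / 4) with hE
  have hEm : MeasurableSet E :=
    ((isOpen_ball.inter (isOpen_lt continuous_const S.hu.continuous)).inter isOpen_ball).measurableSet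
  have hfm : Measurable (fun x => (u x) ^ (-(γ x) / 2)) := by
    have h1 := S.hγm
    have h3 := S.hu.continuous.measurable
    fun_prop
  have hSm : ∀ k : ℕ, MeasurableSet {x | 2 / ((k:ℝ) + 1) ≤ u x} := fun k =>
    (isClosed_le continuous_const S.hu.continuous).measurableSet
  have hcover : AECover (volume.restrict E) Filter.atTop (fun k : ℕ => {x | 2 / ((k:ℝ) + 1) ≤ u x}) := by
    refine ⟨?_, hSm⟩
    rw [ae_restrict_iff' hEm]
    filter_upwards with x hx
    have hpos : 0 < u x := hx.1.2
    have h1 : Filter.Tendsto (fun k : ℕ => 2 * (1 / ((k:ℝ) + 1))) Filter.atTop (nhds (2 * 0)) :=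
      tendsto_one_div_add_atTop_nhds_zero_nat.const_mul 2
    rw [mul_zero] at h1
    filter_upwards [h1.eventually (gt_mem_nhds hpos)] with k hk
    change 2 / ((k:ℝ) + 1) ≤ u x
    rw [mul_one_div] at hk
    exact hk.le
  have hpt : ∀ k : ℕ, ∀ x ∈ {x | 2 / ((k:ℝ) + 1) ≤ u x} ∩ E, (u x) ^ (-(γ x) / 2) ≤
      u x ^ (γ x - 1 - s) * (φ x * Real.smoothTransition (u x / (1 / ((k:ℝ) + 1)) - 1)) := by
    rintro k x ⟨hxk, hxE⟩
    have hpos : 0 < u x := hxE.1.2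
    have hx4 : x ∈ ball x1 ρ := ball_subset_ball (by linarith) hxE.2
    obtain ⟨-, -, a3, -, -, -⟩ := hρs hx4
    have h1 : φ x = 1 := φ.one_of_mem_closedBall (ball_subset_closedBall hxE.2)
    have h2 : Real.smoothTransition (u x / (1 / ((k:ℝ) + 1)) - 1) = 1 := by
      apply Real.smoothTransition.one_of_one_le
      change 2 / ((k:ℝ) + 1) ≤ u x at hxk
      rw [div_le_iff₀ (by positivity)] at hxk
      rw [div_div_eq_mul_div, div_one]
      linarith
    rw [h1, h2, mul_one, mul_one]
    exact rpow_le_rpow_of_exponent_ge hpos (S.hu01 x hxE.1.1).2 (by linarith)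
  have hnn : ∀ x ∈ E, 0 ≤ (u x) ^ (-(γ x) / 2) := fun x hx => (rpow_pos_of_pos hx.1.2 _).le
  have hWnn : ∀ k : ℕ, ∀ x, 0 ≤ u x ^ (γ x - 1 - s) * (φ x * Real.smoothTransition (u x / (1 / ((k:ℝ) + 1)) - 1)) := by
    intro k x
    have h2 : 0 ≤ Real.smoothTransition (u x / (1 / ((k:ℝ) + 1)) - 1) := Real.smoothTransition.nonneg _
    by_cases hpos : 0 ≤ u x
    · have := φ.nonneg (x := x)
      have := rpow_nonneg hpos (γ x - 1 - s)
      positivity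
    · have : Real.smoothTransition (u x / (1 / ((k:ℝ) + 1)) - 1) = 0 := by
        apply Real.smoothTransition.zero_of_nonpos
        have : u x / (1 / ((k:ℝ) + 1)) ≤ 0 := div_nonpos_of_nonpos_of_nonneg (not_le.mp hpos).le (by positivity)
        linarith
      rw [this]; simp
  have hfi : ∀ k : ℕ, IntegrableOn (fun x => (u x) ^ (-(γ x) / 2)) ({x | 2 / ((k:ℝ) + 1) ≤ u x} ∩ E) := by
    intro k
    refine Integrable.mono' (htest (1 / ((k:ℝ) + 1)) (by positivity)).1.integrableOn
      hfm.aestronglyMeasurable ?_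
    rw [ae_restrict_iff' ((hSm k).inter hEm)]
    filter_upwards with x hx
    rw [Real.norm_eq_abs, abs_of_nonneg (hnn x hx.2)]
    exact hpt k x hx
  refine hcover.integrable_of_integral_bounded_of_nonneg_ae I ?_ ?_ ?_
  · intro k
    rw [IntegrableOn, Measure.restrict_restrict (hSm k)]
    exact hfi k
  · rw [ae_restrict_iff' hEm]
    filter_upwards with x hx using hnn x hx
  · refine Filter.Eventually.of_forall fun k => ?_
    rw [Measure.restrict_restrict (hSm k)]
    have ht := htest (1 / ((k:ℝ) + 1)) (by positivity)
    calc ∫ x in {x | 2 / ((k:ℝ) + 1) ≤ u x} ∩ E, (u x) ^ (-(γ x) / 2)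
        ≤ ∫ x in {x | 2 / ((k:ℝ) + 1) ≤ u x} ∩ E,
          u x ^ (γ x - 1 - s) * (φ x * Real.smoothTransition (u x / (1 / ((k:ℝ) + 1)) - 1)) :=
          setIntegral_mono_on (hfi k) ht.1.integrableOn ((hSm k).inter hEm) (hpt k)
      _ ≤ ∫ x, u x ^ (γ x - 1 - s) * (φ x * Real.smoothTransition (u x / (1 / ((k:ℝ) + 1)) - 1)) :=
          setIntegral_le_integral ht.1 (Filter.Eventually.of_forall (hWnn k))
      _ ≤ I := by
          rw [hI, le_div_iff₀ hκ0, mul_comm]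
          exact ht.2

lemma local_integrable_pos {n : ℕ} {δ γ u : EuclideanSpace ℝ (Fin n) → ℝ} {C : NNReal} (S : Standing δ γ u C)
    {x1 : EuclideanSpace ℝ (Fin n)} (hx1 : x1 ∈ ball (0 : EuclideanSpace ℝ (Fin n)) 1) (hux1 : 0 < u x1) :
    ∃ r > 0, IntegrableOn (fun x => (u x) ^ (-(γ x) / 2))
      ({x ∈ ball (0 : EuclideanSpace ℝ (Fin n)) 1 | 0 < u x} ∩ ball x1 r) := by
  have hBn := isOpen_ball.mem_nhds hx1
  have c1 : ContinuousAt γ x1 := S.hγC1.continuousOn.continuousAt hBn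
  have c3 : ContinuousAt u x1 := S.hu.continuous.continuousAt
  have c4 : ContinuousAt (fun x => u x ^ (-(γ x) / 2)) x1 :=
    c3.rpow (c1.neg.div_const 2) (Or.inl hux1.ne')
  obtain ⟨r, hr, hrs⟩ := Metric.mem_nhds_iff.mp (c4.eventually (Metric.ball_mem_nhds _ one_pos))
  refine ⟨r, hr, IntegrableOn.mono_set ?_ inter_subset_right⟩
  have hfm : Measurable (fun x => (u x) ^ (-(γ x) / 2)) := by
    have h1 := S.hγm
    have h3 := S.hu.continuous.measurable
    fun_prop
  refine Measure.integrableOn_of_bounded (M := |u x1 ^ (-(γ x1) / 2)| + 1) measure_ball_lt_top.ne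
    hfm.aestronglyMeasurable ?_
  rw [ae_restrict_iff' measurableSet_ball]
  filter_upwards with x hx
  have h := hrs hx
  have h' : dist (u x ^ (-(γ x) / 2)) (u x1 ^ (-(γ x1) / 2)) < 1 := h
  rw [Real.dist_eq] at h'
  rw [Real.norm_eq_abs]
  have := abs_sub_abs_le_abs_sub (u x ^ (-(γ x) / 2)) (u x1 ^ (-(γ x1) / 2))
  linarith

lemma final_integrable {n : ℕ} {δ γ u : EuclideanSpace ℝ (Fin n) → ℝ} {C : NNReal} (S : Standing δ γ u C) :
    IntegrableOn (fun x => (u x) ^ (-(γ x) / 2))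
      ({x ∈ ball (0 : EuclideanSpace ℝ (Fin n)) 1 | 0 < u x} ∩
        ball (0 : EuclideanSpace ℝ (Fin n)) (1/2)) volume := by
  set Ω := {x ∈ ball (0 : EuclideanSpace ℝ (Fin n)) 1 | 0 < u x} with hΩ
  have hloc : ∀ x1 ∈ closedBall (0 : EuclideanSpace ℝ (Fin n)) (1/2), ∃ r > 0,
      IntegrableOn (fun x => (u x) ^ (-(γ x) / 2)) (Ω ∩ ball x1 r) := by
    intro x1 hx1
    have hx : x1 ∈ ball (0 : EuclideanSpace ℝ (Fin n)) 1 := closedBall_subset_ball (by norm_num) hx1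
    rcases (S.hu01 x1 hx).1.lt_or_eq with h | h
    · exact local_integrable_pos S hx h
    · exact local_integrable S hx h.symm
  have hall := (isCompact_closedBall (0 : EuclideanSpace ℝ (Fin n)) (1/2)).induction_on
    (p := fun s => IntegrableOn (fun x => (u x) ^ (-(γ x) / 2)) (Ω ∩ s) volume) (by simp)
    (fun s t hst ht => ht.mono_set (inter_subset_inter_right _ hst))
    (fun s t hs ht => by rw [inter_union_distrib_left]; exact hs.union ht)
    (fun x hx => by
      obtain ⟨r, hr, h⟩ := hloc x hx
      exact ⟨ball x r, mem_nhdsWithin_of_mem_nhds (ball_mem_nhds x hr), h⟩)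
  exact hall.mono_set (inter_subset_inter_right _ ball_subset_closedBall)


theorem statement14 {n : ℕ} (hn : 2 ≤ n)
    (δ γ : EuclideanSpace ℝ (Fin n) → ℝ)
    (hδm : Measurable δ) (hγm : Measurable γ)
    (hδbd : ∃ M, ∀ x, |δ x| ≤ M) (hγbd : ∃ M, ∀ x, |γ x| ≤ M)
    (δ₀ : ℝ) (hδ₀ : 0 < δ₀)
    (hδlow : ∀ x ∈ ball (0 : EuclideanSpace ℝ (Fin n)) 1, δ₀ ≤ δ x)
    (hγlow : 0 < sInf (γ '' ball (0 : EuclideanSpace ℝ (Fin n)) 1))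
    (hγhigh : sSup (γ '' ball (0 : EuclideanSpace ℝ (Fin n)) 1) < 1)
    (hδC1 : ContDiffOn ℝ 1 δ (ball (0 : EuclideanSpace ℝ (Fin n)) 1))
    (hγC1 : ContDiffOn ℝ 1 γ (ball (0 : EuclideanSpace ℝ (Fin n)) 1))
    (hδW2 : ∃ L, LipschitzOnWith L (fun x => gradient δ x)
      (ball (0 : EuclideanSpace ℝ (Fin n)) 1))
    (hγW2 : ∃ L, LipschitzOnWith L (fun x => gradient γ x)
      (ball (0 : EuclideanSpace ℝ (Fin n)) 1))
    (u : EuclideanSpace ℝ (Fin n) → ℝ)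
    (humin : IsLocalMinimizer δ γ u)
    (hu01 : ∀ x ∈ ball (0 : EuclideanSpace ℝ (Fin n)) 1, 0 ≤ u x ∧ u x ≤ 1)
    (huC1 : ContDiffOn ℝ 1 u (ball (0 : EuclideanSpace ℝ (Fin n)) 1))
    (h0 : (0 : EuclideanSpace ℝ (Fin n)) ∈ freeBoundary u) :
    IntegrableOn (fun x => (u x) ^ (-(γ x) / 2))
      ({x ∈ ball (0 : EuclideanSpace ℝ (Fin n)) 1 | 0 < u x} ∩
        ball (0 : EuclideanSpace ℝ (Fin n)) (1/2)) volume := by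
  have hγ : ∀ x ∈ ball (0 : EuclideanSpace ℝ (Fin n)) 1, 0 < γ x ∧ γ x < 1 := by
    obtain ⟨M, hM⟩ := hγbd
    have hb : BddBelow (γ '' ball (0 : EuclideanSpace ℝ (Fin n)) 1) := by
      refine ⟨-M, ?_⟩
      rintro _ ⟨x, -, rfl⟩
      exact (abs_le.mp (hM x)).1
    have ha : BddAbove (γ '' ball (0 : EuclideanSpace ℝ (Fin n)) 1) := by
      refine ⟨M, ?_⟩
      rintro _ ⟨x, -, rfl⟩
      exact (abs_le.mp (hM x)).2
    intro x hx
    exact ⟨hγlow.trans_le (csInf_le hb (mem_image_of_mem _ hx)),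
      (le_csSup ha (mem_image_of_mem _ hx)).trans_lt hγhigh⟩
  have hδ : ∀ x ∈ ball (0 : EuclideanSpace ℝ (Fin n)) 1, 0 < δ x :=
    fun x hx => hδ₀.trans_le (hδlow x hx)
  obtain ⟨C, hC⟩ := humin.1
  have hw := euler_lagrange hδm hγm hδbd (fun x hx => (hδ x hx).le) hγ huC1
    (f_contDiffOn huC1 hδC1 hγC1).continuousOn humin
  exact final_integrable ⟨hC, hu01, huC1, hδC1, hγC1, hδm, hγm, hδ, hγ, hw, hδW2, hγW2⟩

end
end
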